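/- (Bethe ansatz for the elliptic Calogero–Moser system.) Let N ≥ 2 and p ≥ 1 be integers, m = N(N−1)p/2, and let c : {1,…,m} → {1,…,N−1} be the unique non-decreasing function with |c^{−1}(j)| = (N−j)p for each j. On polynomials in x_1,…,x_N let f_j = x_{j+1}·∂/∂x_j, and for s ∈ S_m define l(s) ∈ ℤ_{≥0} by f_{c(s(1))}∘⋯∘f_{c(s(m))}(x_1^{Np}) = l(s)·(x_1⋯x_N)^p. Fix τ ∈ H₊, ξ ∈ ℂ^N, and t = (t_1,…,t_m) ∈ ℂ^m with t_i ∉ ℤ+τℤ for all i and t_i − t_j ∉ ℤ+τℤ for all i ≠ j, satisfying the Bethe ansatz equations: for every j ∈ {1,…,m}, ∑_{l : |c(l)−c(j)|=1} ρ(t_j−t_l,τ) − 2∑_{l≠j, c(l)=c(j)} ρ(t_j−t_l,τ) + Np·δ_{c(j),1}·ρ(t_j,τ) = 2πi(ξ_{c(j)} − ξ_{c(j)+1}). For λ ∈ ℂ^N and s ∈ S_m with l(s) ≠ 0 set w_j(s,λ) = ∑_{l=1}^{j} (λ_{c(s(l))} − λ_{c(s(l))+1}), and define (with the convention t_{s(m+1)}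 = 0) ψ(λ) = exp(2πi∑_{j=1}^N ξ_j λ_j) · ∑_{s∈S_m} l(s) ∏_{j=1}^{m} σ_{w_j(s,λ)}( t_{s(j)} − t_{s(j+1)}, τ ). Then for every λ ∈ ℂ^N such that w_j(s,λ) ∉ ℤ+τℤ for all j and all s with l(s) ≠ 0, ψ is an eigenfunction of the elliptic Calogero–Moser Hamiltonian: −∑_{i=1}^{N} ∂²_{λ_i} ψ(λ) − 2p(p+1) ∑_{i<j} ∂_tρ(λ_i−λ_j,τ)·ψ(λ) = ε·ψ(λ), where ε = 4π²∑_{j=1}^N ξ_j² − 4πi·[ ∑_{i<j} (2δ_{c(i),c(j)} − δ_{|c(i)−c(j)|,1})·(∂_τE/E)(t_i−t_j,τ) − Np ∑_{i : c(i)=1} (∂_τE/E)(t_i,τ) ]. -/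

import Mathlib

open Complex Filter Topology MeasureTheory

noncomputable section

/-- Jacobi's theta function `ϑ₁(t,τ)`. -/
def theta1 (t τ : ℂ) : ℂ :=
  -∑' j : ℤ, Complex.exp ((Real.pi : ℂ) * Complex.I * ((j : ℂ) + 1/2)^2 * τ +
      2 * (Real.pi : ℂ) * Complex.I * ((j : ℂ) + 1/2) * (t + 1/2))

/-- Derivative of `ϑ₁` in the first argument. -/
def theta1' (t τ : ℂ) : ℂ := deriv (fun s => theta1 s τ) t

/-- Membership in the lattice `ℤ + τℤ`. -/
def inLattice (τ t : ℂ) : Prop := ∃ a b : ℤ, t = (a : ℂ) + (b : ℂ) * τ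

/-- The function `σ_w(t,τ)`. -/
def sigmaF (w t τ : ℂ) : ℂ := theta1 (w - t) τ * theta1' 0 τ / (theta1 w τ * theta1 t τ)

/-- The function `ρ(t,τ) = ϑ₁'(t,τ)/ϑ₁(t,τ)`. -/
def rhoF (t τ : ℂ) : ℂ := theta1' t τ / theta1 t τ

/-- The function `E(t,τ) = ϑ₁(t,τ)/ϑ₁'(0,τ)`. -/
def EF (t τ : ℂ) : ℂ := theta1 t τ / theta1' 0 τ

end

noncomputable section

/-- Zero-extension of a vector `λ ∈ ℂ^N` to a function on `ℕ`
(all accesses below are within range). -/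
def ext {N : ℕ} (lam : Fin N → ℂ) (k : ℕ) : ℂ := if h : k < N then lam ⟨k, h⟩ else 0

/-- The Chevalley generator `f_j = x_{j+1}·∂/∂x_j` on polynomials (0-based indexing:
variable `X k` is the paper's `x_{k+1}`, color `j` is the paper's simple root `α_{j+1}`). -/
def fop (j : ℕ) (P : MvPolynomial ℕ ℂ) : MvPolynomial ℕ ℂ :=
  MvPolynomial.X (j + 1) * MvPolynomial.pderiv j P

/-- The composition `f_{c(s(1))}∘⋯∘f_{c(s(m))}` applied to `x_1^{Np}`. -/
def bethePoly (N p m : ℕ) (c : Fin m → ℕ) (s : Equiv.Perm (Fin m)) : MvPolynomial ℕ ℂ :=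
  (List.finRange m).foldr (fun i P => fop (c (s i)) P) (MvPolynomial.X 0 ^ (N * p))

/-- The weight `w_j(s,λ) = ∑_{l=1}^{j} (λ_{c(s(l))} − λ_{c(s(l))+1})` (0-based). -/
def Wcoef {N m : ℕ} (c : Fin m → ℕ) (s : Equiv.Perm (Fin m)) (lam : Fin N → ℂ)
    (j : Fin m) : ℂ :=
  ∑ i ∈ Finset.univ.filter (fun i : Fin m => i ≤ j),
    (ext lam (c (s i)) - ext lam (c (s i) + 1))

/-- The Bethe ansatz eigenfunction
`ψ(λ) = exp(2πi∑ ξ_j λ_j)·∑_{s∈S_m} l(s) ∏_{j=1}^m σ_{w_j(s,λ)}(t_{s(j)} − t_{s(j+1)}, τ)`,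
with the convention `t_{s(m+1)} = 0`. -/
def psiF {N m : ℕ} (c : Fin m → ℕ) (l : Equiv.Perm (Fin m) → ℕ)
    (τ : ℂ) (ξ : Fin N → ℂ) (t : Fin m → ℂ) (lam : Fin N → ℂ) : ℂ :=
  Complex.exp (2 * (Real.pi : ℂ) * Complex.I * ∑ j : Fin N, ξ j * lam j) *
  ∑ s : Equiv.Perm (Fin m), (l s : ℂ) *
    ∏ j : Fin m, sigmaF (Wcoef c s lam j)
      (t (s j) - if h : (j : ℕ) + 1 < m then t (s ⟨(j : ℕ) + 1, h⟩) else 0) τ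

end

noncomputable section

/-- The `j`-th term of the `k`-th derivative of the theta series. -/
def thTerm (k : ℕ) (j : ℤ) (t τ : ℂ) : ℂ :=
  (2 * (Real.pi : ℂ) * Complex.I * ((j : ℂ) + 1/2)) ^ k *
    Complex.exp ((Real.pi : ℂ) * Complex.I * ((j : ℂ) + 1/2)^2 * τ +
      2 * (Real.pi : ℂ) * Complex.I * ((j : ℂ) + 1/2) * (t + 1/2))

/-- The `k`-th derivative of theta. -/
def Thk (k : ℕ) (t τ : ℂ) : ℂ := -∑' j : ℤ, thTerm k j t τ

lemma theta1_eq_Thk (t τ : ℂ) : theta1 t τ = Thk 0 t τ := by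
  simp [theta1, Thk, thTerm]

lemma thTerm_bound (k : ℕ) {S T U : ℝ} (hT : 0 < T) :
    ∃ u : ℤ → ℝ, Summable u ∧ ∀ j t τ, |t.im| ≤ S → T ≤ τ.im → τ.im ≤ U →
      ‖thTerm k j t τ‖ ≤ u j := by
  have s1 := summable_pow_mul_jacobiTheta₂_term_bound (S + U / 2) hT k
  have s0 := summable_pow_mul_jacobiTheta₂_term_bound (S + U / 2) hT 0
  refine ⟨fun j => (2 * Real.pi) ^ k * (Real.exp (Real.pi * S)) * 2 ^ k *
    ((|j| ^ k : ℝ) * Real.exp (-Real.pi * (T * j ^ 2 - 2 * (S + U / 2) * |j|)) +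
      (|j| ^ 0 : ℝ) * Real.exp (-Real.pi * (T * j ^ 2 - 2 * (S + U / 2) * |j|))), ?_, ?_⟩
  · refine Summable.mul_left _ ?_
    have := s1.add s0
    refine this.congr ?_
    intro j
    simp
  · intro j t τ ht h1 h2
    have e1 : thTerm k j t τ = (2 * (Real.pi : ℂ) * Complex.I * ((j : ℂ) + 1/2)) ^ k *
        (Complex.exp ((Real.pi : ℂ) * Complex.I * (τ / 4 + t + 1/2)) *
          jacobiTheta₂_term j (t + 1/2 + τ/2) τ) := by
      rw [thTerm, jacobiTheta₂_term, ← Complex.exp_add]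
      congr 2
      ring
    have hb := norm_jacobiTheta₂_term_le hT (S := S + U/2) (z := t + 1/2 + τ/2) (τ := τ) (by
      have : (t + 1/2 + τ/2).im = t.im + τ.im / 2 := by
        simp
      rw [this]
      rw [abs_le] at ht ⊢
      constructor <;> linarith [ht.1, ht.2]) h1 j
    rw [e1, norm_mul, norm_mul, norm_pow]
    have n1 : ‖(2 * (Real.pi : ℂ) * Complex.I * ((j : ℂ) + 1/2))‖ ≤ 2 * Real.pi * (|(j:ℝ)| + 1) := by
      rw [norm_mul, norm_mul, norm_mul]
      simp only [Complex.norm_I, mul_one, Complex.norm_ofNat, Complex.norm_real, Real.norm_eq_abs,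
        abs_of_pos Real.pi_pos]
      gcongr
      refine (norm_add_le _ _).trans ?_
      gcongr
      · simp
      · norm_num
    have n2 : ‖Complex.exp ((Real.pi : ℂ) * Complex.I * (τ / 4 + t + 1/2))‖
        ≤ Real.exp (Real.pi * S) := by
      rw [Complex.norm_exp]
      apply Real.exp_le_exp.mpr
      have : ((Real.pi : ℂ) * Complex.I * (τ / 4 + t + 1/2)).re = - Real.pi * (τ.im / 4 + t.im) := by
        simp [Complex.mul_re]
      rw [this]
      have := (abs_le.mp ht).1
      nlinarith [Real.pi_pos]
    have n3 : (|(j:ℝ)| + 1) ^ k ≤ 2 ^ k * (|(j:ℝ)| ^ k + |(j:ℝ)| ^ 0) := by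
      have h := add_pow_le (a := |(j:ℝ)|) (b := 1) (abs_nonneg _) zero_le_one k
      refine h.trans ?_
      simp only [one_pow, pow_zero]
      have : (2:ℝ) ^ (k - 1) ≤ 2 ^ k := pow_le_pow_right₀ (by norm_num) (Nat.sub_le _ _)
      gcongr
    calc _ ≤ (2 * Real.pi * (|(j:ℝ)| + 1)) ^ k * (Real.exp (Real.pi * S) *
          Real.exp (-Real.pi * (T * j ^ 2 - 2 * (S + U / 2) * |j|))) := by
            gcongr
      _ = (2 * Real.pi) ^ k * Real.exp (Real.pi * S) * ((|(j:ℝ)| + 1) ^ k) *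
          Real.exp (-Real.pi * (T * j ^ 2 - 2 * (S + U / 2) * |j|)) := by
            rw [mul_pow]; ring
      _ ≤ (2 * Real.pi) ^ k * Real.exp (Real.pi * S) * (2 ^ k * (|(j:ℝ)| ^ k + |(j:ℝ)| ^ 0)) *
          Real.exp (-Real.pi * (T * j ^ 2 - 2 * (S + U / 2) * |j|)) := by
            gcongr
      _ = _ := by push_cast; ring

lemma thTerm_hasDerivAt_t (k : ℕ) (j : ℤ) (t τ : ℂ) :
    HasDerivAt (fun s => thTerm k j s τ) (thTerm (k+1) j t τ) t := by
  have : HasDerivAt (fun s : ℂ => (Real.pi : ℂ) * Complex.I * ((j : ℂ) + 1/2)^2 * τ +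
      2 * (Real.pi : ℂ) * Complex.I * ((j : ℂ) + 1/2) * (s + 1/2))
      (2 * (Real.pi : ℂ) * Complex.I * ((j : ℂ) + 1/2)) t := by
    simpa using (((hasDerivAt_id t).add_const (1/2 : ℂ)).const_mul
      (2 * (Real.pi : ℂ) * Complex.I * ((j : ℂ) + 1/2))).const_add
      ((Real.pi : ℂ) * Complex.I * ((j : ℂ) + 1/2)^2 * τ)
  have h := (this.cexp).const_mul ((2 * (Real.pi : ℂ) * Complex.I * ((j : ℂ) + 1/2)) ^ k)
  have h' : HasDerivAt (fun s => thTerm k j s τ) _ t := h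
  exact h'.congr_deriv (by rw [thTerm, pow_succ]; ring)

lemma thTerm_hasDerivAt_tau (k : ℕ) (j : ℤ) (t τ : ℂ) :
    HasDerivAt (fun s => thTerm k j t s) (thTerm (k+2) j t τ / (4 * Real.pi * Complex.I)) τ := by
  have : HasDerivAt (fun s : ℂ => (Real.pi : ℂ) * Complex.I * ((j : ℂ) + 1/2)^2 * s +
      2 * (Real.pi : ℂ) * Complex.I * ((j : ℂ) + 1/2) * (t + 1/2))
      ((Real.pi : ℂ) * Complex.I * ((j : ℂ) + 1/2)^2) τ := by
    simpa using ((hasDerivAt_id τ).const_mul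
      ((Real.pi : ℂ) * Complex.I * ((j : ℂ) + 1/2)^2)).add_const
      (2 * (Real.pi : ℂ) * Complex.I * ((j : ℂ) + 1/2) * (t + 1/2))
  have h := (this.cexp).const_mul ((2 * (Real.pi : ℂ) * Complex.I * ((j : ℂ) + 1/2)) ^ k)
  have h' : HasDerivAt (fun s => thTerm k j t s) _ τ := h
  refine h'.congr_deriv ?_
  have hp : (Real.pi : ℂ) ≠ 0 := by exact_mod_cast Real.pi_ne_zero
  rw [thTerm, pow_add]
  field_simp
  ring

lemma summable_thTerm (k : ℕ) (t : ℂ) {τ : ℂ} (hτ : 0 < τ.im) :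
    Summable (fun j => thTerm k j t τ) := by
  obtain ⟨u, hu, hb⟩ := thTerm_bound k (S := |t.im|) (U := τ.im) hτ
  exact Summable.of_norm_bounded hu (fun j => hb j t τ le_rfl le_rfl le_rfl)

lemma summable_norm_thTerm (k : ℕ) (t : ℂ) {τ : ℂ} (hτ : 0 < τ.im) :
    Summable (fun j => ‖thTerm k j t τ‖) := (summable_thTerm k t hτ).norm

lemma Thk_hasDerivAt_t (k : ℕ) (t : ℂ) {τ : ℂ} (hτ : 0 < τ.im) :
    HasDerivAt (fun s => Thk k s τ) (Thk (k+1) t τ) t := by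
  obtain ⟨u, hu, hb⟩ := thTerm_bound k (S := |t.im| + 1) (U := τ.im) hτ
  have ho : IsOpen {s : ℂ | |s.im| < |t.im| + 1} :=
    isOpen_lt (by fun_prop) continuous_const
  have hmem : t ∈ {s : ℂ | |s.im| < |t.im| + 1} := by simp
  have hd : ∀ j : ℤ, DifferentiableOn ℂ (fun s => thTerm k j s τ) {s : ℂ | |s.im| < |t.im| + 1} :=
    fun j s _ => (thTerm_hasDerivAt_t k j s τ).differentiableAt.differentiableWithinAt
  have h1 := differentiableOn_tsum_of_summable_norm hu hd ho
    (fun j s hs => hb j s τ (le_of_lt hs) le_rfl le_rfl)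
  have h2 := hasSum_deriv_of_summable_norm hu hd ho
    (fun j s hs => hb j s τ (le_of_lt hs) le_rfl le_rfl) hmem
  have h3 := (h1.differentiableAt (ho.mem_nhds hmem)).hasDerivAt
  have h4 : deriv (fun w => ∑' j : ℤ, thTerm k j w τ) t = ∑' j, thTerm (k+1) j t τ := by
    rw [← h2.tsum_eq]
    exact tsum_congr fun j => (thTerm_hasDerivAt_t k j t τ).deriv
  rw [h4] at h3
  exact h3.neg

lemma Thk_hasDerivAt_tau (k : ℕ) (t : ℂ) {τ : ℂ} (hτ : 0 < τ.im) :
    HasDerivAt (fun s => Thk k t s) (Thk (k+2) t τ / (4 * Real.pi * Complex.I)) τ := by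
  have hT : 0 < τ.im / 2 := by linarith
  obtain ⟨u, hu, hb⟩ := thTerm_bound k (S := |t.im|) (U := 2 * τ.im) hT
  have ho : IsOpen {s : ℂ | τ.im / 2 < s.im ∧ s.im < 2 * τ.im} :=
    (isOpen_lt continuous_const Complex.continuous_im).inter
      (isOpen_lt Complex.continuous_im continuous_const)
  have hmem : τ ∈ {s : ℂ | τ.im / 2 < s.im ∧ s.im < 2 * τ.im} := by
    constructor <;> linarith
  have hd : ∀ j : ℤ, DifferentiableOn ℂ (fun s => thTerm k j t s)
      {s : ℂ | τ.im / 2 < s.im ∧ s.im < 2 * τ.im} :=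
    fun j s _ => (thTerm_hasDerivAt_tau k j t s).differentiableAt.differentiableWithinAt
  have h1 := differentiableOn_tsum_of_summable_norm hu hd ho
    (fun j s hs => hb j t s le_rfl hs.1.le hs.2.le)
  have h2 := hasSum_deriv_of_summable_norm hu hd ho
    (fun j s hs => hb j t s le_rfl hs.1.le hs.2.le) hmem
  have h3 := (h1.differentiableAt (ho.mem_nhds hmem)).hasDerivAt
  have h4 : deriv (fun w => ∑' j : ℤ, thTerm k j t w) τ
      = (∑' j, thTerm (k+2) j t τ) / (4 * Real.pi * Complex.I) := by
    rw [← h2.tsum_eq, ← tsum_div_const]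
    exact tsum_congr fun j => (thTerm_hasDerivAt_tau k j t τ).deriv
  rw [h4] at h3
  have h' : HasDerivAt (fun s => Thk k t s) _ τ := h3.neg
  exact h'.congr_deriv (by rw [Thk]; ring)

lemma Thk_one (t : ℂ) {τ : ℂ} (hτ : 0 < τ.im) : theta1' t τ = Thk 1 t τ := by
  rw [theta1']
  simp only [theta1_eq_Thk]
  exact (Thk_hasDerivAt_t 0 t hτ).deriv

end

noncomputable section

def eqvA : (ℤ × ℤ) ⊕ (ℤ × ℤ) ≃ ℤ × ℤ where
  toFun u := match u with
    | Sum.inl q => (q.1 + q.2, q.1 - q.2 - 1)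
    | Sum.inr q => (q.1 + q.2, q.1 - q.2)
  invFun q := if (q.1 + q.2) % 2 = 0 then Sum.inr ((q.1 + q.2) / 2, (q.1 - q.2) / 2)
    else Sum.inl ((q.1 + q.2 + 1) / 2, (q.1 - q.2 - 1) / 2)
  left_inv u := by
    rcases u with ⟨a, b⟩ | ⟨a, b⟩
    · have h : ¬ ((a + b + (a - b - 1)) % 2 = 0) := by omega
      simp only [h, if_false]
      congr 2 <;> omega
    · have h : ((a + b + (a - b)) % 2 = 0) := by omega
      simp only [h, if_true]
      congr 2 <;> omega
  right_inv q := by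
    rcases q with ⟨a, b⟩
    by_cases h : (a + b) % 2 = 0
    · simp only [h, if_true]
      ext <;> simp <;> omega
    · simp only [h, if_false]
      ext <;> simp <;> omega

def thA (τ x : ℂ) : ℂ := jacobiTheta₂ (2 * x) (2 * τ)
def thB (τ x : ℂ) : ℂ := Complex.exp (Real.pi * I * τ / 2 + 2 * Real.pi * I * x) *
  jacobiTheta₂ (2 * x + τ) (2 * τ)

lemma exp_int_pi (n : ℤ) : Complex.exp (2 * Real.pi * I * n) = 1 := by
  rw [show 2 * (Real.pi : ℂ) * I * n = n * (2 * Real.pi * I) by ring]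
  exact Complex.exp_int_mul_two_pi_mul_I n

lemma theta_prod {τ : ℂ} (hτ : 0 < τ.im) (x y : ℂ) :
    theta1 (x + y) τ * theta1 (x - y) τ = thA τ x * thB τ y - thB τ x * thA τ y := by
  have hT : 0 < (2 * τ).im := by simpa using hτ
  have sA : ∀ z, Summable fun n => ‖jacobiTheta₂_term n z (2 * τ)‖ := fun z =>
    ((summable_jacobiTheta₂_term_iff z (2 * τ)).2 hT).norm
  have s1 := summable_norm_thTerm 0 (x + y) hτ
  have s2 := summable_norm_thTerm 0 (x - y) hτ
  rw [theta1_eq_Thk, theta1_eq_Thk, Thk, Thk, neg_mul_neg,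
    tsum_mul_tsum_of_summable_norm s1 s2]
  have ss := (summable_mul_of_summable_norm s1 s2)
  rw [← eqvA.tsum_eq]
  have ss' := (eqvA.summable_iff).2 ss
  rw [show (fun c : (ℤ × ℤ) ⊕ (ℤ × ℤ) => thTerm 0 (eqvA c).1 (x + y) τ * thTerm 0 (eqvA c).2 (x - y) τ) =
    ((fun x_1 : ℤ × ℤ => thTerm 0 x_1.1 (x + y) τ * thTerm 0 x_1.2 (x - y) τ) ∘ eqvA) from rfl]
  rw [Summable.tsum_sum (ss'.comp_injective Sum.inl_injective) (ss'.comp_injective Sum.inr_injective)]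
  refine (congrArg₂ (· + ·) ?_ ?_).trans (sub_eq_add_neg _ _).symm
  · rw [thA, thB, jacobiTheta₂, jacobiTheta₂, mul_left_comm, tsum_mul_tsum_of_summable_norm (sA _) (sA _),
      ← tsum_mul_left]
    refine tsum_congr fun q => ?_
    rcases q with ⟨a, b⟩
    simp only [Function.comp, eqvA, Equiv.coe_fn_mk, thTerm, jacobiTheta₂_term, pow_zero, one_mul]
    rw [← Complex.exp_add, ← Complex.exp_add, ← Complex.exp_add]
    have : ∀ u : ℂ, Complex.exp u = Complex.exp (u + 2 * Real.pi * I * a) := by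
      intro u
      rw [Complex.exp_add, exp_int_pi]; ring
    conv_rhs => rw [this]
    congr 1
    push_cast
    ring
  · rw [thA, thB, jacobiTheta₂, jacobiTheta₂, mul_assoc, tsum_mul_tsum_of_summable_norm (sA _) (sA _),
      ← tsum_mul_left, ← tsum_neg]
    refine tsum_congr fun q => ?_
    rcases q with ⟨a, b⟩
    simp only [Function.comp, eqvA, Equiv.coe_fn_mk, thTerm, jacobiTheta₂_term, pow_zero, one_mul]
    rw [← Complex.exp_add, ← Complex.exp_add, ← Complex.exp_add]
    have : ∀ u : ℂ, -Complex.exp u = Complex.exp (u + 2 * Real.pi * I * a + Real.pi * I) := by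
      intro u
      rw [Complex.exp_add, Complex.exp_add, exp_int_pi, Complex.exp_pi_mul_I]; ring
    rw [this]
    congr 1
    push_cast
    ring

lemma theta_three {τ : ℂ} (hτ : 0 < τ.im) (x y u v : ℂ) :
    theta1 (x + y) τ * theta1 (x - y) τ * (theta1 (u + v) τ * theta1 (u - v) τ)
    - theta1 (x + u) τ * theta1 (x - u) τ * (theta1 (y + v) τ * theta1 (y - v) τ)
    + theta1 (x + v) τ * theta1 (x - v) τ * (theta1 (y + u) τ * theta1 (y - u) τ) = 0 := by
  simp only [theta_prod hτ]; ring

lemma theta_odd (τ x : ℂ) : theta1 (-x) τ = - theta1 x τ := by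
  rw [theta1, theta1, neg_neg]
  let e : ℤ ≃ ℤ := ⟨fun j => -1 - j, fun j => -1 - j, fun j => by simp, fun j => by simp⟩
  rw [← e.tsum_eq, ← tsum_neg]
  refine tsum_congr fun j => ?_
  have : ∀ u : ℂ, -Complex.exp u = Complex.exp (u + 2 * Real.pi * I * (j : ℂ) + Real.pi * I) := by
    intro u
    rw [Complex.exp_add, Complex.exp_add, exp_int_pi, Complex.exp_pi_mul_I]; ring
  rw [this]
  congr 1
  simp only [e, Equiv.coe_fn_mk]
  push_cast
  ring

lemma theta_add_one (τ x : ℂ) : theta1 (x + 1) τ = - theta1 x τ := by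
  rw [theta1, theta1, neg_neg, ← tsum_neg]
  refine tsum_congr fun j => ?_
  have : Complex.exp (Real.pi * I * ((j:ℂ) + 1/2)^2 * τ +
      2 * (Real.pi : ℂ) * Complex.I * ((j : ℂ) + 1/2) * (x + 1 + 1/2)) =
    Complex.exp ((Real.pi * I * ((j:ℂ) + 1/2)^2 * τ +
      2 * (Real.pi : ℂ) * Complex.I * ((j : ℂ) + 1/2) * (x + 1/2)) + 2 * Real.pi * I * j + Real.pi * I) := by
    congr 1; ring
  rw [this, Complex.exp_add, Complex.exp_add _ (2 * Real.pi * I * j), exp_int_pi, Complex.exp_pi_mul_I]; ring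

lemma theta_add_tau (τ x : ℂ) : theta1 (x + τ) τ =
    - Complex.exp (-(Real.pi * I * τ) - 2 * Real.pi * I * x) * theta1 x τ := by
  rw [theta1, theta1, neg_mul_neg, ← tsum_mul_left, ← tsum_neg]
  conv_rhs => rw [← (Equiv.addRight (1:ℤ)).tsum_eq]
  refine tsum_congr fun j => ?_
  rw [← Complex.exp_add]
  have : ∀ u : ℂ, -Complex.exp u = Complex.exp (u + Real.pi * I) := by
    intro u
    rw [Complex.exp_add, Complex.exp_pi_mul_I]; ring
  rw [this]
  congr 1
  simp only [Equiv.coe_addRight]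
  push_cast
  ring
end

noncomputable section

/-- An abstract odd theta-like function with its first three derivatives. -/
structure TH where
  th : ℂ → ℂ
  th1 : ℂ → ℂ
  th2 : ℂ → ℂ
  th3 : ℂ → ℂ
  d0 : ∀ x, HasDerivAt th (th1 x) x
  d1 : ∀ x, HasDerivAt th1 (th2 x) x
  d2 : ∀ x, HasDerivAt th2 (th3 x) x
  odd : ∀ x, th (-x) = - th x
  three : ∀ x y u v : ℂ, th (x + y) * th (x - y) * (th (u + v) * th (u - v))
    - th (x + u) * th (x - u) * (th (y + v) * th (y - v))
    + th (x + v) * th (x - v) * (th (y + u) * th (y - u)) = 0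
  k0 : th1 0 ≠ 0

namespace TH
variable (T : TH)

def kap : ℂ := T.th3 0 / T.th1 0
def rho (x : ℂ) : ℂ := T.th1 x / T.th x
def rho' (x : ℂ) : ℂ := T.th2 x / T.th x - T.rho x ^ 2
def eta (x : ℂ) : ℂ := T.th2 x / T.th x - T.kap
def sig (w x : ℂ) : ℂ := T.th (w - x) * T.th1 0 / (T.th w * T.th x)
def phi (w x : ℂ) : ℂ := T.rho (w - x) - T.rho w
def phi' (w x : ℂ) : ℂ := T.rho' (w - x) - T.rho' w

lemma th_zero : T.th 0 = 0 := by
  have := T.odd 0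
  rw [neg_zero] at this
  exact self_eq_neg.mp this

lemma even1 (x : ℂ) : T.th1 (-x) = T.th1 x := by
  have h1 : HasDerivAt (fun y => T.th (-y)) (T.th1 (-x) * (-1)) x :=
    (T.d0 (-x)).comp x (hasDerivAt_neg x)
  have h2 : HasDerivAt (fun y => T.th (-y)) (-(T.th1 x)) x := by
    simp only [T.odd]; exact (T.d0 x).neg
  have := h1.unique h2
  linear_combination -this

lemma odd2 (x : ℂ) : T.th2 (-x) = -T.th2 x := by
  have h1 : HasDerivAt (fun y => T.th1 (-y)) (T.th2 (-x) * (-1)) x :=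
    (T.d1 (-x)).comp x (hasDerivAt_neg x)
  have h2 : HasDerivAt (fun y => T.th1 (-y)) ((T.th2 x)) x := by
    simp only [T.even1]; exact (T.d1 x)
  have := h1.unique h2
  linear_combination -this

lemma th2_zero : T.th2 0 = 0 := by
  have := T.odd2 0
  rw [neg_zero] at this
  exact self_eq_neg.mp this

lemma rho_neg (x : ℂ) : T.rho (-x) = - T.rho x := by
  simp [rho, T.odd, T.even1, div_neg]
lemma rho'_neg (x : ℂ) : T.rho' (-x) = T.rho' x := by
  simp [rho', T.odd, T.odd2, T.rho_neg]
lemma eta_neg (x : ℂ) : T.eta (-x) = T.eta x := by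
  simp [eta, T.odd, T.odd2]
lemma rho_zero : T.rho 0 = 0 := by simp [rho, T.th_zero]
lemma ne_neg {x : ℂ} (h : T.th x ≠ 0) : T.th (-x) ≠ 0 := by
  rw [T.odd]; exact neg_ne_zero.mpr h
lemma ne_symm {x y : ℂ} (h : T.th (x - y) ≠ 0) : T.th (y - x) ≠ 0 := by
  rw [← neg_sub]; exact T.ne_neg h
lemma rho_sub (x y : ℂ) : T.rho (x - y) = - T.rho (y - x) := by
  rw [← neg_sub y x, T.rho_neg]
lemma rho'_sub (x y : ℂ) : T.rho' (x - y) = T.rho' (y - x) := by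
  rw [← neg_sub y x, T.rho'_neg]
lemma eta_sub (x y : ℂ) : T.eta (x - y) = T.eta (y - x) := by
  rw [← neg_sub y x, T.eta_neg]
lemma eta_eq (x : ℂ) : T.eta x = T.rho' x + T.rho x ^ 2 - T.kap := by
  rw [eta, rho']; ring

lemma dA (f : ℂ → ℂ) (f' x a : ℂ) (h : HasDerivAt f f' (a + x)) :
   HasDerivAt (fun v => f (a + v)) f' x := HasDerivAt.comp_const_add a x h
lemma dS (f : ℂ → ℂ) (f' x a : ℂ) (h : HasDerivAt f f' (a - x)) :
   HasDerivAt (fun v => f (a - v)) (-f') x := HasDerivAt.comp_const_sub a x h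

lemma s4 (a b c : ℂ) : T.th1 0 * (T.th (a + b) * T.th (a + c) * T.th (b + c))
    - T.th a * T.th (a + b + c) * (T.th1 c * T.th b + T.th c * T.th1 b)
    - (T.th1 a * T.th (a + b + c) - T.th a * T.th1 (a + b + c)) * (T.th c * T.th b) = 0 := by
  have key : ∀ x y u : ℂ, T.th (x + y) * T.th (x - y) * (T.th (u + u) * (- T.th1 0))
    - T.th (x + u) * T.th (x - u) * (T.th1 (y + u) * T.th (y - u) - T.th (y + u) * T.th1 (y - u))
    + (T.th1 (x + u) * T.th (x - u) - T.th (x + u) * T.th1 (x - u)) * (T.th (y + u) * T.th (y - u)) = 0 := by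
    intro x y u
    have hd := ((((dA T.th _ u u (T.d0 _)).mul (dS T.th _ u u (T.d0 _))).const_mul
        (T.th (x + y) * T.th (x - y))).sub
      (((dA T.th _ u y (T.d0 _)).mul (dS T.th _ u y (T.d0 _))).const_mul
        (T.th (x + u) * T.th (x - u)))).add
      (((dA T.th _ u x (T.d0 _)).mul (dS T.th _ u x (T.d0 _))).mul_const
        (T.th (y + u) * T.th (y - u)))
    have h0 : HasDerivAt (fun _ : ℂ => (0:ℂ)) 0 u := hasDerivAt_const u 0
    have := hd.unique (h0.congr_of_eventuallyEq (Eventually.of_forall fun v => T.three x y u v))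
    rw [sub_self, T.th_zero] at this
    linear_combination this
  have := key (a + (b + c)/2) ((b - c)/2) (-(b+c)/2)
  rw [show (a + (b + c)/2) + ((b - c)/2) = a + b by ring,
    show (a + (b + c)/2) - ((b - c)/2) = a + c by ring,
    show -(b+c)/2 + -(b+c)/2 = -(b + c) by ring,
    show (a + (b + c)/2) + (-(b+c)/2) = a by ring,
    show (a + (b + c)/2) - (-(b+c)/2) = a + b + c by ring,
    show ((b - c)/2) + (-(b+c)/2) = -c by ring,
    show ((b - c)/2) - (-(b+c)/2) = b by ring, T.odd, T.odd, T.even1] at this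
  linear_combination this

lemma d2poly (a c : ℂ) : T.th1 0 ^ 2 * (T.th (a + c) * T.th (a - c)) =
    T.th c ^ 2 * (T.th a * T.th2 a - T.th1 a ^ 2) - T.th a ^ 2 * (T.th c * T.th2 c - T.th1 c ^ 2) := by
  have e1 : HasDerivAt (fun b => T.th (a + b)) (T.th1 0) (-a) := by
    apply dA; rw [add_neg_cancel]; exact T.d0 _
  have e2 : HasDerivAt (fun b => T.th (b + c)) (T.th1 (-a + c)) (-a) :=
    HasDerivAt.comp_add_const (-a) c (T.d0 _)
  have e3 : HasDerivAt (fun b => T.th (a + b + c)) (T.th1 c) (-a) := by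
    have := HasDerivAt.comp_add_const (-a) (a + c) (T.d0 (-a + (a + c)))
    rw [show -a + (a + c) = c by ring] at this
    exact this.congr_of_eventuallyEq (Eventually.of_forall fun b => by
      show T.th (a + b + c) = T.th (b + (a + c)); congr 1; ring)
  have e4 : HasDerivAt (fun b => T.th1 (a + b + c)) (T.th2 c) (-a) := by
    have := HasDerivAt.comp_add_const (-a) (a + c) (T.d1 (-a + (a + c)))
    rw [show -a + (a + c) = c by ring] at this
    exact this.congr_of_eventuallyEq (Eventually.of_forall fun b => by
      show T.th1 (a + b + c) = T.th1 (b + (a + c)); congr 1; ring)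
  have hd := ((((e1.mul_const (T.th (a + c))).mul e2).const_mul (T.th1 0)).sub
     ((e3.const_mul (T.th a)).mul (((T.d0 (-a)).const_mul (T.th1 c)).add
      ((T.d1 (-a)).const_mul (T.th c))))).sub
     (((e3.const_mul (T.th1 a)).sub (e4.const_mul (T.th a))).mul ((T.d0 (-a)).const_mul (T.th c)))
  have h0 : HasDerivAt (fun _ : ℂ => (0:ℂ)) 0 (-a) := hasDerivAt_const _ 0
  have := hd.unique (h0.congr_of_eventuallyEq (Eventually.of_forall fun v => T.s4 a v c))
  simp only [Pi.add_apply, Pi.sub_apply] at this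
  rw [show -a + c = -(a - c) by ring, show a + -a + c = c by ring, add_neg_cancel, T.th_zero, T.odd, T.odd, T.even1, T.odd2, T.even1] at this
  linear_combination -this

lemma k3poly (a b : ℂ) : T.th (a + b) * T.th b * T.th2 a + T.th (a + b) * T.th a * T.th2 b
   + T.th a * T.th b * T.th2 (a + b) - T.kap * (T.th a * T.th b * T.th (a + b))
   + 2 * (T.th1 a * T.th1 b * T.th (a + b) - T.th1 (a + b) * (T.th1 a * T.th b + T.th a * T.th1 b)) = 0 := by
  have e0 := fun c => T.d0 c
  have f0 := fun c => T.d1 c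
  have g0 := fun c => T.d2 c
  have ea := fun c => dA T.th _ c a (T.d0 _)
  have fa := fun c => dA T.th1 _ c a (T.d1 _)
  have eb := fun c => dA T.th _ c b (T.d0 _)
  have fb := fun c => dA T.th1 _ c b (T.d1 _)
  have es := fun c => dA T.th _ c (a + b) (T.d0 _)
  have fs := fun c => dA T.th1 _ c (a + b) (T.d1 _)
  have gs := fun c => dA T.th2 _ c (a + b) (T.d2 _)
  have G1 : ∀ c, _ = (0:ℂ) := fun c => by
    have hd := ((((ea c).const_mul (T.th (a + b))).mul (eb c)).const_mul (T.th1 0)).sub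
      (((es c).const_mul (T.th a)).mul (((f0 c).mul_const (T.th b)).add
      ((e0 c).mul_const (T.th1 b)))) |>.sub
      ((((es c).const_mul (T.th1 a)).sub ((fs c).const_mul (T.th a))).mul ((e0 c).mul_const (T.th b)))
    have h0 : HasDerivAt (fun _ : ℂ => (0:ℂ)) 0 c := hasDerivAt_const _ 0
    exact hd.unique (h0.congr_of_eventuallyEq (Eventually.of_forall fun v => T.s4 a b v))
  have c0 : (0:ℂ) = 0 := rfl
  have hd2 := ((((ea 0).mul (eb 0)).const_mul (T.th1 0 * T.th (a + b))))
  have hA := (((fa 0).const_mul (T.th (a + b))).mul (eb 0)).add (((ea 0).const_mul (T.th (a + b))).mul (fb 0)) |>.const_mul (T.th1 0)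
  have hB := (((fs 0).const_mul (T.th a)).mul (((f0 0).mul_const (T.th b)).add
      ((e0 0).mul_const (T.th1 b)))).add (((es 0).const_mul (T.th a)).mul (((g0 0).mul_const (T.th b)).add
      ((f0 0).mul_const (T.th1 b))))
  have hC := ((((fs 0).const_mul (T.th1 a)).sub ((gs 0).const_mul (T.th a))).mul ((e0 0).mul_const (T.th b))).add
     ((((es 0).const_mul (T.th1 a)).sub ((fs 0).const_mul (T.th a))).mul ((f0 0).mul_const (T.th b)))
  have h0 : HasDerivAt (fun _ : ℂ => (0:ℂ)) 0 0 := hasDerivAt_const _ 0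
  have := ((hA.sub hB).sub hC).unique (h0.congr_of_eventuallyEq (Eventually.of_forall fun v => G1 v))
  simp only [Pi.add_apply, Pi.sub_apply, add_zero, T.th_zero, T.th2_zero] at this
  have hk : T.th3 0 = T.kap * T.th1 0 := by rw [kap, div_mul_cancel₀ _ T.k0]
  rw [hk] at this
  apply mul_left_cancel₀ T.k0
  linear_combination this
end TH
end

noncomputable section
namespace TH
variable (T : TH)

lemma S4 {a b c d : ℂ} (hd : d = a + b + c) (ha : T.th a ≠ 0) (hb : T.th b ≠ 0) (hc : T.th c ≠ 0)
    (h : T.th d ≠ 0) : T.rho a + T.rho b + T.rho c - T.rho d =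
      T.th1 0 * (T.th (a + b) * T.th (a + c) * T.th (b + c)) / (T.th a * T.th b * T.th c * T.th d) := by
  have := T.s4 a b c
  rw [← hd] at this
  simp only [rho]
  field_simp
  linear_combination -this

lemma D2 {a c : ℂ} (ha : T.th a ≠ 0) (hc : T.th c ≠ 0) : T.rho' a - T.rho' c =
    T.th1 0 ^ 2 * (T.th (a + c) * T.th (a - c)) / (T.th a ^ 2 * T.th c ^ 2) := by
  have := T.d2poly a c
  simp only [rho', rho]
  field_simp
  linear_combination -this

/-- `σ_w(δ)σ_w(−δ) = ρ'(δ) − ρ'(w)` -/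
lemma sigpm {w x : ℂ} (hw : T.th w ≠ 0) (hx : T.th x ≠ 0) :
    T.sig w x * T.sig w (-x) = T.rho' x - T.rho' w := by
  rw [T.D2 hx hw]
  simp only [sig, T.odd x, sub_neg_eq_add]
  rw [show T.th (w - x) = - T.th (x - w) by rw [← T.odd, neg_sub], add_comm w x]
  field_simp
  
lemma K3 {a b c : ℂ} (h : c = a + b) (ha : T.th a ≠ 0) (hb : T.th b ≠ 0) (hc : T.th c ≠ 0) :
    T.eta a + T.eta b + T.eta c + 2 * T.kap +
      2 * (T.rho a * T.rho b - T.rho c * (T.rho a + T.rho b)) = 0 := by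
  have := T.k3poly a b
  rw [← h] at this
  simp only [eta, rho]
  field_simp
  linear_combination this

lemma fay {a b x y : ℂ} (ha : T.th a ≠ 0) (hb : T.th b ≠ 0) (hab : T.th (a + b) ≠ 0)
    (hx : T.th x ≠ 0) (hy : T.th y ≠ 0) (hxy : T.th (x - y) ≠ 0) :
    T.sig a x * T.sig b y = T.sig (a + b) x * T.sig b (y - x) + T.sig (a + b) y * T.sig a (x - y) := by
  have e := T.three ((a+b+y-x)/2) ((a+b-y+x)/2) ((a+b-x-y)/2) ((a-b-x+y)/2)
  rw [show (a+b+y-x)/2 + (a+b-y+x)/2 = a + b by ring, show (a+b+y-x)/2 - (a+b-y+x)/2 = -(x - y) by ring,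
    show (a+b-x-y)/2 + (a-b-x+y)/2 = a - x by ring, show (a+b-x-y)/2 - (a-b-x+y)/2 = b - y by ring,
    show (a+b+y-x)/2 + (a+b-x-y)/2 = a + b - x by ring, show (a+b+y-x)/2 - (a+b-x-y)/2 = y by ring,
    show (a+b-y+x)/2 + (a-b-x+y)/2 = a by ring, show (a+b-y+x)/2 - (a-b-x+y)/2 = b - (y - x) by ring,
    show (a+b+y-x)/2 + (a-b-x+y)/2 = a - (x - y) by ring, show (a+b+y-x)/2 - (a-b-x+y)/2 = b by ring,
    show (a+b-y+x)/2 + (a+b-x-y)/2 = a + b - y by ring, show (a+b-y+x)/2 - (a+b-x-y)/2 = x by ring,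
    T.odd (x - y)] at e
  simp only [sig]
  rw [show T.th (y - x) = - T.th (x - y) by rw [← T.odd, neg_sub]]
  field_simp
  linear_combination -(T.th1 0) ^ 2 * e

lemma dF {w x y z : ℂ} (hz : z = x + y) (hw : T.th w ≠ 0) (hx : T.th x ≠ 0) (hy : T.th y ≠ 0)
    (hxy : T.th z ≠ 0) (hwxy : T.th (w - z) ≠ 0) :
    T.sig w z * (T.phi w z + T.rho x + T.rho y) = T.sig w x * T.sig w y := by
  have := T.S4 (a := w - z) (b := x) (c := y) (d := w) (by rw [hz]; ring) hwxy hx hy hw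
  rw [phi, show T.rho (w - z) - T.rho w + T.rho x + T.rho y = T.rho (w - z) + T.rho x + T.rho y - T.rho w by ring,
    this, show w - z + x = w - y by rw [hz]; ring, show w - z + y = w - x by rw [hz]; ring, ← hz]
  simp only [sig]
  field_simp

lemma sigsig {w w' v x : ℂ} (hv : v = w - w') (hw : T.th w ≠ 0) (hw' : T.th w' ≠ 0) (hv0 : T.th v ≠ 0)
    (hx : T.th x ≠ 0) (hvx : T.th (v - x) ≠ 0) :
    T.sig w x * T.sig w' (-x) = T.sig v x * (T.rho w - T.rho w' - T.rho x - T.rho (v - x)) := by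
  have := T.S4 (a := v - x) (b := w') (c := x) (d := w) (by rw [hv]; ring) hvx hw' hx hw
  rw [show T.rho w - T.rho w' - T.rho x - T.rho (v - x) = -(T.rho (v - x) + T.rho w' + T.rho x - T.rho w) by ring,
    this, show v - x + w' = w - x by rw [hv]; ring, show v - x + x = v by ring]
  simp only [sig, T.odd x, sub_neg_eq_add]
  field_simp

lemma I1 {w x : ℂ} (hw : T.th w ≠ 0) (hx : T.th x ≠ 0) (hwx : T.th (w - x) ≠ 0) :
    T.phi w x ^ 2 + T.phi' w x + 2 * T.rho x * T.phi w x + 2 * T.rho' w + T.eta x = 0 := by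
  have := T.K3 (a := w - x) (b := x) (c := w) (by ring) hwx hx hw
  rw [T.eta_eq, T.eta_eq, T.eta_eq] at this
  rw [phi, phi', T.eta_eq]
  linear_combination this

lemma eta4 {a b c d e : ℂ} (hd : d = a + b + c) (he : e = a + c) (ha : T.th a ≠ 0) (hb : T.th b ≠ 0) (hc : T.th c ≠ 0)
    (h : T.th d ≠ 0) (hac : T.th e ≠ 0) : T.eta b + T.eta d - T.eta a - T.eta c =
      - 2 * T.rho e * (T.rho a + T.rho b + T.rho c - T.rho d) + 2 * T.rho b * T.rho d
        + 2 * T.rho a * T.rho c := by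
  have h1 := T.K3 he ha hc hac
  have h2 := T.K3 (a := d) (b := -b) (c := e) (by rw [hd, he]; ring) h (T.ne_neg hb) hac
  rw [T.eta_neg, T.rho_neg] at h2
  linear_combination h2 - h1

lemma eta3a {y z δ : ℂ} (hd : δ = y - z) (hy : T.th y ≠ 0) (hz : T.th z ≠ 0) (h : T.th δ ≠ 0) :
    T.eta y + T.eta z - T.eta δ = 2 * (T.rho z + T.rho δ) * (T.rho y - T.rho δ) - 2 * T.rho' δ := by
  have h1 := T.K3 (a := δ) (b := z) (c := y) (by rw [hd]; ring) h hz hy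
  have := T.eta_eq δ
  linear_combination h1 - 2 * this

lemma eta3b {x x' δ : ℂ} (hd : x' = x + δ) (hy : T.th x ≠ 0) (hz : T.th x' ≠ 0) (h : T.th δ ≠ 0) :
    T.eta x' - T.eta x - T.eta δ = 2 * (T.rho x' - T.rho x) * (T.rho x' - T.rho δ) + 2 * T.rho' x' := by
  have h1 := T.K3 (a := x) (b := δ) (c := x') hd hy h hz
  have := T.eta_eq x'
  linear_combination -h1 + 2 * this

end TH
end

noncomputable section
namespace TH
variable (T : TH)

lemma cont0 : Continuous T.th := continuous_iff_continuousAt.2 fun x => (T.d0 x).continuousAt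
lemma cont1 : Continuous T.th1 := continuous_iff_continuousAt.2 fun x => (T.d1 x).continuousAt
lemma cont2 : Continuous T.th2 := continuous_iff_continuousAt.2 fun x => (T.d2 x).continuousAt

lemma analytic (x : ℂ) : AnalyticAt ℂ T.th x :=
  Differentiable.analyticAt (fun x => (T.d0 x).differentiableAt) x

lemma punct (x : ℂ) : ∀ᶠ q in 𝓝[≠] x, T.th q ≠ 0 := by
  have h : AnalyticOnNhd ℂ T.th Set.univ := fun x _ => T.analytic x
  rcases (T.analytic x).eventually_eq_zero_or_eventually_ne_zero with h1 | h1
  · exfalso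
    have := h.eqOn_zero_of_preconnected_of_eventuallyEq_zero isPreconnected_univ (Set.mem_univ x) h1
    have h2 : T.th = fun _ => 0 := funext fun y => this (Set.mem_univ y)
    have h3 := T.d0 0
    rw [h2] at h3
    exact T.k0 (h3.unique (hasDerivAt_const _ _))
  · exact h1

/-- coefficient of `d` in the level contribution, equal heights -/
def alphaE (w w' Y Z y z : ℂ) : ℂ :=
  -2 * (T.phi w (y - Y) - T.phi w' (z - Z)) + 2 * T.rho (y - Z) - 2 * T.rho (z - Y) - 4 * T.rho (y - z)
def betaE (w w' Y Z y z : ℂ) : ℂ :=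
  -T.phi w (y - Y) ^ 2 - T.phi w' (z - Z) ^ 2 + 4 * T.phi w (y - Y) * T.phi w' (z - Z)
  - T.phi' w (y - Y) - T.phi' w' (z - Z) + 2 * T.phi w (y - Y) * T.rho (y - Z)
  + 2 * T.phi w' (z - Z) * T.rho (z - Y)
  - 4 * (T.phi w (y - Y) - T.phi w' (z - Z)) * T.rho (y - z)
  + T.eta (y - Z) + T.eta (z - Y) - 2 * T.eta (y - z)
def alphaU (Y Z y z : ℂ) : ℂ :=
  2 * T.rho (y - Z) - 2 * T.rho (z - Y) - 4 * T.rho (y - z)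
def betaU (w w' Y Z y z : ℂ) : ℂ :=
  2 * T.phi w (y - Y) * T.phi w' (z - Z) + 2 * T.phi w (y - Y) * T.rho (y - Z)
  + 2 * T.phi w' (z - Z) * T.rho (z - Y)
  - 4 * (T.phi w (y - Y) - T.phi w' (z - Z)) * T.rho (y - z)
  + T.eta (y - Z) + T.eta (z - Y) - 2 * T.eta (y - z)
def mm (w w' Y Z y z : ℂ) : ℂ := T.sig w (y - Y) * T.sig w' (z - Z)

section eqcase
variable {T}
variable {w Y Z y z : ℂ} (hw : T.th w ≠ 0) (hd : T.th (y - z) ≠ 0)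
  (h1 : T.th (y - Y) ≠ 0) (h2 : T.th (z - Z) ≠ 0) (h3 : T.th (y - Z) ≠ 0) (h4 : T.th (z - Y) ≠ 0)
  (g1 : T.th (w - (y - Y)) ≠ 0) (g2 : T.th (w - (z - Z)) ≠ 0)
  (g3 : T.th (w - (y - Z)) ≠ 0) (g4 : T.th (w - (z - Y)) ≠ 0)

lemma fLem (hw : T.th w ≠ 0) (hd : T.th (y - z) ≠ 0) (h1 : T.th (y - Y) ≠ 0)
    (h4 : T.th (z - Y) ≠ 0) (g1 : T.th (w - (y - Y)) ≠ 0)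
    : T.sig w (y - Y) * (T.phi w (y - Y) + T.rho (z - Y) + T.rho (y - z)) =
    T.sig w (z - Y) * T.sig w (y - z) :=
  T.dF (by ring) hw h4 hd h1 g1

lemma gLem (hw : T.th w ≠ 0) (hd : T.th (y - z) ≠ 0) (h2 : T.th (z - Z) ≠ 0)
    (h3 : T.th (y - Z) ≠ 0) (g2 : T.th (w - (z - Z)) ≠ 0)
    : T.sig w (z - Z) * (T.phi w (z - Z) + T.rho (y - Z) - T.rho (y - z)) =
    T.sig w (y - Z) * T.sig w (-(y - z)) := by
  have := T.dF (w := w) (x := y - Z) (y := -(y - z)) (z := z - Z) (by ring) hw h3 (T.ne_neg hd) h2 g2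
  rw [T.rho_neg] at this
  rw [← this]; ring

lemma lemA (hw : T.th w ≠ 0) (hd : T.th (y - z) ≠ 0) (h1 : T.th (y - Y) ≠ 0)
    (h2 : T.th (z - Z) ≠ 0) (h3 : T.th (y - Z) ≠ 0) (h4 : T.th (z - Y) ≠ 0)
    (g1 : T.th (w - (y - Y)) ≠ 0) (g2 : T.th (w - (z - Z)) ≠ 0) (g3 : T.th (w - (y - Z)) ≠ 0)
    (g4 : T.th (w - (z - Y)) ≠ 0)
    : T.mm w w Y Z y z * T.alphaE w w Y Z y z = T.mm w w Z Y y z * T.alphaE w w Z Y y z := by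
  have f1 := fLem hw hd h1 h4 g1
  have f2 := gLem hw hd h2 h3 g2
  have f3 := fLem hw hd h3 h2 g3
  have f4 := gLem hw hd h4 h1 g4
  simp only [mm, alphaE]
  linear_combination -2 * T.sig w (z - Z) * f1 + 2 * T.sig w (y - Y) * f2
    + 2 * T.sig w (z - Y) * f3 - 2 * T.sig w (y - Z) * f4

lemma lemB (hw : T.th w ≠ 0) (hd : T.th (y - z) ≠ 0) (h1 : T.th (y - Y) ≠ 0)
    (h2 : T.th (z - Z) ≠ 0) (h3 : T.th (y - Z) ≠ 0) (h4 : T.th (z - Y) ≠ 0)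
    (g1 : T.th (w - (y - Y)) ≠ 0) (g2 : T.th (w - (z - Z)) ≠ 0) (g3 : T.th (w - (y - Z)) ≠ 0)
    (g4 : T.th (w - (z - Y)) ≠ 0)
    : T.mm w w Y Z y z * T.betaE w w Y Z y z + T.mm w w Z Y y z * T.betaE w w Z Y y z = 0 := by
  have f1 := fLem hw hd h1 h4 g1
  have f2 := gLem hw hd h2 h3 g2
  have f3 := fLem hw hd h3 h2 g3
  have f4 := gLem hw hd h4 h1 g4
  have i1 := T.I1 hw h1 g1
  have i2 := T.I1 hw h2 g2
  have i3 := T.I1 hw h3 g3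
  have i4 := T.I1 hw h4 g4
  have e1 := T.eta3a (δ := y - z) (y := y - Y) (z := z - Y) (by ring) h1 h4 hd
  have e2 := T.eta3a (δ := y - z) (y := y - Z) (z := z - Z) (by ring) h3 h2 hd
  have pm := T.sigpm hw hd
  have b1 : T.betaE w w Y Z y z =
     4 * (T.phi w (y - Y) + T.rho (z - Y) + T.rho (y - z)) * (T.phi w (z - Z) + T.rho (y - Z) - T.rho (y - z))
     + 2 * (T.phi w (y - Y) + T.rho (z - Y) + T.rho (y - z)) * (T.rho (y - Y) - T.rho (y - Z))
     + 2 * (T.phi w (z - Z) + T.rho (y - Z) - T.rho (y - z)) * (T.rho (z - Z) - T.rho (z - Y))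
     + 4 * (T.rho' w - T.rho' (y - z)) := by
    simp only [betaE]
    linear_combination -i1 - i2 + e1 + e2
  have b2 : T.betaE w w Z Y y z =
     4 * (T.phi w (y - Z) + T.rho (z - Z) + T.rho (y - z)) * (T.phi w (z - Y) + T.rho (y - Y) - T.rho (y - z))
     + 2 * (T.phi w (y - Z) + T.rho (z - Z) + T.rho (y - z)) * (T.rho (y - Z) - T.rho (y - Y))
     + 2 * (T.phi w (z - Y) + T.rho (y - Y) - T.rho (y - z)) * (T.rho (z - Y) - T.rho (z - Z))
     + 4 * (T.rho' w - T.rho' (y - z)) := by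
    simp only [betaE]
    linear_combination -i3 - i4 + e1 + e2
  rw [b1, b2]
  simp only [mm]
  generalize T.phi w (y - Y) + T.rho (z - Y) + T.rho (y - z) = f at *
  generalize T.phi w (z - Z) + T.rho (y - Z) - T.rho (y - z) = g at *
  generalize T.phi w (y - Z) + T.rho (z - Z) + T.rho (y - z) = f' at *
  generalize T.phi w (z - Y) + T.rho (y - Y) - T.rho (y - z) = g' at *
  have p1 : T.sig w (y - Y) * T.sig w (z - Z) * (f * g) =
     (T.sig w (z - Y) * T.sig w (y - z)) * (T.sig w (y - Z) * T.sig w (-(y - z))) := by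
    rw [← f1, ← f2]; ring
  have p2 : T.sig w (y - Z) * T.sig w (z - Y) * (f' * g') =
     (T.sig w (z - Z) * T.sig w (y - z)) * (T.sig w (y - Y) * T.sig w (-(y - z))) := by
    rw [← f3, ← f4]; ring
  linear_combination 4 * p1 + 4 * p2 + 2 * T.sig w (z - Z) * (T.rho (y - Y) - T.rho (y - Z)) * f1
    + 2 * T.sig w (y - Y) * (T.rho (z - Z) - T.rho (z - Y)) * f2
    + 2 * T.sig w (z - Y) * (T.rho (y - Z) - T.rho (y - Y)) * f3
    + 2 * T.sig w (y - Z) * (T.rho (z - Y) - T.rho (z - Z)) * f4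
    + 4 * (T.sig w (z - Y) * T.sig w (y - Z) + T.sig w (z - Z) * T.sig w (y - Y)) * pm
end eqcase

section ucase
variable {T}
variable {w w' v Y Z y z : ℂ} (hv : v = w - w') (hw : T.th w ≠ 0) (hw' : T.th w' ≠ 0) (hv0 : T.th v ≠ 0)
  (hd : T.th (y - z) ≠ 0) (hD : T.th (Y - Z) ≠ 0)
  (h1 : T.th (y - Y) ≠ 0) (h2 : T.th (z - Z) ≠ 0) (h3 : T.th (y - Z) ≠ 0) (h4 : T.th (z - Y) ≠ 0)
  (g1 : T.th (w - (y - Y)) ≠ 0)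
  (g4 : T.th (w - (z - Y)) ≠ 0)
  (k2 : T.th (w' - (z - Z)) ≠ 0)
  (k3 : T.th (w' - (y - Z)) ≠ 0)
  (vd : T.th (v - (y - z)) ≠ 0) (vD : T.th (v + (Y - Z)) ≠ 0)

lemma lemQ (hv : v = w - w') (hw : T.th w ≠ 0) (hw' : T.th w' ≠ 0)
    (hv0 : T.th v ≠ 0) (hd : T.th (y - z) ≠ 0) (hD : T.th (Y - Z) ≠ 0)
    (h1 : T.th (y - Y) ≠ 0) (h2 : T.th (z - Z) ≠ 0) (h3 : T.th (y - Z) ≠ 0)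
    (h4 : T.th (z - Y) ≠ 0)
    : T.mm w w' Y Z y z * (T.rho (y - Z) - T.rho (z - Y) - T.rho (y - z) - T.rho (Y - Z))
    - T.sig v (-(Y - Z)) * T.mm w w' Z Y y z + T.sig v (y - z) * T.mm w w' Y Z z y = 0 := by
  have e := T.three ((w-y+Y+w'-z+Z)/2) ((w-y+Y-(w'-z+Z))/2) ((y-z+Y-Z+w-w')/2) ((y-z+Y-Z-(w-w'))/2)
  rw [show (w-y+Y+w'-z+Z)/2 + (w-y+Y-(w'-z+Z))/2 = w - (y - Y) by ring,
    show (w-y+Y+w'-z+Z)/2 - (w-y+Y-(w'-z+Z))/2 = w' - (z - Z) by ring,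
    show (y-z+Y-Z+w-w')/2 + (y-z+Y-Z-(w-w'))/2 = (y - z) + (Y - Z) by ring,
    show (y-z+Y-Z+w-w')/2 - (y-z+Y-Z-(w-w'))/2 = v by rw [hv]; ring,
    show (w-y+Y+w'-z+Z)/2 + (y-z+Y-Z+w-w')/2 = w - (z - Y) by ring,
    show (w-y+Y+w'-z+Z)/2 - (y-z+Y-Z+w-w')/2 = w' - (y - Z) by ring,
    show (w-y+Y+w'-z+Z)/2 + (y-z+Y-Z-(w-w'))/2 = w' - (z - Y) by ring,
    show (w-y+Y+w'-z+Z)/2 - (y-z+Y-Z-(w-w'))/2 = w - (y - Z) by ring,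
    show (w-y+Y-(w'-z+Z))/2 + (y-z+Y-Z-(w-w'))/2 = Y - Z by ring,
    show (w-y+Y-(w'-z+Z))/2 - (y-z+Y-Z-(w-w'))/2 = v - (y - z) by rw [hv]; ring,
    show (w-y+Y-(w'-z+Z))/2 + (y-z+Y-Z+w-w')/2 = v - (-(Y - Z)) by rw [hv]; ring,
    show (w-y+Y-(w'-z+Z))/2 - (y-z+Y-Z+w-w')/2 = -(y - z) by ring, T.odd (y - z)] at e
  have s := T.S4 (a := y - Z) (b := -(z - Y)) (c := -(y - z)) (d := Y - Z) (by ring) h3 (T.ne_neg h4) (T.ne_neg hd) hD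
  rw [show y - Z + -(z - Y) = (y - z) + (Y - Z) by ring, show y - Z + -(y - z) = z - Z by ring,
    show -(z - Y) + -(y - z) = -(y - Y) by ring, T.rho_neg, T.rho_neg, T.odd (z - Y), T.odd (y - z), T.odd (y - Y)] at s
  rw [show T.rho (y - Z) - T.rho (z - Y) - T.rho (y - z) - T.rho (Y - Z) =
    T.rho (y - Z) + -T.rho (z - Y) + -T.rho (y - z) - T.rho (Y - Z) by ring, s]
  simp only [mm, sig]
  rw [T.odd (Y - Z)]
  field_simp
  linear_combination -(T.th1 0)^3 * e

lemma lemP0 (hv : v = w - w') (hw : T.th w ≠ 0) (hw' : T.th w' ≠ 0)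
    (hv0 : T.th v ≠ 0) (hd : T.th (y - z) ≠ 0) (hD : T.th (Y - Z) ≠ 0)
    (h1 : T.th (y - Y) ≠ 0) (h2 : T.th (z - Z) ≠ 0) (h3 : T.th (y - Z) ≠ 0)
    (h4 : T.th (z - Y) ≠ 0) (g1 : T.th (w - (y - Y)) ≠ 0) (g4 : T.th (w - (z - Y)) ≠ 0)
    (k2 : T.th (w' - (z - Z)) ≠ 0) (k3 : T.th (w' - (y - Z)) ≠ 0) (vd : T.th (v - (y - z)) ≠ 0)
    (vD : T.th (v + (Y - Z)) ≠ 0)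
    (hE : T.th ((y - z) + (Y - Z)) ≠ 0) : T.mm w w' Y Z y z * (T.betaU w w' Y Z y z + T.eta (y - z) - T.eta (Y - Z)
      + 2 * T.rho (y - z) * (T.phi w (y - Y) - T.phi w' (z - Z)))
    - 2 * T.sig v (-(Y - Z)) * T.phi v (-(Y - Z)) * T.mm w w' Z Y y z
    + 2 * T.sig v (y - z) * T.mm w w' Y Z z y *
      (T.phi v (y - z) + T.phi w (z - Y) - T.phi w' (y - Z)) = 0 := by
  have f1 := fLem hw hd h1 h4 g1
  have f2 := gLem hw' hd h2 h3 k2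
  have ss := T.sigsig hv hw hw' hv0 hd vd
  have q := lemQ hv hw hw' hv0 hd hD h1 h2 h3 h4
  have vD' : T.th (v - (-(Y - Z))) ≠ 0 := by rwa [sub_neg_eq_add]
  · have e4 := T.eta4 (a := y - z) (b := z - Y) (c := Y - Z) (d := y - Z) (e := (y - z) + (Y - Z)) (by ring) rfl
      hd h4 hD h3 hE
    have df := T.dF (w := v) (x := -((y - z) + (Y - Z))) (y := y - z) (z := -(Y - Z)) (by ring) hv0 (T.ne_neg hE) hd
      (T.ne_neg hD) vD'
    have s := T.S4 (a := v) (b := w' - (y - Z)) (c := (y - z) + (Y - Z)) (d := w - (z - Y)) (by rw [hv]; ring)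
      hv0 k3 hE g4
    rw [show v + (w' - (y - Z)) = w - (y - Z) by rw [hv]; ring, show w' - (y - Z) + ((y - z) + (Y - Z)) = w' - (z - Y) by ring] at s
    have fin : T.sig v (y - z) * T.mm w w' Y Z z y * (T.rho v + T.rho (w' - (y - Z)) + T.rho ((y - z) + (Y - Z)) - T.rho (w - (z - Y)))
        = - T.mm w w' Z Y y z * T.sig v (-((y - z) + (Y - Z))) * T.sig v (y - z) := by
      rw [s]
      simp only [mm, sig]
      rw [T.odd ((y - z) + (Y - Z)), sub_neg_eq_add]
      field_simp
    rw [T.rho_neg] at df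
    have p1 : T.mm w w' Y Z y z * ((T.phi w (y - Y) + T.rho (z - Y) + T.rho (y - z)) *
       (T.phi w' (z - Z) + T.rho (y - Z) - T.rho (y - z))) =
       (T.sig w (z - Y) * T.sig w (y - z)) * (T.sig w' (y - Z) * T.sig w' (-(y - z))) := by
      rw [← f1, ← f2, mm]; ring
    have b : T.betaU w w' Y Z y z + T.eta (y - z) - T.eta (Y - Z)
      + 2 * T.rho (y - z) * (T.phi w (y - Y) - T.phi w' (z - Z)) =
        2 * ((T.phi w (y - Y) + T.rho (z - Y) + T.rho (y - z)) * (T.phi w' (z - Z) + T.rho (y - Z) - T.rho (y - z)))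
        + 2 * (T.rho (y - Z) - T.rho (z - Y) - T.rho (y - z) - T.rho (Y - Z)) *
           (T.rho ((y - z) + (Y - Z)) - T.rho (y - z)) := by
      simp only [betaU]
      linear_combination e4
    rw [b]
    have N : T.mm w w' Y Z z y = T.sig w (z - Y) * T.sig w' (y - Z) := rfl
    have ph1 : T.phi v (y - z) = T.rho (v - (y - z)) - T.rho v := rfl
    have ph2 : T.phi w (z - Y) = T.rho (w - (z - Y)) - T.rho w := rfl
    have ph3 : T.phi w' (y - Z) = T.rho (w' - (y - Z)) - T.rho w' := rfl
    rw [ph1, ph2, ph3]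
    linear_combination 2 * p1 + 2 * (T.rho ((y - z) + (Y - Z)) - T.rho (y - z)) * q
      - 2 * T.mm w w' Z Y y z * df - 2 * fin + 2 * T.sig w (z - Y) * T.sig w' (y - Z) * ss
      - 2 * (T.sig v (y - z) * (T.rho w - T.rho w' - T.rho (y - z) - T.rho (v - (y-z)))) * N
lemma lemP (hv : v = w - w') (hw : T.th w ≠ 0) (hw' : T.th w' ≠ 0)
    (hv0 : T.th v ≠ 0) (hd : T.th (y - z) ≠ 0) (hD : T.th (Y - Z) ≠ 0)
    (h1 : T.th (y - Y) ≠ 0) (h2 : T.th (z - Z) ≠ 0) (h3 : T.th (y - Z) ≠ 0)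
    (h4 : T.th (z - Y) ≠ 0) (g1 : T.th (w - (y - Y)) ≠ 0) (g4 : T.th (w - (z - Y)) ≠ 0)
    (k2 : T.th (w' - (z - Z)) ≠ 0) (k3 : T.th (w' - (y - Z)) ≠ 0) (vd : T.th (v - (y - z)) ≠ 0)
    (vD : T.th (v + (Y - Z)) ≠ 0)
    : T.mm w w' Y Z y z * (T.betaU w w' Y Z y z + T.eta (y - z) - T.eta (Y - Z)
      + 2 * T.rho (y - z) * (T.phi w (y - Y) - T.phi w' (z - Z)))
    - 2 * T.sig v (-(Y - Z)) * T.phi v (-(Y - Z)) * T.mm w w' Z Y y z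
    + 2 * T.sig v (y - z) * T.mm w w' Y Z z y *
      (T.phi v (y - z) + T.phi w (z - Y) - T.phi w' (y - Z)) = 0 := by
  by_cases hE : T.th ((y - z) + (Y - Z)) ≠ 0
  · exact lemP0 hv hw hw' hv0 hd hD h1 h2 h3 h4 g1 g4 k2 k3 vd vD hE
  · have c0 := T.cont0
    have c1 := T.cont1
    have c2 := T.cont2
    refine tendsto_nhds_unique (f := fun y => T.mm w w' Y Z y z * (T.betaU w w' Y Z y z + T.eta (y - z) - T.eta (Y - Z)
      + 2 * T.rho (y - z) * (T.phi w (y - Y) - T.phi w' (z - Z)))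
    - 2 * T.sig v (-(Y - Z)) * T.phi v (-(Y - Z)) * T.mm w w' Z Y y z
    + 2 * T.sig v (y - z) * T.mm w w' Y Z z y *
      (T.phi v (y - z) + T.phi w (z - Y) - T.phi w' (y - Z))) (l := 𝓝[≠] y) ?_ ((tendsto_const_nhds (x := (0:ℂ))).congr' ?_)
    · have : ContinuousAt (fun y => T.mm w w' Y Z y z * (T.betaU w w' Y Z y z + T.eta (y - z) - T.eta (Y - Z)
      + 2 * T.rho (y - z) * (T.phi w (y - Y) - T.phi w' (z - Z)))
    - 2 * T.sig v (-(Y - Z)) * T.phi v (-(Y - Z)) * T.mm w w' Z Y y z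
    + 2 * T.sig v (y - z) * T.mm w w' Y Z z y *
      (T.phi v (y - z) + T.phi w (z - Y) - T.phi w' (y - Z))) y := by
        have n1 : T.th w * T.th (y - Y) ≠ 0 := mul_ne_zero hw h1
        have n2 : T.th w * T.th (y - Z) ≠ 0 := mul_ne_zero hw h3
        have n3 : T.th v * T.th (y - z) ≠ 0 := mul_ne_zero hv0 hd
        have n4 : T.th w' * T.th (y - Z) ≠ 0 := mul_ne_zero hw' h3
        simp only [mm, betaU, eta, rho, phi, sig]
        fun_prop (disch := assumption)
      exact this.tendsto.mono_left nhdsWithin_le_nhds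
    · have ev : ∀ {x : ℂ → ℂ}, Continuous x → T.th (x y) ≠ 0 → ∀ᶠ q in 𝓝[≠] y, T.th (x q) ≠ 0 := by
        intro x hx h
        exact (((c0.comp hx).continuousAt).eventually_ne h).filter_mono nhdsWithin_le_nhds
      have evE : ∀ᶠ q in 𝓝[≠] y, T.th ((q - z) + (Y - Z)) ≠ 0 := by
        have := T.punct (y - z + (Y - Z))
        have ht : Tendsto (fun q : ℂ => (q - z) + (Y - Z)) (𝓝[≠] y) (𝓝[≠] (y - z + (Y - Z))) := by
          apply tendsto_nhdsWithin_of_tendsto_nhds_of_eventually_within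
          · exact (Continuous.tendsto (by fun_prop) y).mono_left nhdsWithin_le_nhds
          · filter_upwards [self_mem_nhdsWithin] with q hq h
            apply hq
            have h' : q - z + (Y - Z) = y - z + (Y - Z) := h
            exact (by linear_combination h' : q = y)
        exact ht.eventually this
      filter_upwards [ev (x := fun q => q - z) (by fun_prop) hd, ev (x := fun q => q - Y) (by fun_prop) h1,
        ev (x := fun q => q - Z) (by fun_prop) h3, ev (x := fun q => w - (q - Y)) (by fun_prop) g1,
        ev (x := fun q => w' - (q - Z)) (by fun_prop) k3, ev (x := fun q => v - (q - z)) (by fun_prop) vd, evE]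
        with q a1 a2 a3 a4 a5 a6 a7
      exact (lemP0 hv hw hw' hv0 a1 hD a2 h2 a3 h4 a4 g4 k2 a5 a6 vD a7).symm

lemma lemBase (hv : v = w - w') (hw : T.th w ≠ 0) (hw' : T.th w' ≠ 0)
    (hv0 : T.th v ≠ 0)
    (hd : T.th (y - z) ≠ 0) (hy : T.th y ≠ 0) (hz : T.th z ≠ 0) (g1 : T.th (w - y) ≠ 0)
    (g4 : T.th (w - z) ≠ 0) (k2 : T.th (w' - z) ≠ 0) (k3 : T.th (w' - y) ≠ 0)
    (vd : T.th (v - (y - z)) ≠ 0) :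
    T.mm w w' 0 0 y z * (T.betaU w w' 0 0 y z + T.eta (y - z) + 2 * T.rho' v
      + 2 * T.rho (y - z) * (T.phi w (y - 0) - T.phi w' (z - 0)))
    + 2 * T.sig v (y - z) * T.mm w w' 0 0 z y *
      (T.phi v (y - z) + T.phi w (z - 0) - T.phi w' (y - 0)) = 0 := by
  have f1 := fLem (Y := 0) hw hd (by simpa using hy) (by simpa using hz) (by simpa using g1)
  have f2 := gLem (Z := 0) hw' hd (by simpa using hz) (by simpa using hy) (by simpa using k2)
  have ss := T.sigsig hv hw hw' hv0 hd vd
  have e3 := T.eta3a (δ := y - z) rfl hy hz hd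
  have s := T.S4 (a := v) (b := w' - y) (c := y - z) (d := w - z) (by rw [hv]; ring) hv0 k3 hd g4
  rw [show v + (w' - y) = w - y by rw [hv]; ring, show w' - y + (y - z) = w' - z by ring] at s
  have d2 := T.D2 hv0 hd
  simp only [mm, betaU, phi, sub_zero] at *
  have p1 : T.sig w y * T.sig w' z * ((T.rho (w - y) - T.rho w + T.rho z + T.rho (y - z)) *
       (T.rho (w' - z) - T.rho w' + T.rho y - T.rho (y - z))) =
       (T.sig w z * T.sig w (y - z)) * (T.sig w' y * T.sig w' (-(y - z))) := by
      rw [← f1, ← f2]; ring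
  have fin : T.sig w y * T.sig w' z * (T.rho' v - T.rho' (y - z)) = T.sig v (y - z) * (T.sig w z * T.sig w' y) *
     (T.rho v + T.rho (w' - y) + T.rho (y - z) - T.rho (w - z)) := by
    rw [d2, s]
    simp only [sig]
    field_simp
  linear_combination 2 * p1 + T.sig w y * T.sig w' z * e3 + 2 * T.sig w z * T.sig w' y * ss + 2 * fin

lemma lemTop {v x x' δ d : ℂ} (hx' : x' = x + δ) (hv0 : T.th v ≠ 0) (hx : T.th x ≠ 0) (hxx : T.th x' ≠ 0) (hd : T.th δ ≠ 0)
   (vx : T.th (v - x) ≠ 0) (vd : T.th (v + δ) ≠ 0) :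
   T.sig v x * (T.phi v x ^ 2 + T.phi' v x + 2 * T.phi v x * d + 2 * T.rho' v + 2 * (d + T.phi v x) * T.rho x' + T.eta x')
   = T.sig v x * (T.eta δ + 2 * T.rho' v + 2 * d * T.rho δ) + 2 * T.sig v x' * T.sig v (-δ) * (T.phi v (-δ) + d) := by
  have i1 := T.I1 hv0 hx vx
  have df := T.dF (w := v) (x := x') (y := -δ) (z := x) (by rw [hx']; ring) hv0 hxx (T.ne_neg hd) hx vx
  have df2 := T.dF (w := v) (x := x) (y := -x') (z := -δ) (by rw [hx']; ring) hv0 hx (T.ne_neg hxx) (T.ne_neg hd)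
    (by rwa [sub_neg_eq_add])
  have e3 := T.eta3b hx' hx hxx hd
  have pm := T.sigpm hv0 hxx
  rw [T.rho_neg] at df df2
  linear_combination T.sig v x * i1 + T.sig v x * e3 + (2 * d + 2 * (T.rho x' - T.rho x)) * df
    - 2 * T.sig v x * pm - 2 * T.sig v x' * df2
end ucase
end TH
end

noncomputable section

/-- swap the values at level `a+1` for `a ∈ s`. -/
def swq (s : Finset ℕ) (y z : ℕ → ℂ) : ℕ → ℂ
  | 0 => y 0
  | a + 1 => if a ∈ s then z (a + 1) else y (a + 1)

def ins (b : Bool) (n : ℕ) (s : Finset ℕ) : Finset ℕ := if b then insert n s else s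

def bval (b : Bool) (y z : ℂ) : ℂ := if b then z else y

lemma swq_ins_lt {b : Bool} {n a : ℕ} (s : Finset ℕ) (y z : ℕ → ℂ) (h : a ≤ n) :
    swq (ins b n s) y z a = swq s y z a := by
  cases a with
  | zero => rfl
  | succ a =>
    have : a ∈ ins b n s ↔ a ∈ s := by
      cases b <;> simp [ins]; omega
    simp [swq, this]

lemma swq_ins_self {b : Bool} {n : ℕ} {s : Finset ℕ} (y z : ℕ → ℂ) (h : s ∈ (Finset.range n).powerset) :
    swq (ins b n s) y z (n + 1) = bval b (y (n + 1)) (z (n + 1)) := by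
  have hn : n ∉ s := fun hh => by
    have := Finset.mem_powerset.1 h hh
    simp at this
  cases b <;> simp [swq, ins, bval, hn]

lemma sum_ins (n : ℕ) (F : Finset ℕ → ℂ) : ∑ s ∈ (Finset.range (n + 1)).powerset, F s =
    ∑ b : Bool, ∑ s ∈ (Finset.range n).powerset, F (ins b n s) := by
  rw [Finset.range_add_one, Finset.sum_powerset_insert Finset.notMem_range_self]
  simp [ins, add_comm]

lemma bval_not (b : Bool) (y z : ℂ) : bval b z y = bval (!b) y z := by cases b <;> rfl

namespace TH
variable (T : TH)

def pp (w w' : ℕ → ℂ) (n : ℕ) (u v : ℕ → ℂ) : ℂ :=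
  ∏ a ∈ Finset.range n, T.mm (w a) (w' a) (u a) (v a) (u (a + 1)) (v (a + 1))
def dd (w w' : ℕ → ℂ) (n : ℕ) (u v : ℕ → ℂ) : ℂ :=
  ∑ a ∈ Finset.range n, (T.phi (w a) (u (a + 1) - u a) - T.phi (w' a) (v (a + 1) - v a))
def LL (w w' : ℕ → ℂ) (α β : ℕ → ℂ → ℂ → ℂ → ℂ → ℂ) (n : ℕ) (u v : ℕ → ℂ) : ℂ :=
  ∑ a ∈ Finset.range n, (T.dd w w' a u v * α a (u a) (v a) (u (a + 1)) (v (a + 1)) +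
    β a (u a) (v a) (u (a + 1)) (v (a + 1)))

variable (w w' : ℕ → ℂ) (α β : ℕ → ℂ → ℂ → ℂ → ℂ → ℂ)

lemma pp_congr {n : ℕ} {u v u' v' : ℕ → ℂ} (hu : ∀ a ≤ n, u a = u' a) (hv : ∀ a ≤ n, v a = v' a) :
    T.pp w w' n u v = T.pp w w' n u' v' := by
  refine Finset.prod_congr rfl fun a ha => ?_
  have := Finset.mem_range.1 ha
  rw [hu a (by omega), hv a (by omega), hu (a+1) (by omega), hv (a+1) (by omega)]

lemma dd_congr {n : ℕ} {u v u' v' : ℕ → ℂ} (hu : ∀ a ≤ n, u a = u' a) (hv : ∀ a ≤ n, v a = v' a) :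
    T.dd w w' n u v = T.dd w w' n u' v' := by
  refine Finset.sum_congr rfl fun a ha => ?_
  have := Finset.mem_range.1 ha
  rw [hu a (by omega), hv a (by omega), hu (a+1) (by omega), hv (a+1) (by omega)]

lemma LL_congr {n : ℕ} {u v u' v' : ℕ → ℂ} (hu : ∀ a ≤ n, u a = u' a) (hv : ∀ a ≤ n, v a = v' a) :
    T.LL w w' α β n u v = T.LL w w' α β n u' v' := by
  refine Finset.sum_congr rfl fun a ha => ?_
  have := Finset.mem_range.1 ha
  rw [T.dd_congr w w' (n := a) (fun b hb => hu b (by omega)) (fun b hb => hv b (by omega)),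
    hu a (by omega), hv a (by omega), hu (a+1) (by omega), hv (a+1) (by omega)]

variable (y z : ℕ → ℂ)

def PP (n : ℕ) (b : Bool) : ℂ := ∑ s ∈ (Finset.range n).powerset,
  T.pp w w' (n + 1) (swq (ins b n s) y z) (swq (ins b n s) z y)
def QQ (n : ℕ) (b : Bool) : ℂ := ∑ s ∈ (Finset.range n).powerset,
  T.pp w w' (n + 1) (swq (ins b n s) y z) (swq (ins b n s) z y) *
    T.dd w w' (n + 1) (swq (ins b n s) y z) (swq (ins b n s) z y)
def RR (n : ℕ) (b : Bool) : ℂ := ∑ s ∈ (Finset.range n).powerset,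
  T.pp w w' (n + 1) (swq (ins b n s) y z) (swq (ins b n s) z y) *
    T.LL w w' α β (n + 1) (swq (ins b n s) y z) (swq (ins b n s) z y)

/-- transition weight from level `a` to level `a+1`. -/
def Mt (a : ℕ) (b b' : Bool) : ℂ := T.mm (w a) (w' a) (bval b (y a) (z a)) (bval b (z a) (y a))
  (bval b' (y (a + 1)) (z (a + 1))) (bval b' (z (a + 1)) (y (a + 1)))
def et (a : ℕ) (b b' : Bool) : ℂ :=
  T.phi (w a) (bval b' (y (a + 1)) (z (a + 1)) - bval b (y a) (z a)) -
  T.phi (w' a) (bval b' (z (a + 1)) (y (a + 1)) - bval b (z a) (y a))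
def ft (f : ℕ → ℂ → ℂ → ℂ → ℂ → ℂ) (y z : ℕ → ℂ) (a : ℕ) (b b' : Bool) : ℂ :=
  f a (bval b (y a) (z a)) (bval b (z a) (y a))
  (bval b' (y (a + 1)) (z (a + 1))) (bval b' (z (a + 1)) (y (a + 1)))

lemma PP_succ (n : ℕ) (b' : Bool) : T.PP w w' y z (n + 1) b' =
    ∑ b : Bool, T.PP w w' y z n b * T.Mt w w' y z (n + 1) b b' := by
  simp only [PP]
  rw [sum_ins]
  refine Finset.sum_congr rfl fun b _ => ?_
  rw [Finset.sum_mul]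
  refine Finset.sum_congr rfl fun s hs => ?_
  have hs' : ins b n s ∈ (Finset.range (n + 1)).powerset := by
    rw [Finset.mem_powerset] at hs ⊢
    have : Finset.range n ⊆ Finset.range (n + 1) := Finset.range_mono (by omega)
    cases b
    · exact hs.trans this
    · exact Finset.insert_subset (by simp) (hs.trans this)
  conv_lhs => rw [pp, Finset.prod_range_succ, ← pp]
  rw [T.pp_congr w w' (fun a ha => swq_ins_lt (b := b') (n := n + 1) (ins b n s) y z ha)
    (fun a ha => swq_ins_lt (b := b') (n := n + 1) (ins b n s) z y ha)]
  rw [swq_ins_self _ _ hs', swq_ins_self _ _ hs', swq_ins_lt _ _ _ le_rfl, swq_ins_lt _ _ _ le_rfl,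
    swq_ins_self _ _ hs, swq_ins_self _ _ hs]
  rfl

lemma QQ_succ (n : ℕ) (b' : Bool) : T.QQ w w' y z (n + 1) b' =
    ∑ b : Bool, (T.QQ w w' y z n b + T.PP w w' y z n b * T.et w w' y z (n + 1) b b') * T.Mt w w' y z (n + 1) b b' := by
  simp only [PP, QQ]
  rw [sum_ins]
  refine Finset.sum_congr rfl fun b _ => ?_
  rw [Finset.sum_mul, ← Finset.sum_add_distrib, Finset.sum_mul]
  refine Finset.sum_congr rfl fun s hs => ?_
  have hs' : ins b n s ∈ (Finset.range (n + 1)).powerset := by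
    rw [Finset.mem_powerset] at hs ⊢
    have : Finset.range n ⊆ Finset.range (n + 1) := Finset.range_mono (by omega)
    cases b
    · exact hs.trans this
    · exact Finset.insert_subset (by simp) (hs.trans this)
  conv_lhs => rw [pp, Finset.prod_range_succ, ← pp, dd, Finset.sum_range_succ, ← dd]
  rw [T.pp_congr w w' (fun a ha => swq_ins_lt (b := b') (n := n + 1) (ins b n s) y z ha)
    (fun a ha => swq_ins_lt (b := b') (n := n + 1) (ins b n s) z y ha),
    T.dd_congr w w' (fun a ha => swq_ins_lt (b := b') (n := n + 1) (ins b n s) y z ha)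
    (fun a ha => swq_ins_lt (b := b') (n := n + 1) (ins b n s) z y ha)]
  rw [swq_ins_self _ _ hs', swq_ins_self _ _ hs', swq_ins_lt _ _ _ le_rfl, swq_ins_lt _ _ _ le_rfl,
    swq_ins_self _ _ hs, swq_ins_self _ _ hs]
  simp only [Mt, et]
  ring

lemma RR_succ (n : ℕ) (b' : Bool) : T.RR w w' α β y z (n + 1) b' =
    ∑ b : Bool, (T.RR w w' α β y z n b + T.QQ w w' y z n b * ft α y z (n + 1) b b'
      + T.PP w w' y z n b * ft β y z (n + 1) b b') * T.Mt w w' y z (n + 1) b b' := by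
  simp only [PP, QQ, RR]
  rw [sum_ins]
  refine Finset.sum_congr rfl fun b _ => ?_
  rw [Finset.sum_mul, Finset.sum_mul, ← Finset.sum_add_distrib, ← Finset.sum_add_distrib, Finset.sum_mul]
  refine Finset.sum_congr rfl fun s hs => ?_
  have hs' : ins b n s ∈ (Finset.range (n + 1)).powerset := by
    rw [Finset.mem_powerset] at hs ⊢
    have : Finset.range n ⊆ Finset.range (n + 1) := Finset.range_mono (by omega)
    cases b
    · exact hs.trans this
    · exact Finset.insert_subset (by simp) (hs.trans this)
  conv_lhs => rw [pp, Finset.prod_range_succ, ← pp, LL, Finset.sum_range_succ, ← LL]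
  rw [T.pp_congr w w' (fun a ha => swq_ins_lt (b := b') (n := n + 1) (ins b n s) y z ha)
    (fun a ha => swq_ins_lt (b := b') (n := n + 1) (ins b n s) z y ha),
    T.dd_congr w w' (fun a ha => swq_ins_lt (b := b') (n := n + 1) (ins b n s) y z ha)
    (fun a ha => swq_ins_lt (b := b') (n := n + 1) (ins b n s) z y ha),
    T.LL_congr w w' α β (fun a ha => swq_ins_lt (b := b') (n := n + 1) (ins b n s) y z ha)
    (fun a ha => swq_ins_lt (b := b') (n := n + 1) (ins b n s) z y ha)]
  rw [swq_ins_self _ _ hs', swq_ins_self _ _ hs', swq_ins_lt _ _ _ le_rfl, swq_ins_lt _ _ _ le_rfl,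
    swq_ins_self _ _ hs, swq_ins_self _ _ hs]
  simp only [Mt, ft]
  ring

lemma PP_zero (b : Bool) : T.PP w w' y z 0 b = T.mm (w 0) (w' 0) (y 0) (z 0) (bval b (y 1) (z 1)) (bval b (z 1) (y 1)) := by
  cases b <;> simp [PP, pp, swq, ins, bval]
lemma QQ_zero (b : Bool) : T.QQ w w' y z 0 b = T.PP w w' y z 0 b *
   (T.phi (w 0) (bval b (y 1) (z 1) - y 0) - T.phi (w' 0) (bval b (z 1) (y 1) - z 0)) := by
  cases b <;> simp [PP, QQ, pp, dd, swq, ins, bval]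
lemma RR_zero (b : Bool) : T.RR w w' α β y z 0 b = T.PP w w' y z 0 b *
   β 0 (y 0) (z 0) (bval b (y 1) (z 1)) (bval b (z 1) (y 1)) := by
  cases b <;> simp [PP, RR, pp, dd, LL, swq, ins, bval]

end TH
end

noncomputable section
namespace TH
variable {T : TH}

/-- genericity of one transition -/
def Gn (T : TH) (w Y x : ℂ) : Prop := T.th (x - Y) ≠ 0 ∧ T.th (w - (x - Y)) ≠ 0

section
variable {w : ℕ → ℂ} {y z : ℕ → ℂ} {n : ℕ} (h0 : y 0 = z 0)
  (hw : ∀ a < n, T.th (w a) ≠ 0) (hyz : ∀ a < n, T.th (y (a+1) - z (a+1)) ≠ 0)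
  (hyy : ∀ a < n, T.Gn (w a) (y a) (y (a+1))) (hzz : ∀ a < n, T.Gn (w a) (z a) (z (a+1)))
  (hyz' : ∀ a < n, T.Gn (w a) (y a) (z (a+1))) (hzy' : ∀ a < n, T.Gn (w a) (z a) (y (a+1)))

lemma invE (h0 : y 0 = z 0) (hw : ∀ a < n, T.th (w a) ≠ 0) (hyz : ∀ a < n, T.th (y (a+1) - z (a+1)) ≠ 0)
    (hyy : ∀ a < n, T.Gn (w a) (y a) (y (a+1))) (hzz : ∀ a < n, T.Gn (w a) (z a) (z (a+1))) (hyz' : ∀ a < n, T.Gn (w a) (y a) (z (a+1)))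
    (hzy' : ∀ a < n, T.Gn (w a) (z a) (y (a+1)))
    (k : ℕ) (hk : k < n) :
    T.PP w w y z k true = T.PP w w y z k false ∧ T.QQ w w y z k true = - T.QQ w w y z k false ∧
    ∀ b, T.RR w w (fun a => T.alphaE (w a) (w a)) (fun a => T.betaE (w a) (w a)) y z k b = 0 := by
  induction k with
  | zero =>
    have B1 := lemB (hw 0 hk) (hyz 0 hk) (hyy 0 hk).1 (hzz 0 hk).1 (hzy' 0 hk).1 (hyz' 0 hk).1
      (hyy 0 hk).2 (hzz 0 hk).2 (hzy' 0 hk).2 (hyz' 0 hk).2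
    have B2 := lemB (hw 0 hk) (T.ne_symm (hyz 0 hk)) (hyz' 0 hk).1 (hzy' 0 hk).1  (hzz 0 hk).1 (hyy 0 hk).1
      (hyz' 0 hk).2 (hzy' 0 hk).2  (hzz 0 hk).2 (hyy 0 hk).2
    simp only [zero_add] at B1 B2
    rw [← h0] at B1 B2
    refine ⟨?_, ?_, ?_⟩
    · simp only [PP_zero, bval, mm, ← h0]; simp [mul_comm]
    · simp only [QQ_zero, PP_zero, bval, mm, ← h0]; simp; ring
    · intro b
      cases b
      · simp only [RR_zero, PP_zero, bval, ← h0]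
        simp
        have : (2:ℂ) * (T.mm (w 0) (w 0) (y 0) (y 0) (y 1) (z 1) * T.betaE (w 0) (w 0) (y 0) (y 0) (y 1) (z 1)) = 0 := by
          linear_combination B1
        simpa using this
      · simp only [RR_zero, PP_zero, bval, ← h0]
        simp
        have : (2:ℂ) * (T.mm (w 0) (w 0) (y 0) (y 0) (z 1) (y 1) * T.betaE (w 0) (w 0) (y 0) (y 0) (z 1) (y 1)) = 0 := by
          linear_combination B2
        simpa using this
  | succ k ih =>
    obtain ⟨i1, i2, i3⟩ := ih (by omega)
    have B1 := lemB (hw _ hk) (hyz _ hk) (hyy _ hk).1 (hzz _ hk).1 (hzy' _ hk).1 (hyz' _ hk).1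
      (hyy _ hk).2 (hzz _ hk).2 (hzy' _ hk).2 (hyz' _ hk).2
    have B2 := lemB (hw _ hk) (T.ne_symm (hyz _ hk)) (hyz' _ hk).1 (hzy' _ hk).1  (hzz _ hk).1 (hyy _ hk).1
      (hyz' _ hk).2 (hzy' _ hk).2  (hzz _ hk).2 (hyy _ hk).2
    have A1 := lemA (hw _ hk) (hyz _ hk) (hyy _ hk).1 (hzz _ hk).1 (hzy' _ hk).1 (hyz' _ hk).1
      (hyy _ hk).2 (hzz _ hk).2 (hzy' _ hk).2 (hyz' _ hk).2
    have A2 := lemA (hw _ hk) (T.ne_symm (hyz _ hk)) (hyz' _ hk).1 (hzy' _ hk).1  (hzz _ hk).1 (hyy _ hk).1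
      (hyz' _ hk).2 (hzy' _ hk).2  (hzz _ hk).2 (hyy _ hk).2
    refine ⟨?_, ?_, ?_⟩
    · simp only [PP_succ, Fintype.sum_bool, i1, Mt, bval, mm]; simp; ring
    · simp only [QQ_succ, Fintype.sum_bool, i1, i2, Mt, et, bval, mm]; simp; ring
    · intro b
      cases b
      · simp only [RR_succ, Fintype.sum_bool, i1, i2, i3, Mt, ft, bval]
        simp
        linear_combination T.QQ w w y z k false * A1 + T.PP w w y z k false * B1
      · simp only [RR_succ, Fintype.sum_bool, i1, i2, i3, Mt, ft, bval]
        simp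
        linear_combination T.QQ w w y z k false * A2 + T.PP w w y z k false * B2

lemma pairE (h0 : y 0 = z 0) (hw : ∀ a < n, T.th (w a) ≠ 0) (hyz : ∀ a < n, T.th (y (a+1) - z (a+1)) ≠ 0)
    (hyy : ∀ a < n, T.Gn (w a) (y a) (y (a+1))) (hzz : ∀ a < n, T.Gn (w a) (z a) (z (a+1))) (hyz' : ∀ a < n, T.Gn (w a) (y a) (z (a+1)))
    (hzy' : ∀ a < n, T.Gn (w a) (z a) (y (a+1)))
    : ∑ s ∈ (Finset.range n).powerset, T.pp w w n (swq s y z) (swq s z y) *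
    T.LL w w (fun a => T.alphaE (w a) (w a)) (fun a => T.betaE (w a) (w a)) n (swq s y z) (swq s z y) = 0 := by
  cases n with
  | zero => simp [LL]
  | succ k =>
    rw [sum_ins]
    have := (invE h0 hw hyz hyy hzz hyz' hzy' k (by omega)).2.2
    simp only [RR] at this
    simp [this]
end

section
variable {w w' : ℕ → ℂ} {v : ℂ} {y z : ℕ → ℂ} {n : ℕ} (hy0 : y 0 = 0) (hz0 : z 0 = 0)
  (hv0 : T.th v ≠ 0) (hv : ∀ a < n, v = w a - w' a)
  (hw : ∀ a < n, T.th (w a) ≠ 0) (hw' : ∀ a < n, T.th (w' a) ≠ 0)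
  (hyz : ∀ a < n, T.th (y (a+1) - z (a+1)) ≠ 0)
  (hvyz : ∀ a < n, T.th (v - (y (a+1) - z (a+1))) ≠ 0)
  (hvzy : ∀ a < n, T.th (v - (z (a+1) - y (a+1))) ≠ 0)
  (hyy : ∀ a < n, T.Gn (w a) (y a) (y (a+1))) (hzz : ∀ a < n, T.Gn (w a) (z a) (z (a+1)))
  (hyz' : ∀ a < n, T.Gn (w a) (y a) (z (a+1))) (hzy' : ∀ a < n, T.Gn (w a) (z a) (y (a+1)))
  (kyy : ∀ a < n, T.Gn (w' a) (y a) (y (a+1))) (kzz : ∀ a < n, T.Gn (w' a) (z a) (z (a+1)))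
  (kyz' : ∀ a < n, T.Gn (w' a) (y a) (z (a+1))) (kzy' : ∀ a < n, T.Gn (w' a) (z a) (y (a+1)))

lemma invU (hy0 : y 0 = 0) (hz0 : z 0 = 0) (hv0 : T.th v ≠ 0)
    (hv : ∀ a < n, v = w a - w' a) (hw : ∀ a < n, T.th (w a) ≠ 0) (hw' : ∀ a < n, T.th (w' a) ≠ 0)
    (hyz : ∀ a < n, T.th (y (a+1) - z (a+1)) ≠ 0) (hvyz : ∀ a < n, T.th (v - (y (a+1) - z (a+1))) ≠ 0) (hvzy : ∀ a < n, T.th (v - (z (a+1) - y (a+1))) ≠ 0)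
    (hyy : ∀ a < n, T.Gn (w a) (y a) (y (a+1))) (hzz : ∀ a < n, T.Gn (w a) (z a) (z (a+1))) (hyz' : ∀ a < n, T.Gn (w a) (y a) (z (a+1)))
    (hzy' : ∀ a < n, T.Gn (w a) (z a) (y (a+1))) (kyy : ∀ a < n, T.Gn (w' a) (y a) (y (a+1))) (kzz : ∀ a < n, T.Gn (w' a) (z a) (z (a+1)))
    (kyz' : ∀ a < n, T.Gn (w' a) (y a) (z (a+1))) (kzy' : ∀ a < n, T.Gn (w' a) (z a) (y (a+1)))
    (k : ℕ) (hk : k < n) (b : Bool) :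
    T.RR w w' (fun _ => T.alphaU) (fun a => T.betaU (w a) (w' a)) y z k b
     + (T.eta (y (k+1) - z (k+1)) + 2 * T.rho' v) * T.PP w w' y z k b
     + 2 * T.rho (bval b (y (k+1)) (z (k+1)) - bval b (z (k+1)) (y (k+1))) * T.QQ w w' y z k b
     + 2 * T.sig v (bval b (y (k+1)) (z (k+1)) - bval b (z (k+1)) (y (k+1))) *
        (T.phi v (bval b (y (k+1)) (z (k+1)) - bval b (z (k+1)) (y (k+1))) * T.PP w w' y z k (!b)
          + T.QQ w w' y z k (!b)) = 0 := by
  induction k generalizing b with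
  | zero =>
    have B1 := lemBase (hv 0 hk) (hw 0 hk) (hw' 0 hk) hv0 (hyz 0 hk)
      (by simpa [hz0] using (hzy' 0 hk).1) (by simpa [hy0] using (hyz' 0 hk).1)
      (by simpa [hz0] using (hzy' 0 hk).2) (by simpa [hy0] using (hyz' 0 hk).2)
      (by simpa [hy0] using (kyz' 0 hk).2) (by simpa [hz0] using (kzy' 0 hk).2) (hvyz 0 hk)
    have B2 := lemBase (hv 0 hk) (hw 0 hk) (hw' 0 hk) hv0 (T.ne_symm (hyz 0 hk))
      (by simpa [hy0] using (hyz' 0 hk).1) (by simpa [hz0] using (hzy' 0 hk).1)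
      (by simpa [hy0] using (hyz' 0 hk).2) (by simpa [hz0] using (hzy' 0 hk).2)
      (by simpa [hz0] using (kzy' 0 hk).2) (by simpa [hy0] using (kyz' 0 hk).2) (hvzy 0 hk)
    rw [T.eta_sub] at B2
    cases b
    · simp only [RR_zero, QQ_zero, PP_zero, bval, hy0, hz0]
      simp only [zero_add, sub_zero] at B1 ⊢
      simp
      linear_combination B1
    · simp only [RR_zero, QQ_zero, PP_zero, bval, hy0, hz0]
      simp only [zero_add, sub_zero] at B2 ⊢
      simp
      linear_combination B2
  | succ k ih =>
    have i1 := ih (by omega) false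
    have i2 := ih (by omega) true
    have hk' : k < n := by omega
    have nD := T.ne_symm (hyz k hk')
    have vD1 : T.th (v + (y (k+1) - z (k+1))) ≠ 0 := by
      have := hvzy k hk'; rwa [show v - (z (k+1) - y (k+1)) = v + (y (k+1) - z (k+1)) by ring] at this
    have vD2 : T.th (v + (z (k+1) - y (k+1))) ≠ 0 := by
      have := hvyz k hk'; rwa [show v - (y (k+1) - z (k+1)) = v + (z (k+1) - y (k+1)) by ring] at this
    have Q1 := lemQ (hv _ hk) (hw _ hk) (hw' _ hk) hv0 (hyz _ hk) (hyz _ hk') (hyy _ hk).1 (hzz _ hk).1 (hzy' _ hk).1 (hyz' _ hk).1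
    have Q2 := lemQ (hv _ hk) (hw _ hk) (hw' _ hk) hv0 (hyz _ hk) nD (hzy' _ hk).1 (hyz' _ hk).1 (hyy _ hk).1 (hzz _ hk).1
    have Q3 := lemQ (hv _ hk) (hw _ hk) (hw' _ hk) hv0 (T.ne_symm (hyz _ hk)) (hyz _ hk') (hyz' _ hk).1 (hzy' _ hk).1 (hzz _ hk).1 (hyy _ hk).1
    have Q4 := lemQ (hv _ hk) (hw _ hk) (hw' _ hk) hv0 (T.ne_symm (hyz _ hk)) nD (hzz _ hk).1 (hyy _ hk).1 (hyz' _ hk).1 (hzy' _ hk).1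
    have P1 := lemP (hv _ hk) (hw _ hk) (hw' _ hk) hv0 (hyz _ hk) (hyz _ hk') (hyy _ hk).1 (hzz _ hk).1 (hzy' _ hk).1 (hyz' _ hk).1
      (hyy _ hk).2 (hyz' _ hk).2 (kzz _ hk).2 (kzy' _ hk).2 (hvyz _ hk) vD1
    have P2 := lemP (hv _ hk) (hw _ hk) (hw' _ hk) hv0 (hyz _ hk) nD (hzy' _ hk).1 (hyz' _ hk).1 (hyy _ hk).1 (hzz _ hk).1
      (hzy' _ hk).2 (hzz _ hk).2 (kyz' _ hk).2 (kyy _ hk).2 (hvyz _ hk) vD2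
    have P3 := lemP (hv _ hk) (hw _ hk) (hw' _ hk) hv0 (T.ne_symm (hyz _ hk)) (hyz _ hk') (hyz' _ hk).1 (hzy' _ hk).1 (hzz _ hk).1 (hyy _ hk).1
      (hyz' _ hk).2 (hyy _ hk).2 (kzy' _ hk).2 (kzz _ hk).2 (hvzy _ hk) vD1
    have P4 := lemP (hv _ hk) (hw _ hk) (hw' _ hk) hv0 (T.ne_symm (hyz _ hk)) nD (hzz _ hk).1 (hyy _ hk).1 (hyz' _ hk).1 (hzy' _ hk).1
      (hzz _ hk).2 (hzy' _ hk).2 (kyy _ hk).2 (kyz' _ hk).2 (hvzy _ hk) vD2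
    rw [T.eta_sub (z (k + 1 + 1)), ] at P3 P4
    rw [T.eta_sub (z (k + 1))] at P2 P4
    simp only [neg_sub] at Q1 Q2 Q3 Q4 P1 P2 P3 P4
    rw [T.rho_sub (z (k+1)) (y (k+1))] at Q2 Q4
    cases b
    · simp only [RR_succ, QQ_succ, PP_succ, Fintype.sum_bool, Mt, et, ft, bval, Bool.not_true, Bool.not_false] at i1 i2 ⊢
      simp only [if_true, if_false, Bool.false_eq_true] at i1 i2 ⊢
      rw [T.rho_sub (z (k+1)) (y (k+1))] at i2
      simp only [alphaU] at *
      linear_combination T.mm (w (k+1)) (w' (k+1)) (y (k+1)) (z (k+1)) (y (k+1+1)) (z (k+1+1)) * i1 +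
        T.mm (w (k+1)) (w' (k+1)) (z (k+1)) (y (k+1)) (y (k+1+1)) (z (k+1+1)) * i2 +
        2 * T.QQ w w' y z k false * Q1 + 2 * T.QQ w w' y z k true * Q2 +
        T.PP w w' y z k false * P1 + T.PP w w' y z k true * P2
    · simp only [RR_succ, QQ_succ, PP_succ, Fintype.sum_bool, Mt, et, ft, bval, Bool.not_true, Bool.not_false] at i1 i2 ⊢
      simp only [if_true, if_false, Bool.false_eq_true] at i1 i2 ⊢
      rw [T.rho_sub (z (k+1)) (y (k+1))] at i2
      simp only [alphaU] at *
      linear_combination T.mm (w (k+1)) (w' (k+1)) (y (k+1)) (z (k+1)) (z (k+1+1)) (y (k+1+1)) * i1 +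
        T.mm (w (k+1)) (w' (k+1)) (z (k+1)) (y (k+1)) (z (k+1+1)) (y (k+1+1)) * i2 +
        2 * T.QQ w w' y z k false * Q3 + 2 * T.QQ w w' y z k true * Q4 +
        T.PP w w' y z k false * P3 + T.PP w w' y z k true * P4

/-- contribution of the edge above the top level of the shorter string -/
def topX (T : TH) (v x x' d : ℂ) : ℂ :=
  T.phi v x ^ 2 + T.phi' v x + 2 * T.phi v x * d + 2 * T.rho' v + 2 * (d + T.phi v x) * T.rho x' + T.eta x'

lemma pairU (hy0 : y 0 = 0) (hz0 : z 0 = 0) (hv0 : T.th v ≠ 0)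
    (hv : ∀ a < n, v = w a - w' a) (hw : ∀ a < n, T.th (w a) ≠ 0) (hw' : ∀ a < n, T.th (w' a) ≠ 0)
    (hyz : ∀ a < n, T.th (y (a+1) - z (a+1)) ≠ 0) (hvyz : ∀ a < n, T.th (v - (y (a+1) - z (a+1))) ≠ 0) (hvzy : ∀ a < n, T.th (v - (z (a+1) - y (a+1))) ≠ 0)
    (hyy : ∀ a < n, T.Gn (w a) (y a) (y (a+1))) (hzz : ∀ a < n, T.Gn (w a) (z a) (z (a+1))) (hyz' : ∀ a < n, T.Gn (w a) (y a) (z (a+1)))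
    (hzy' : ∀ a < n, T.Gn (w a) (z a) (y (a+1))) (kyy : ∀ a < n, T.Gn (w' a) (y a) (y (a+1))) (kzz : ∀ a < n, T.Gn (w' a) (z a) (z (a+1)))
    (kyz' : ∀ a < n, T.Gn (w' a) (y a) (z (a+1))) (kzy' : ∀ a < n, T.Gn (w' a) (z a) (y (a+1)))
    (Yt : ℂ) (tz : T.Gn v (z n) Yt) (ty : T.Gn v (y n) Yt) :
    ∑ s ∈ (Finset.range n).powerset, T.pp w w' n (swq s y z) (swq s z y) * T.sig v (Yt - swq s y z n) *
    (T.LL w w' (fun _ => T.alphaU) (fun a => T.betaU (w a) (w' a)) n (swq s y z) (swq s z y)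
      + T.topX v (Yt - swq s y z n) (Yt - swq s z y n) (T.dd w w' n (swq s y z) (swq s z y))) = 0 := by
  cases n with
  | zero =>
    have := T.I1 hv0 ty.1 ty.2
    simp [LL, pp, dd, swq, topX, hy0, hz0]
    right
    simp only [hy0, sub_zero] at this
    linear_combination this
  | succ k =>
    have hk : k < k + 1 := by omega
    have i1 := invU hy0 hz0 hv0 hv hw hw' hyz hvyz hvzy hyy hzz hyz' hzy' kyy kzz kyz' kzy' k hk false
    have i2 := invU hy0 hz0 hv0 hv hw hw' hyz hvyz hvzy hyy hzz hyz' hzy' kyy kzz kyz' kzy' k hk true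
    have vD1 : T.th (v + (y (k+1) - z (k+1))) ≠ 0 := by
      have := hvzy k hk; rwa [show v - (z (k+1) - y (k+1)) = v + (y (k+1) - z (k+1)) by ring] at this
    have vD2 : T.th (v + (z (k+1) - y (k+1))) ≠ 0 := by
      have := hvyz k hk; rwa [show v - (y (k+1) - z (k+1)) = v + (z (k+1) - y (k+1)) by ring] at this
    have t1 := fun d => lemTop (T := T) (d := d) (x := Yt - y (k+1)) (x' := Yt - z (k+1)) (δ := y (k+1) - z (k+1)) (by ring) hv0
      ty.1 tz.1 (hyz k hk) ty.2 vD1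
    have t2 := fun d => lemTop (T := T) (d := d) (x := Yt - z (k+1)) (x' := Yt - y (k+1)) (δ := z (k+1) - y (k+1)) (by ring) hv0
      tz.1 ty.1 (T.ne_symm (hyz k hk)) tz.2 vD2
    have e1 : ∑ s ∈ (Finset.range k).powerset, T.pp w w' (k+1) (swq (ins false k s) y z) (swq (ins false k s) z y) *
        T.sig v (Yt - swq (ins false k s) y z (k+1)) *
      (T.LL w w' (fun _ => T.alphaU) (fun a => T.betaU (w a) (w' a)) (k+1) (swq (ins false k s) y z) (swq (ins false k s) z y)
      + T.topX v (Yt - swq (ins false k s) y z (k+1)) (Yt - swq (ins false k s) z y (k+1)) (T.dd w w' (k+1) (swq (ins false k s) y z) (swq (ins false k s) z y)))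
      = T.sig v (Yt - y (k+1)) * (T.RR w w' (fun _ => T.alphaU) (fun a => T.betaU (w a) (w' a)) y z k false
        + (T.eta (y (k+1) - z (k+1)) + 2 * T.rho' v) * T.PP w w' y z k false
        + 2 * T.rho (y (k+1) - z (k+1)) * T.QQ w w' y z k false)
        + 2 * T.sig v (Yt - z (k+1)) * T.sig v (-(y (k+1) - z (k+1))) *
          (T.phi v (-(y (k+1) - z (k+1))) * T.PP w w' y z k false + T.QQ w w' y z k false) := by
      simp only [RR, PP, QQ, Finset.mul_sum, ← Finset.sum_add_distrib]
      refine Finset.sum_congr rfl fun s hs => ?_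
      rw [swq_ins_self _ _ hs, swq_ins_self _ _ hs]
      simp only [bval, Bool.false_eq_true, if_false, topX]
      linear_combination T.pp w w' (k+1) (swq (ins false k s) y z) (swq (ins false k s) z y) * t1 (T.dd w w' (k+1) (swq (ins false k s) y z) (swq (ins false k s) z y))
    have e2 : ∑ s ∈ (Finset.range k).powerset, T.pp w w' (k+1) (swq (ins true k s) y z) (swq (ins true k s) z y) *
        T.sig v (Yt - swq (ins true k s) y z (k+1)) *
      (T.LL w w' (fun _ => T.alphaU) (fun a => T.betaU (w a) (w' a)) (k+1) (swq (ins true k s) y z) (swq (ins true k s) z y)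
      + T.topX v (Yt - swq (ins true k s) y z (k+1)) (Yt - swq (ins true k s) z y (k+1)) (T.dd w w' (k+1) (swq (ins true k s) y z) (swq (ins true k s) z y)))
      = T.sig v (Yt - z (k+1)) * (T.RR w w' (fun _ => T.alphaU) (fun a => T.betaU (w a) (w' a)) y z k true
        + (T.eta (z (k+1) - y (k+1)) + 2 * T.rho' v) * T.PP w w' y z k true
        + 2 * T.rho (z (k+1) - y (k+1)) * T.QQ w w' y z k true)
        + 2 * T.sig v (Yt - y (k+1)) * T.sig v (-(z (k+1) - y (k+1))) *
          (T.phi v (-(z (k+1) - y (k+1))) * T.PP w w' y z k true + T.QQ w w' y z k true) := by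
      simp only [RR, PP, QQ, Finset.mul_sum, ← Finset.sum_add_distrib]
      refine Finset.sum_congr rfl fun s hs => ?_
      rw [swq_ins_self _ _ hs, swq_ins_self _ _ hs]
      simp only [bval, if_true, topX]
      linear_combination T.pp w w' (k+1) (swq (ins true k s) y z) (swq (ins true k s) z y) * t2 (T.dd w w' (k+1) (swq (ins true k s) y z) (swq (ins true k s) z y))
    rw [sum_ins, Fintype.sum_bool, e1, e2]
    simp only [bval, Bool.false_eq_true, if_false, if_true, Bool.not_true, Bool.not_false] at i1 i2
    rw [T.eta_sub (z (k+1)), neg_sub, neg_sub]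
    linear_combination T.sig v (Yt - y (k+1)) * i1 + T.sig v (Yt - z (k+1)) * i2
end
end TH
end

noncomputable section

/-- The Jacobi theta function as an instance of `TH`. -/
def thJ (τ : ℂ) (hτ : 0 < τ.im) (k0 : theta1' 0 τ ≠ 0) : TH where
  th := fun t => theta1 t τ
  th1 := fun t => theta1' t τ
  th2 := fun t => Thk 2 t τ
  th3 := fun t => Thk 3 t τ
  d0 := fun x => by
    have := Thk_hasDerivAt_t 0 x hτ
    simp only [theta1_eq_Thk, Thk_one x hτ]
    exact this
  d1 := fun x => by
    have := Thk_hasDerivAt_t 1 x hτ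
    have h : (fun t => theta1' t τ) = fun s => Thk 1 s τ := funext fun s => Thk_one s hτ
    rw [h]
    exact this
  d2 := fun x => Thk_hasDerivAt_t 2 x hτ
  odd := fun x => theta_odd τ x
  three := fun x y u v => theta_three hτ x y u v
  k0 := k0

namespace TH
variable (T : TH)

lemma Lid {α : ℂ} (hα : T.th α = 0) (p q : ℂ) :
    (T.th1 p * T.th (p - α) - T.th p * T.th1 (p - α)) * (T.th q * T.th (q - α)) =
    (T.th1 q * T.th (q - α) - T.th q * T.th1 (q - α)) * (T.th p * T.th (p - α)) := by
  have h := T.s4 q (α - q) (p - α)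
  have e1 : q + (α - q) = α := by ring
  have e2 : α + (p - α) = p := by ring
  rw [e1, e2, hα, ← neg_sub q α, T.odd, T.even1] at h
  linear_combination -h

lemma exists_exp {α : ℂ} (hα : T.th α = 0) : ∃ C b q : ℂ, T.th q ≠ 0 ∧
    ∀ p, T.th p = C * Complex.exp (b * p) * T.th (p - α) := by
  obtain ⟨q, hq1, hq2⟩ : ∃ q, T.th q ≠ 0 ∧ T.th (q - α) ≠ 0 := by
    have h1 : ∀ᶠ q in 𝓝[≠] (0:ℂ), T.th q ≠ 0 := T.punct 0
    have h2 : ∀ᶠ q in 𝓝[≠] (0:ℂ), T.th (q - α) ≠ 0 := by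
      have := T.punct (0 - α)
      have ht : Tendsto (fun q : ℂ => q - α) (𝓝[≠] 0) (𝓝[≠] (0 - α)) := by
        refine tendsto_nhdsWithin_of_tendsto_nhds_of_eventually_within _ ?_ ?_
        · exact ((continuous_id.sub continuous_const).tendsto 0).mono_left nhdsWithin_le_nhds
        · filter_upwards [self_mem_nhdsWithin] with x hx
          intro h
          apply hx
          have : x - α = 0 - α := h
          simpa using this
      exact ht.eventually this
    exact (h1.and h2).exists
  set b := (T.th1 q * T.th (q - α) - T.th q * T.th1 (q - α)) / (T.th q * T.th (q - α)) with hb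
  set C := T.th q / (Complex.exp (b * q) * T.th (q - α)) with hC
  refine ⟨C, b, q, hq1, ?_⟩
  have hode : ∀ p, T.th1 p * T.th (p - α) - T.th p * T.th1 (p - α) = b * (T.th p * T.th (p - α)) := by
    intro p
    have := T.Lid hα p q
    rw [hb]; field_simp; linear_combination this
  have hcont : Continuous fun p => T.th (p - α) := T.cont0.comp (continuous_id.sub continuous_const)
  have hne : ∀ᶠ p in 𝓝 q, T.th (p - α) ≠ 0 := hcont.continuousAt.eventually_ne hq2
  obtain ⟨r, hr, hball⟩ := Metric.eventually_nhds_iff_ball.1 hne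
  have hconst : ∀ p ∈ Metric.ball q r, T.th p / (Complex.exp (b * p) * T.th (p - α)) = C := by
    intro p hp
    have hd : ∀ x ∈ Metric.ball q r, HasDerivAt (fun x => T.th x / (Complex.exp (b * x) * T.th (x - α))) 0 x := by
      intro x hx
      have h1 := T.d0 x
      have h2 : HasDerivAt (fun x => T.th (x - α)) (T.th1 (x - α)) x := by
        have := HasDerivAt.comp_sub_const x α (T.d0 (x - α))
        exact this
      have h3 : HasDerivAt (fun x => Complex.exp (b * x)) (Complex.exp (b * x) * (b * 1)) x :=
        ((hasDerivAt_id x).const_mul b).cexp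
      have := h1.div (h3.mul h2) (mul_ne_zero (Complex.exp_ne_zero _) (hball x hx))
      refine HasDerivAt.congr_deriv (f := fun x => T.th x / (Complex.exp (b * x) * T.th (x - α))) this ?_
      have h4 := hode x
      rw [div_eq_zero_iff]
      left
      simp only [Pi.mul_apply]
      linear_combination Complex.exp (b * x) * h4
    have := (convex_ball q r).is_const_of_fderivWithin_eq_zero (𝕜 := ℂ)
      (f := fun x => T.th x / (Complex.exp (b * x) * T.th (x - α)))
      (fun x hx => (hd x hx).differentiableAt.differentiableWithinAt) (fun x hx => by
        rw [fderivWithin_eq_fderiv (Metric.isOpen_ball.uniqueDiffWithinAt hx) (hd x hx).differentiableAt]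
        have h5 := (hd x hx).hasFDerivAt.fderiv
        rw [h5]; ext; simp) hp (Metric.mem_ball_self hr)
    exact this
  have hev : T.th =ᶠ[𝓝 q] fun p => C * Complex.exp (b * p) * T.th (p - α) := by
    filter_upwards [Metric.ball_mem_nhds q hr] with p hp
    have := hconst p hp
    have h6 := hball p hp
    have h7 := Complex.exp_ne_zero (b * p)
    field_simp at this
    linear_combination this
  have hA : AnalyticOnNhd ℂ T.th Set.univ := fun x _ => T.analytic x
  have hB : AnalyticOnNhd ℂ (fun p => C * Complex.exp (b * p) * T.th (p - α)) Set.univ := by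
    have : Differentiable ℂ (fun p => C * Complex.exp (b * p) * T.th (p - α)) := by
      have h1 : Differentiable ℂ (fun p => T.th (p - α)) := fun x =>
        (HasDerivAt.comp_sub_const x α (T.d0 (x - α))).differentiableAt
      fun_prop
    exact fun x _ => this.analyticAt x
  have := hA.eq_of_eventuallyEq hB hev
  exact fun p => congrFun this p
end TH

lemma th_ne {τ : ℂ} (hτ : 0 < τ.im) (k0 : theta1' 0 τ ≠ 0) {a : ℂ} (ha : ¬ inLattice τ a) :
    theta1 a τ ≠ 0 := by
  intro h0
  apply ha
  obtain ⟨C, b, q, hq, h⟩ := (thJ τ hτ k0).exists_exp (α := a) h0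
  change theta1 q τ ≠ 0 at hq
  change ∀ p, theta1 p τ = C * Complex.exp (b * p) * theta1 (p - a) τ at h
  have hb : Complex.exp b = 1 := by
    have h1 := h (q + 1)
    rw [theta_add_one, show q + 1 - a = (q - a) + 1 by ring, theta_add_one, mul_add, Complex.exp_add, mul_one] at h1
    have h2 := h q
    have : theta1 q τ * (Complex.exp b - 1) = 0 := by linear_combination h1 + Complex.exp b * h2
    rcases mul_eq_zero.1 this with h3 | h3
    · exact absurd h3 hq
    · linear_combination h3
  have hb2 : Complex.exp (b * τ + 2 * Real.pi * I * a) = 1 := by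
    have h1 := h (q + τ)
    rw [theta_add_tau, show q + τ - a = (q - a) + τ by ring, theta_add_tau, mul_add, Complex.exp_add,
      show -(Real.pi * I * τ) - 2 * Real.pi * I * (q - a) = (-(Real.pi * I * τ) - 2 * Real.pi * I * q) + 2 * Real.pi * I * a by ring,
      Complex.exp_add (-(Real.pi * I * τ) - 2 * Real.pi * I * q)] at h1
    rw [Complex.exp_add]
    have h2 := h q
    have h4 := Complex.exp_ne_zero (-(Real.pi * I * τ) - 2 * Real.pi * I * q)
    have : (Complex.exp (-(Real.pi * I * τ) - 2 * Real.pi * I * q) * theta1 q τ) * (Complex.exp (b * τ) * Complex.exp (2 * Real.pi * I * a) - 1) = 0 := by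
      linear_combination h1 + Complex.exp (-(Real.pi * I * τ) - 2 * Real.pi * I * q) * Complex.exp (b * τ) * Complex.exp (2 * Real.pi * I * a) * h2
    rcases mul_eq_zero.1 this with h3 | h3
    · exact absurd h3 (mul_ne_zero h4 hq)
    · linear_combination h3
  obtain ⟨n, hn⟩ := Complex.exp_eq_one_iff.1 hb
  obtain ⟨k, hk⟩ := Complex.exp_eq_one_iff.1 hb2
  refine ⟨k, -n, ?_⟩
  have hpi : (2 * Real.pi * I : ℂ) ≠ 0 := Complex.two_pi_I_ne_zero
  apply mul_left_cancel₀ hpi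
  rw [hn] at hk
  push_cast
  linear_combination hk

lemma eta_link {τ : ℂ} (hτ : 0 < τ.im) (k0 : theta1' 0 τ ≠ 0) {x : ℂ} (hx : theta1 x τ ≠ 0) :
    4 * (Real.pi : ℂ) * I * (deriv (fun τ' => EF x τ') τ / EF x τ) = (thJ τ hτ k0).eta x := by
  have hE : (fun τ' => EF x τ') =ᶠ[𝓝 τ] fun τ' => Thk 0 x τ' / Thk 1 0 τ' := by
    have : ∀ᶠ τ' : ℂ in 𝓝 τ, 0 < τ'.im := Complex.continuous_im.continuousAt.eventually_const_lt hτ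
    filter_upwards [this] with τ' h'
    simp only [EF, theta1_eq_Thk, Thk_one _ h']
  have hk : Thk 1 0 τ ≠ 0 := by rwa [← Thk_one 0 hτ]
  have hd := (Thk_hasDerivAt_tau 0 x hτ).div (Thk_hasDerivAt_tau 1 0 hτ) hk
  have e : deriv (fun τ' => EF x τ') τ = _ := (hE.deriv_eq).trans hd.deriv
  rw [e]
  have hx' : Thk 0 x τ ≠ 0 := by rwa [← theta1_eq_Thk]
  have hpi : (Real.pi : ℂ) ≠ 0 := by exact_mod_cast Real.pi_ne_zero
  simp only [EF, TH.eta, TH.kap, thJ, theta1_eq_Thk, Thk_one _ hτ]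
  field_simp

namespace TH
variable (T : TH)
lemma rho_hasDerivAt {x : ℂ} (hx : T.th x ≠ 0) : HasDerivAt T.rho (T.rho' x) x := by
  have := (T.d1 x).div (T.d0 x) hx
  refine HasDerivAt.congr_deriv (f := T.rho) this ?_
  rw [rho', rho]; field_simp
end TH
end

noncomputable section

namespace TH
variable (T : TH) (L : ℕ → ℂ) (N : ℕ)

/-- logarithmic derivative of the `a`-th factor of a string of length `r`. -/
def fi (r : ℕ) (u : ℕ → ℂ) (a : ℕ) : ℂ := T.phi (L a - L r) (u (a + 1) - u a)
def fi' (r : ℕ) (u : ℕ → ℂ) (a : ℕ) : ℂ := T.phi' (L a - L r) (u (a + 1) - u a)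
def Sf (r : ℕ) (u : ℕ → ℂ) (a : ℕ) : ℂ := ∑ k ∈ Finset.range a, T.fi L r u k
def Dn (r : ℕ) (u : ℕ → ℂ) (n : ℕ) : ℂ :=
  (if n < r then T.fi L r u n else 0) - (if n = r then T.Sf L r u r else 0)
def Bp (r' : ℕ) (v : ℕ → ℂ) (x : ℂ) (a : ℕ) : ℂ :=
  (if a ≤ r' then T.rho (x - v a) else 0) + (if a + 2 ≤ r' then T.rho (x - v (a + 2)) else 0)
   - 2 * (if a + 1 ≤ r' then T.rho (x - v (a + 1)) else 0)
def Xf (r : ℕ) (u : ℕ → ℂ) : ℂ := T.Sf L r u r ^ 2 + ∑ a ∈ Finset.range r, T.fi' L r u a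
def Zf (r : ℕ) (u : ℕ → ℂ) (b : ℕ) : ℂ :=
  T.fi L r u b ^ 2 + T.fi' L r u b + 2 * T.fi L r u b * T.Sf L r u b
def alloc (r : ℕ) (u : ℕ → ℂ) (r' : ℕ) : ℂ :=
  if r' < r then T.Zf L r u r' + 2 * T.rho' (L r' - L r) else if r' = r then - T.Xf L r u else 0
def etaJ (r : ℕ) (u : ℕ → ℂ) (r' : ℕ) (v : ℕ → ℂ) : ℂ :=
  (∑ a ∈ Finset.range r, if a ≤ r' then T.eta (u (a + 1) - v a) else 0)
  - ∑ a ∈ Finset.range r, if a + 1 ≤ r' then T.eta (u (a + 1) - v (a + 1)) else 0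
/-- interaction of two strings -/
def Jf (r : ℕ) (u : ℕ → ℂ) (r' : ℕ) (v : ℕ → ℂ) : ℂ :=
  ∑ n ∈ Finset.range N, T.Dn L r u n * T.Dn L r' v n
  + 2 * ∑ a ∈ Finset.range r, T.Sf L r u (a + 1) * T.Bp r' v (u (a + 1)) a
  + T.etaJ r u r' v + T.alloc L r u r'
def tg (r : ℕ) (u : ℕ → ℂ) : ℂ := ∏ a ∈ Finset.range r, T.sig (L a - L r) (u (a + 1) - u a)
def Kf (r : ℕ) (u : ℕ → ℂ) (r' : ℕ) (v : ℕ → ℂ) : ℂ := T.Jf L N r u r' v + T.Jf L N r' v r u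

end TH

lemma sum_ite_range (r n : ℕ) (h : n ≤ r) (f : ℕ → ℂ) :
    ∑ a ∈ Finset.range r, (if a + 1 ≤ n then f a else 0) = ∑ a ∈ Finset.range n, f a := by
  rw [← Finset.sum_filter]
  congr 1
  ext a; simp; omega

lemma sum_ite_range' (r n : ℕ) (h : n < r) (f : ℕ → ℂ) :
    ∑ a ∈ Finset.range r, (if a ≤ n then f a else 0) = ∑ a ∈ Finset.range n, f a + f n := by
  rw [← Finset.sum_range_succ, ← sum_ite_range r (n+1) h]
  simp

lemma sum_ite_shift (r n : ℕ) (h : n ≤ r) (f : ℕ → ℂ) (h0 : f 0 = 0) :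
    ∑ a ∈ Finset.range r, (if a + 2 ≤ n then f (a + 1) else 0) = ∑ a ∈ Finset.range n, f a := by
  cases n with
  | zero => simp
  | succ n =>
    rw [Finset.sum_range_succ', h0, add_zero, ← sum_ite_range r n (by omega)]
    simp

lemma sum_ite_shift' (r n : ℕ) (h : n < r) (f : ℕ → ℂ) (h0 : f 0 = 0) :
    ∑ a ∈ Finset.range n, (if a + 2 ≤ r then f (a + 1) else 0) = ∑ a ∈ Finset.range n, f a + f n := by
  rw [← Finset.sum_range_succ, Finset.sum_range_succ', h0, add_zero]
  refine Finset.sum_congr rfl fun a ha => ?_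
  rw [if_pos]; have := Finset.mem_range.1 ha; omega

namespace TH
variable (T : TH) (L : ℕ → ℂ) (N : ℕ)

lemma Sf_succ (r : ℕ) (u : ℕ → ℂ) (a : ℕ) : T.Sf L r u (a + 1) = T.Sf L r u a + T.fi L r u a :=
  Finset.sum_range_succ _ _
lemma Sf_zero (r : ℕ) (u : ℕ → ℂ) : T.Sf L r u 0 = 0 := rfl

lemma dd_eq (r r' : ℕ) (u v : ℕ → ℂ) (n : ℕ) :
    T.dd (fun a => L a - L r) (fun a => L a - L r') n u v = T.Sf L r u n - T.Sf L r' v n := by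
  simp only [dd, Sf, fi, Finset.sum_sub_distrib]

lemma Bsum_eq {r n : ℕ} (u v : ℕ → ℂ) (F : ℕ → ℂ) (F0 : F 0 = 0) (hn : n < r) :
    ∑ a ∈ Finset.range r, F (a + 1) * T.Bp n v (u (a + 1)) a =
    ∑ a ∈ Finset.range n, (F (a + 1) * T.rho (u (a + 1) - v a) + F a * T.rho (u a - v (a + 1))
      - 2 * (F (a + 1) * T.rho (u (a + 1) - v (a + 1)))) + F (n + 1) * T.rho (u (n + 1) - v n) := by
  have h1 := sum_ite_range' r n hn (fun a => F (a + 1) * T.rho (u (a + 1) - v a))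
  have h2 := sum_ite_shift r n hn.le (fun a => F a * T.rho (u a - v (a + 1))) (by simp [F0])
  have h3 := sum_ite_range r n hn.le (fun a => F (a + 1) * T.rho (u (a + 1) - v (a + 1)))
  rw [Finset.sum_sub_distrib, Finset.sum_add_distrib, ← Finset.mul_sum, ← h2, ← h3]
  have : ∀ A B C D E : ℂ, A = B + C → A + D - 2 * E = B + D - 2 * E + C := by intros; linear_combination ‹_ = _›
  rw [← this _ _ _ _ _ h1, Finset.mul_sum, ← Finset.sum_add_distrib, ← Finset.sum_sub_distrib]
  refine Finset.sum_congr rfl fun a _ => ?_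
  simp only [Bp]
  split_ifs <;> ring

lemma Bsum_eq_le {r n : ℕ} (u v : ℕ → ℂ) (F : ℕ → ℂ) (F0 : F 0 = 0) (hn : n = r) :
    ∑ a ∈ Finset.range r, F (a + 1) * T.Bp n v (u (a + 1)) a =
    ∑ a ∈ Finset.range n, (F (a + 1) * T.rho (u (a + 1) - v a) + F a * T.rho (u a - v (a + 1))
      - 2 * (F (a + 1) * T.rho (u (a + 1) - v (a + 1)))) := by
  subst hn
  have h2 := sum_ite_shift n n le_rfl (fun a => F a * T.rho (u a - v (a + 1))) (by simp [F0])
  rw [Finset.sum_sub_distrib, Finset.sum_add_distrib, ← h2, ← Finset.sum_add_distrib, ← Finset.sum_sub_distrib]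
  refine Finset.sum_congr rfl fun a ha => ?_
  have := Finset.mem_range.1 ha
  simp only [Bp]
  rw [if_pos (by omega : a ≤ n), if_pos (by omega : a + 1 ≤ n)]
  split_ifs <;> ring

lemma Bsum_gt {r n : ℕ} (u v : ℕ → ℂ) (F : ℕ → ℂ) (F0 : F 0 = 0) (hn : n < r) :
    ∑ a ∈ Finset.range n, F (a + 1) * T.Bp r u (v (a + 1)) a =
    ∑ a ∈ Finset.range n, (F (a + 1) * T.rho (v (a + 1) - u a) + F a * T.rho (v a - u (a + 1))
      - 2 * (F (a + 1) * T.rho (v (a + 1) - u (a + 1)))) + F n * T.rho (v n - u (n + 1)) := by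
  have h2 := sum_ite_shift' r n hn (fun a => F a * T.rho (v a - u (a + 1))) (by simp [F0])
  rw [Finset.sum_sub_distrib, Finset.sum_add_distrib]
  have : ∀ A B C D E : ℂ, A = B + C → E + A - D = E + B - D + C := by intros; linear_combination ‹_ = _›
  rw [← this _ _ _ _ _ h2, ← Finset.sum_add_distrib, ← Finset.sum_sub_distrib]
  refine Finset.sum_congr rfl fun a ha => ?_
  have := Finset.mem_range.1 ha
  simp only [Bp]
  rw [if_pos (by omega : a ≤ r), if_pos (by omega : a + 1 ≤ r)]
  split_ifs <;> ring

lemma DD_eq {r : ℕ} (hr : r < N) (u v : ℕ → ℂ) :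
    ∑ n ∈ Finset.range N, T.Dn L r u n * T.Dn L r v n =
    ∑ a ∈ Finset.range r, T.fi L r u a * T.fi L r v a + T.Sf L r u r * T.Sf L r v r := by
  have key := sum_ite_range' N r hr (fun a => if a = r then T.Sf L r u r * T.Sf L r v r else T.fi L r u a * T.fi L r v a)
  refine Eq.trans ?_ (key.trans ?_)
  · refine Finset.sum_congr rfl fun a _ => ?_
    simp only [Dn]
    rcases lt_trichotomy a r with h | h | h
    · simp [h, h.ne, h.le]
    · simp [h]
    · simp [h.not_gt, h.ne', h.not_ge]
  · simp only [if_true, add_left_inj]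
    refine Finset.sum_congr rfl fun a ha => ?_
    rw [if_neg (Finset.mem_range.1 ha).ne]

lemma DD_gt {r n : ℕ} (hr : r < N) (hn : n < r) (u v : ℕ → ℂ) :
    ∑ k ∈ Finset.range N, T.Dn L r u k * T.Dn L n v k =
    ∑ a ∈ Finset.range n, T.fi L r u a * T.fi L n v a - T.fi L r u n * T.Sf L n v n := by
  have key := sum_ite_range' N n (hn.trans hr) (fun a => if a = n then - (T.fi L r u n * T.Sf L n v n) else T.fi L r u a * T.fi L n v a)
  refine Eq.trans ?_ (key.trans ?_)
  · refine Finset.sum_congr rfl fun a _ => ?_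
    simp only [Dn]
    rcases lt_trichotomy a n with h | h | h
    · simp [h, h.ne, h.le, h.trans hn, (h.trans hn).ne]
    · simp [h, hn, hn.ne]
    · simp [h.not_gt, h.ne', h.not_ge]
  · simp only [if_true, ← sub_eq_add_neg, sub_left_inj]
    refine Finset.sum_congr rfl fun a ha => ?_
    rw [if_neg (Finset.mem_range.1 ha).ne]

lemma K_eq {r : ℕ} (hr : r < N) (u v : ℕ → ℂ) : T.Kf L N r u r v =
    T.LL (fun a => L a - L r) (fun a => L a - L r) (fun a => T.alphaE (L a - L r) (L a - L r))
      (fun a => T.betaE (L a - L r) (L a - L r)) r u v := by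
  have hsq : ∀ n, (T.Sf L r u n - T.Sf L r v n) ^ 2 = ∑ a ∈ Finset.range n,
      ((T.fi L r u a - T.fi L r v a) ^ 2 + 2 * (T.Sf L r u a - T.Sf L r v a) * (T.fi L r u a - T.fi L r v a)) := by
    intro n
    induction n with
    | zero => simp [Sf]
    | succ n ih => rw [Finset.sum_range_succ, ← ih, Sf_succ, Sf_succ]; ring
  rw [Kf, Jf, Jf, DD_eq T L N hr, DD_eq T L N hr, T.Bsum_eq_le _ _ _ (T.Sf_zero L r u) rfl,
    T.Bsum_eq_le _ _ _ (T.Sf_zero L r v) rfl]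
  simp only [alloc, lt_irrefl, if_false, if_true, Xf, etaJ]
  rw [sum_ite_range r r le_rfl, sum_ite_range r r le_rfl]
  have e1 : ∀ f : ℕ → ℂ, ∑ a ∈ Finset.range r, (if a ≤ r then f a else 0) = ∑ a ∈ Finset.range r, f a := by
    intro f
    refine Finset.sum_congr rfl fun a ha => ?_
    rw [if_pos (Finset.mem_range.1 ha).le]
  rw [e1, e1]
  have h3 := hsq r
  have : ∀ A B C D E F G H I J K M O P Q: ℂ, (P - Q)^2 = A → (B + 2 * C + (D - E) - F) + (G + 2 * H + (I - J) - K) - (A) = M →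
     (B + P * Q + 2 * C + (D - E) + -(P^2+F)) + (G + Q * P + 2 * H + (I - J) + -(Q^2+K)) = M := by
    intros A B C D E F G H I J K M O P Q h1 h2
    linear_combination h2 - h1
  refine this _ _ _ _ _ _ _ _ _ _ _ _ 0 _ _ h3 ?_
  simp only [LL, dd_eq, Finset.mul_sum]
  simp only [← Finset.sum_sub_distrib, ← Finset.sum_add_distrib]
  refine Finset.sum_congr rfl fun a _ => ?_
  simp only [Sf_succ, alphaE, betaE, fi, fi']
  rw [T.rho_sub (u a), T.rho_sub (v a), T.rho_sub (v (a+1)) (u (a+1)), T.eta_sub (v (a+1)) (u (a+1))]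
  ring

lemma K_gt {r n : ℕ} (hr : r < N) (hn : n < r) (u v : ℕ → ℂ) : T.Kf L N r u n v =
    T.LL (fun a => L a - L r) (fun a => L a - L n) (fun _ => T.alphaU)
      (fun a => T.betaU (L a - L r) (L a - L n)) n u v +
    T.topX (L n - L r) (u (n + 1) - u n) (u (n + 1) - v n)
      (T.dd (fun a => L a - L r) (fun a => L a - L n) n u v) := by
  have h0 : ∑ k ∈ Finset.range N, T.Dn L n v k * T.Dn L r u k = ∑ k ∈ Finset.range N, T.Dn L r u k * T.Dn L n v k :=
    Finset.sum_congr rfl fun _ _ => mul_comm _ _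
  rw [Kf, Jf, Jf, h0, DD_gt T L N hr hn, T.Bsum_eq _ _ _ (T.Sf_zero L r u) hn,
    T.Bsum_gt _ _ _ (T.Sf_zero L n v) hn]
  simp only [alloc, if_pos hn, if_neg hn.not_gt, if_neg hn.ne', Zf, etaJ]
  rw [sum_ite_range r n hn.le, sum_ite_range' r n hn]
  have e1 : ∀ f : ℕ → ℂ, ∑ a ∈ Finset.range n, (if a ≤ r then f a else 0) = ∑ a ∈ Finset.range n, f a := by
    intro f
    refine Finset.sum_congr rfl fun a ha => ?_
    rw [if_pos ((Finset.mem_range.1 ha).trans hn).le]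
  have e2 : ∀ f : ℕ → ℂ, ∑ a ∈ Finset.range n, (if a + 1 ≤ r then f a else 0) = ∑ a ∈ Finset.range n, f a := by
    intro f
    refine Finset.sum_congr rfl fun a ha => ?_
    rw [if_pos (Nat.succ_le_of_lt ((Finset.mem_range.1 ha).trans hn))]
  rw [e1, e2]
  simp only [topX, dd_eq, Sf_succ]
  rw [T.rho_sub (v n)]
  have hLL : T.LL (fun a => L a - L r) (fun a => L a - L n) (fun _ => T.alphaU)
      (fun a => T.betaU (L a - L r) (L a - L n)) n u v =
      2 * ∑ a ∈ Finset.range n, T.fi L r u a * T.fi L n v a +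
      2 * ∑ a ∈ Finset.range n, ((T.Sf L r u a + T.fi L r u a) * T.rho (u (a + 1) - v a) + T.Sf L r u a * T.rho (u a - v (a + 1))
      - 2 * ((T.Sf L r u a + T.fi L r u a) * T.rho (u (a + 1) - v (a + 1)))) +
      2 * ∑ a ∈ Finset.range n, ((T.Sf L n v a + T.fi L n v a) * T.rho (v (a + 1) - u a) + T.Sf L n v a * T.rho (v a - u (a + 1))
      - 2 * ((T.Sf L n v a + T.fi L n v a) * T.rho (v (a + 1) - u (a + 1)))) +
      (∑ a ∈ Finset.range n, T.eta (u (a + 1) - v a) - ∑ a ∈ Finset.range n, T.eta (u (a + 1) - v (a + 1)))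
      + (∑ a ∈ Finset.range n, T.eta (v (a + 1) - u a) - ∑ a ∈ Finset.range n, T.eta (v (a + 1) - u (a + 1))) := by
    simp only [LL, dd_eq, Finset.mul_sum]
    simp only [← Finset.sum_sub_distrib, ← Finset.sum_add_distrib]
    refine Finset.sum_congr rfl fun a _ => ?_
    simp only [alphaU, betaU, fi]
    rw [T.rho_sub (u a), T.rho_sub (v a), T.rho_sub (v (a+1)) (u (a+1)), T.eta_sub (v (a+1)) (u (a+1))]
    ring
  rw [hLL]
  have e3 : T.fi L r u n = T.phi (L n - L r) (u (n + 1) - u n) := rfl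
  have e4 : T.fi' L r u n = T.phi' (L n - L r) (u (n + 1) - u n) := rfl
  rw [e3, e4]
  ring
end TH
end

noncomputable section

namespace TH
variable (T : TH) (L : ℕ → ℂ) (N : ℕ)

/-- a generic difference of points -/
def Gd (x : ℂ) : Prop := T.th x ≠ 0 ∧ ∀ a b, a < b → b < N → T.th (L a - L b - x) ≠ 0

lemma Kf_symm (r : ℕ) (u : ℕ → ℂ) (r' : ℕ) (v : ℕ → ℂ) : T.Kf L N r u r' v = T.Kf L N r' v r u :=
  add_comm _ _

lemma two_eq {r : ℕ} (hr : r < N) (hL : ∀ a b, a < b → b < N → T.th (L a - L b) ≠ 0) {y z : ℕ → ℂ}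
    (h0 : y 0 = 0) (h0' : z 0 = 0)
    (hy : ∀ a < r, T.Gd L N (y (a + 1) - y a)) (hz : ∀ a < r, T.Gd L N (z (a + 1) - z a))
    (hyz : ∀ a < r, T.Gd L N (y (a + 1) - z a)) (hzy : ∀ a < r, T.Gd L N (z (a + 1) - y a))
    (hd : ∀ a < r, T.Gd L N (y (a + 1) - z (a + 1))) :
    ∑ s ∈ (Finset.range r).powerset, T.tg L r (swq s y z) * T.tg L r (swq s z y) *
      T.Kf L N r (swq s y z) r (swq s z y) = 0 := by
  rw [← pairE (T := T) (w := fun a => L a - L r) (y := y) (z := z) (n := r) (h0.trans h0'.symm)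
    (fun a ha => hL a r ha hr) (fun a ha => (hd a ha).1)
    (fun a ha => ⟨(hy a ha).1, (hy a ha).2 a r ha hr⟩) (fun a ha => ⟨(hz a ha).1, (hz a ha).2 a r ha hr⟩)
    (fun a ha => ⟨(hzy a ha).1, (hzy a ha).2 a r ha hr⟩) (fun a ha => ⟨(hyz a ha).1, (hyz a ha).2 a r ha hr⟩)]
  refine Finset.sum_congr rfl fun s _ => ?_
  rw [T.K_eq L N hr]
  congr 1
  simp only [pp, tg, mm, Finset.prod_mul_distrib]

lemma swq_above {s : Finset ℕ} {n : ℕ} (hs : s ∈ (Finset.range n).powerset) (y z : ℕ → ℂ) {a : ℕ} (ha : n < a) :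
    swq s y z a = y a := by
  cases a with
  | zero => omega
  | succ a =>
    simp only [swq]
    rw [if_neg]
    intro h
    have := Finset.mem_range.1 (Finset.mem_powerset.1 hs h)
    omega

lemma two_gt {r n : ℕ} (hr : r < N) (hn : n < r) (hL : ∀ a b, a < b → b < N → T.th (L a - L b) ≠ 0) {y z : ℕ → ℂ}
    (h0 : y 0 = 0) (h0' : z 0 = 0)
    (hy : ∀ a < r, T.Gd L N (y (a + 1) - y a)) (hz : ∀ a < n, T.Gd L N (z (a + 1) - z a))
    (hyz : ∀ a ≤ n, T.Gd L N (y (a + 1) - z a)) (hzy : ∀ a < n, T.Gd L N (z (a + 1) - y a))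
    (hd : ∀ a < n, T.Gd L N (y (a + 1) - z (a + 1))) (hd' : ∀ a < n, T.Gd L N (z (a + 1) - y (a + 1))) :
    ∑ s ∈ (Finset.range n).powerset, T.tg L r (swq s y z) * T.tg L n (swq s z y) *
      T.Kf L N r (swq s y z) n (swq s z y) = 0 := by
  have hnN : n < N := hn.trans hr
  have key := pairU (T := T) (w := fun a => L a - L r) (w' := fun a => L a - L n) (v := L n - L r) (y := y) (z := z) (n := n) h0 h0'
    (hL n r hn hr) (fun a _ => by ring)
    (fun a ha => hL a r (ha.trans hn) hr) (fun a ha => hL a n ha hnN) (fun a ha => (hd a ha).1)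
    (fun a ha => (hd a ha).2 n r hn hr) (fun a ha => (hd' a ha).2 n r hn hr)
    (fun a ha => ⟨(hy a (ha.trans hn)).1, (hy a (ha.trans hn)).2 a r (ha.trans hn) hr⟩)
    (fun a ha => ⟨(hz a ha).1, (hz a ha).2 a r (ha.trans hn) hr⟩)
    (fun a ha => ⟨(hzy a ha).1, (hzy a ha).2 a r (ha.trans hn) hr⟩)
    (fun a ha => ⟨(hyz a ha.le).1, (hyz a ha.le).2 a r (ha.trans hn) hr⟩)
    (fun a ha => ⟨(hy a (ha.trans hn)).1, (hy a (ha.trans hn)).2 a n ha hnN⟩)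
    (fun a ha => ⟨(hz a ha).1, (hz a ha).2 a n ha hnN⟩)
    (fun a ha => ⟨(hzy a ha).1, (hzy a ha).2 a n ha hnN⟩)
    (fun a ha => ⟨(hyz a ha.le).1, (hyz a ha.le).2 a n ha hnN⟩)
    (y (n + 1)) ⟨(hyz n le_rfl).1, (hyz n le_rfl).2 n r hn hr⟩ ⟨(hy n hn).1, (hy n hn).2 n r hn hr⟩
  have : ∀ s ∈ (Finset.range n).powerset, T.tg L r (swq s y z) * T.tg L n (swq s z y) *
      T.Kf L N r (swq s y z) n (swq s z y) =
      (∏ a ∈ Finset.Ico (n + 1) r, T.sig (L a - L r) (y (a + 1) - y a)) *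
      (T.pp (fun a => L a - L r) (fun a => L a - L n) n (swq s y z) (swq s z y) * T.sig (L n - L r) (y (n+1) - swq s y z n) *
    (T.LL (fun a => L a - L r) (fun a => L a - L n) (fun _ => T.alphaU) (fun a => T.betaU (L a - L r) (L a - L n)) n (swq s y z) (swq s z y)
      + T.topX (L n - L r) (y (n+1) - swq s y z n) (y (n+1) - swq s z y n) (T.dd (fun a => L a - L r) (fun a => L a - L n) n (swq s y z) (swq s z y)))) := by
    intro s hs
    rw [T.K_gt L N hr hn, swq_above hs y z (Nat.lt_succ_self n)]
    have e : T.tg L r (swq s y z) = (∏ a ∈ Finset.range n, T.sig (L a - L r) (swq s y z (a + 1) - swq s y z a)) *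
        T.sig (L n - L r) (y (n+1) - swq s y z n) * ∏ a ∈ Finset.Ico (n + 1) r, T.sig (L a - L r) (y (a + 1) - y a) := by
      rw [tg, ← Finset.prod_range_mul_prod_Ico _ hn, Finset.prod_range_succ, swq_above hs y z (Nat.lt_succ_self n)]
      congr 1
      refine Finset.prod_congr rfl fun a ha => ?_
      have := Finset.mem_Ico.1 ha
      rw [swq_above hs y z (by omega), swq_above hs y z (by omega)]
    rw [e]
    simp only [pp, tg, mm, Finset.prod_mul_distrib]
    ring
  rw [Finset.sum_congr rfl this, ← Finset.mul_sum, key, mul_zero]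

/-- The two-string identity in symmetric form. -/
lemma two {r r' : ℕ} (hr : r < N) (hr' : r' < N) (hL : ∀ a b, a < b → b < N → T.th (L a - L b) ≠ 0) {y z : ℕ → ℂ}
    (h0 : y 0 = 0) (h0' : z 0 = 0)
    (hy : ∀ a < r, T.Gd L N (y (a + 1) - y a)) (hz : ∀ a < r', T.Gd L N (z (a + 1) - z a))
    (hyz : ∀ a < r, a ≤ r' → T.Gd L N (y (a + 1) - z a)) (hzy : ∀ a < r', a ≤ r → T.Gd L N (z (a + 1) - y a))
    (hd : ∀ a < r, a < r' → T.Gd L N (y (a + 1) - z (a + 1)))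
    (hd' : ∀ a < r, a < r' → T.Gd L N (z (a + 1) - y (a + 1))) :
    ∑ s ∈ (Finset.range (min r r')).powerset, T.tg L r (swq s y z) * T.tg L r' (swq s z y) *
      T.Kf L N r (swq s y z) r' (swq s z y) = 0 := by
  rcases lt_trichotomy r r' with h | h | h
  · rw [min_eq_left h.le]
    rw [← T.two_gt L N hr' h hL h0' h0 hz hy (fun a ha => hzy a (by omega) ha) (fun a ha => hyz a ha (by omega))
      (fun a ha => hd' a ha (by omega)) (fun a ha => hd a ha (by omega))]
    refine Finset.sum_congr rfl fun s _ => ?_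
    rw [Kf_symm, mul_comm (T.tg L r _)]
  · subst h
    rw [min_self]
    exact T.two_eq L N hr hL h0 h0' hy hz (fun a ha => hyz a ha ha.le) (fun a ha => hzy a ha ha.le) (fun a ha => hd a ha ha)
  · rw [min_eq_right h.le]
    exact T.two_gt L N hr h hL h0 h0' hy hz (fun a ha => hyz a (by omega) ha) (fun a ha => hzy a ha (by omega))
      (fun a ha => hd a (by omega) ha) (fun a ha => hd' a (by omega) ha)
end TH

section strings
variable {m : ℕ} {ι : Type*} [Fintype ι] [DecidableEq ι] (c : Fin m → ℕ) (t : Fin m → ℂ) (N p : ℕ)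

def cnt (g : Fin m → ι) (i : ι) (a : ℕ) : ℕ := (Finset.univ.filter fun k => g k = i ∧ c k = a).card
def len (g : Fin m → ι) (i : ι) : ℕ := ∑ a ∈ Finset.range N, cnt c g i a
def yv (g : Fin m → ι) (i : ι) : ℕ → ℂ
  | 0 => 0
  | a + 1 => ∑ k ∈ Finset.univ.filter (fun k => g k = i ∧ c k = a), t k
/-- Assignments of the Bethe variables to strings. -/
def Valid (g : Fin m → ι) : Prop :=
  (∀ i a, cnt c g i a = if a < len c N g i then 1 else 0) ∧ ∀ r < N, (Finset.univ.filter fun i => len c N g i = r).card = p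

def act (s : Finset ℕ) (i j : ι) (g : Fin m → ι) (k : Fin m) : ι :=
  if c k ∈ s then Equiv.swap i j (g k) else g k

variable {c t N p}

lemma act_eq_iff {s : Finset ℕ} {i j x : ι} {g : Fin m → ι} {k : Fin m} {a : ℕ} :
    (act c s i j g k = x ∧ c k = a) ↔ (g k = (if a ∈ s then Equiv.swap i j x else x) ∧ c k = a) := by
  constructor
  · rintro ⟨h1, h2⟩
    subst h2
    refine ⟨?_, rfl⟩
    rw [act] at h1
    split_ifs with h
    · rw [if_pos h] at h1; exact Equiv.swap_apply_eq_iff.1 h1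
    · rw [if_neg h] at h1; exact h1
  · rintro ⟨h1, h2⟩
    subst h2
    refine ⟨?_, rfl⟩
    rw [act]
    split_ifs with h
    · rw [h1, if_pos h]; simp
    · rw [h1, if_neg h]

lemma cnt_act (s : Finset ℕ) (i j x : ι) (g : Fin m → ι) (a : ℕ) :
    cnt c (act c s i j g) x a = cnt c g (if a ∈ s then Equiv.swap i j x else x) a := by
  simp only [cnt, act_eq_iff]

lemma yv_act (s : Finset ℕ) (i j x : ι) (g : Fin m → ι) (a : ℕ) :
    yv c t (act c s i j g) x (a + 1) = yv c t g (if a ∈ s then Equiv.swap i j x else x) (a + 1) := by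
  simp only [yv, act_eq_iff]

lemma act_act (s : Finset ℕ) (i j : ι) (g : Fin m → ι) : act c s i j (act c s i j g) = g := by
  funext k
  simp only [act]
  split_ifs <;> simp

lemma cnt_act_valid {g : Fin m → ι} (hg : Valid c N p g) {i j : ι} {s : Finset ℕ}
    (hs : s ∈ (Finset.range (min (len c N g i) (len c N g j))).powerset) : cnt c (act c s i j g) = cnt c g := by
  funext x a
  rw [cnt_act]
  split_ifs with h
  · have ha := Finset.mem_range.1 (Finset.mem_powerset.1 hs h)
    have hi : cnt c g i a = 1 := by rw [hg.1, if_pos (by omega)]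
    have hj : cnt c g j a = 1 := by rw [hg.1, if_pos (by omega)]
    rw [Equiv.swap_apply_def]
    split_ifs with h1 h2
    · rw [hj, h1, hi]
    · rw [hi, h2, hj]
    · rfl
  · rfl

lemma len_act_valid {g : Fin m → ι} (hg : Valid c N p g) {i j : ι} {s : Finset ℕ}
    (hs : s ∈ (Finset.range (min (len c N g i) (len c N g j))).powerset) : len c N (act c s i j g) = len c N g := by
  funext x
  simp only [len, cnt_act_valid hg hs]

lemma act_valid {g : Fin m → ι} (hg : Valid c N p g) {i j : ι} {s : Finset ℕ}
    (hs : s ∈ (Finset.range (min (len c N g i) (len c N g j))).powerset) : Valid c N p (act c s i j g) := by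
  simp only [Valid, len_act_valid hg hs, cnt_act_valid hg hs]
  exact hg

lemma yv_act_i (s : Finset ℕ) (i j : ι) (g : Fin m → ι) :
    yv c t (act c s i j g) i = swq s (yv c t g i) (yv c t g j) := by
  funext a
  cases a with
  | zero => rfl
  | succ a =>
    rw [yv_act]
    simp only [swq]
    split_ifs <;> simp

lemma yv_act_j (s : Finset ℕ) (i j : ι) (g : Fin m → ι) :
    yv c t (act c s i j g) j = swq s (yv c t g j) (yv c t g i) := by
  funext a
  cases a with
  | zero => rfl
  | succ a =>
    rw [yv_act]
    simp only [swq]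
    split_ifs <;> simp

lemma yv_act_ne (s : Finset ℕ) {i j x : ι} (h1 : x ≠ i) (h2 : x ≠ j) (g : Fin m → ι) :
    yv c t (act c s i j g) x = yv c t g x := by
  funext a
  cases a with
  | zero => rfl
  | succ a =>
    rw [yv_act, Equiv.swap_apply_of_ne_of_ne h1 h2]
    simp

lemma len_lt {g : Fin m → ι} (hg : Valid c N p g) (hc : ∀ i, c i + 2 ≤ N) (hN : 0 < N) (i : ι) : len c N g i < N := by
  by_contra h
  have h1 := hg.1 i (N - 1)
  rw [if_pos (by omega)] at h1
  rw [cnt, Finset.card_eq_one] at h1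
  obtain ⟨k, hk⟩ := h1
  have : k ∈ ({k} : Finset (Fin m)) := Finset.mem_singleton_self k
  rw [← hk, Finset.mem_filter] at this
  have := hc k
  omega

/-- in a valid configuration, level `a+1` of string `i` is a single Bethe variable -/
lemma yv_succ {g : Fin m → ι} (hg : Valid c N p g) {i : ι} {a : ℕ} (ha : a < len c N g i) :
    ∃ k, g k = i ∧ c k = a ∧ yv c t g i (a + 1) = t k := by
  have h1 := hg.1 i a
  rw [if_pos ha, cnt, Finset.card_eq_one] at h1
  obtain ⟨k, hk⟩ := h1
  have h2 : k ∈ ({k} : Finset (Fin m)) := Finset.mem_singleton_self k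
  rw [← hk, Finset.mem_filter] at h2
  exact ⟨k, h2.2.1, h2.2.2, by simp only [yv]; rw [hk, Finset.sum_singleton]⟩

end strings

section pairsum
variable {m : ℕ} {ι : Type*} [Fintype ι] [DecidableEq ι] (T : TH) (L : ℕ → ℂ) (c : Fin m → ℕ) (t : Fin m → ℂ) (N p : ℕ)

def Tg (g : Fin m → ι) : ℂ := ∏ i, T.tg L (len c N g i) (yv c t g i)

/-- genericity of the weights -/
structure Gen : Prop where
  hL : ∀ a b, a < b → b < N → T.th (L a - L b) ≠ 0
  h1 : ∀ k, T.Gd L N (t k)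
  h2 : ∀ k l, k ≠ l → T.Gd L N (t k - t l)

variable {T L c t N p}

lemma gd_yy (hG : Gen T L t N) {g : Fin m → ι} (hg : Valid c N p g) {i j : ι} {a b : ℕ} (ha : a < len c N g i)
    (hb : b ≤ len c N g j) (hne : i ≠ j ∨ b ≠ a + 1) : T.Gd L N (yv c t g i (a + 1) - yv c t g j b) := by
  obtain ⟨k, hk1, hk2, hk3⟩ := yv_succ (t := t) hg ha
  rw [hk3]
  cases b with
  | zero => simpa [yv] using hG.h1 k
  | succ b =>
    obtain ⟨l, hl1, hl2, hl3⟩ := yv_succ (t := t) hg (Nat.lt_of_succ_le hb)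
    rw [hl3]
    apply hG.h2
    rintro rfl
    rcases hne with h | h
    · exact h (hk1.symm.trans hl1)
    · omega

open Classical in
lemma pair_sum (hG : Gen T L t N) (hc : ∀ i, c i + 2 ≤ N) (hN : 0 < N) {i j : ι} (hij : i ≠ j) :
    ∑ g ∈ Finset.univ.filter (fun g : Fin m → ι => Valid c N p g), Tg T L c t N g *
      T.Kf L N (len c N g i) (yv c t g i) (len c N g j) (yv c t g j) = 0 := by
  set V := Finset.univ.filter (fun g : Fin m → ι => Valid c N p g) with hV
  set F : (Fin m → ι) → ℂ := fun g => Tg T L c t N g *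
      T.Kf L N (len c N g i) (yv c t g i) (len c N g j) (yv c t g j) with hF
  have hmap : ∀ g ∈ V, (len c N g i, len c N g j) ∈ (V.image fun g => (len c N g i, len c N g j)) :=
    fun g hg => Finset.mem_image_of_mem _ hg
  rw [← Finset.sum_fiberwise_of_maps_to hmap]
  refine Finset.sum_eq_zero fun rr _ => ?_
  obtain ⟨r, r'⟩ := rr
  set W := V.filter (fun g => (len c N g i, len c N g j) = (r, r')) with hW
  have hWm : ∀ g, g ∈ W ↔ Valid c N p g ∧ len c N g i = r ∧ len c N g j = r' := by
    intro g; simp [hW, hV]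
  have hs : ∀ s ∈ (Finset.range (min r r')).powerset, ∑ g ∈ W, F (act c s i j g) = ∑ g ∈ W, F g := by
    intro s hs
    have hmem : ∀ g ∈ W, act c s i j g ∈ W := by
      intro g hg
      rw [hWm] at hg ⊢
      obtain ⟨h1, h2, h3⟩ := hg
      have hs' : s ∈ (Finset.range (min (len c N g i) (len c N g j))).powerset := by rw [h2, h3]; exact hs
      rw [len_act_valid h1 hs']
      exact ⟨act_valid h1 hs', h2, h3⟩
    refine Finset.sum_bij' (fun g _ => act c s i j g) (fun g _ => act c s i j g) hmem hmem ?_ ?_ ?_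
    · intro g _; exact act_act s i j g
    · intro g _; exact act_act s i j g
    · intro g _; rfl
  have h0 : ∑ s ∈ (Finset.range (min r r')).powerset, ∑ g ∈ W, F (act c s i j g) = 0 := by
    rw [Finset.sum_comm]
    refine Finset.sum_eq_zero fun g hg => ?_
    obtain ⟨hv, h2, h3⟩ := (hWm g).1 hg
    have hfac : ∀ h : Fin m → ι, Tg T L c t N h = (∏ x ∈ (Finset.univ.erase i).erase j, T.tg L (len c N h x) (yv c t h x)) *
        (T.tg L (len c N h i) (yv c t h i) * T.tg L (len c N h j) (yv c t h j)) := by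
      intro h
      rw [Tg, ← Finset.mul_prod_erase Finset.univ _ (Finset.mem_univ i),
        ← Finset.mul_prod_erase (Finset.univ.erase i) _ (Finset.mem_erase.2 ⟨hij.symm, Finset.mem_univ j⟩)]
      ring
    have h4 : ∀ s ∈ (Finset.range (min r r')).powerset, F (act c s i j g) =
       (∏ x ∈ (Finset.univ.erase i).erase j, T.tg L (len c N g x) (yv c t g x)) *
       (T.tg L r (swq s (yv c t g i) (yv c t g j)) * T.tg L r' (swq s (yv c t g j) (yv c t g i)) *
        T.Kf L N r (swq s (yv c t g i) (yv c t g j)) r' (swq s (yv c t g j) (yv c t g i))) := by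
      intro s hs
      have hs' : s ∈ (Finset.range (min (len c N g i) (len c N g j))).powerset := by rw [h2, h3]; exact hs
      simp only [hF]
      rw [hfac, len_act_valid hv hs', yv_act_i, yv_act_j, h2, h3]
      have : (∏ x ∈ (Finset.univ.erase i).erase j, T.tg L (len c N g x) (yv c t (act c s i j g) x)) =
          ∏ x ∈ (Finset.univ.erase i).erase j, T.tg L (len c N g x) (yv c t g x) := by
        refine Finset.prod_congr rfl fun x hx => ?_
        simp only [Finset.mem_erase] at hx
        rw [yv_act_ne s hx.2.1 hx.1]
      rw [this]
      ring
    rw [Finset.sum_congr rfl h4, ← Finset.mul_sum]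
    have hlt := fun x => len_lt hv hc hN x
    rw [T.two L N (h2 ▸ hlt i) (h3 ▸ hlt j) hG.hL rfl rfl, mul_zero]
    · intro a ha; exact gd_yy hG hv (h2 ▸ ha) (h2 ▸ ha.le) (Or.inr (by omega))
    · intro a ha; exact gd_yy hG hv (h3 ▸ ha) (h3 ▸ ha.le) (Or.inr (by omega))
    · intro a ha hb; exact gd_yy hG hv (h2 ▸ ha) (h3 ▸ hb) (Or.inr (by omega))
    · intro a ha hb; exact gd_yy hG hv (h3 ▸ ha) (h2 ▸ hb) (Or.inr (by omega))
    · intro a ha hb; exact gd_yy hG hv (h2 ▸ ha) (h3 ▸ hb) (Or.inl hij)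
    · intro a ha hb; exact gd_yy hG hv (h3 ▸ hb) (h2 ▸ ha) (Or.inl hij.symm)
  rw [Finset.sum_congr rfl hs, Finset.sum_const, nsmul_eq_mul, mul_eq_zero] at h0
  rcases h0 with h0 | h0
  · simp at h0
  · exact h0
end pairsum
end

noncomputable section

namespace TH
variable (T : TH) (L : ℕ → ℂ) (N : ℕ)

lemma Bself (r : ℕ) (u : ℕ → ℂ) :
    ∑ a ∈ Finset.range r, T.Sf L r u (a + 1) * T.Bp r u (u (a + 1)) a =
    ∑ a ∈ Finset.range r, T.fi L r u a * T.rho (u (a + 1) - u a) := by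
  rw [T.Bsum_eq_le u u _ (T.Sf_zero L r u) rfl]
  refine Finset.sum_congr rfl fun a _ => ?_
  rw [T.rho_sub (u a), sub_self, T.rho_zero, Sf_succ]
  ring

lemma self_eq {r : ℕ} (hr : r < N) (hL : ∀ a b, a < b → b < N → T.th (L a - L b) ≠ 0) {u : ℕ → ℂ}
    (hu : ∀ a < r, T.Gd L N (u (a + 1) - u a)) :
    ∑ n ∈ Finset.range N, T.Dn L r u n * T.Dn L r u n
    + 2 * ∑ a ∈ Finset.range r, T.Sf L r u (a + 1) * T.Bp r u (u (a + 1)) a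
    + ∑ a ∈ Finset.range r, T.eta (u (a + 1) - u a) + 2 * ∑ a ∈ Finset.range r, T.fi' L r u a
    + 2 * ∑ a ∈ Finset.range r, T.rho' (L a - L r) = T.Xf L r u := by
  rw [T.DD_eq L N hr, Bself, Xf]
  have : ∑ a ∈ Finset.range r, (T.fi L r u a * T.fi L r u a) + 2 * ∑ a ∈ Finset.range r, T.fi L r u a * T.rho (u (a + 1) - u a)
     + ∑ a ∈ Finset.range r, T.eta (u (a + 1) - u a) + ∑ a ∈ Finset.range r, T.fi' L r u a
    + 2 * ∑ a ∈ Finset.range r, T.rho' (L a - L r) = 0 := by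
    simp only [Finset.mul_sum, ← Finset.sum_add_distrib]
    refine Finset.sum_eq_zero fun a ha => ?_
    have ha' := Finset.mem_range.1 ha
    have := T.I1 (hL a r ha' hr) (hu a ha').1 ((hu a ha').2 a r ha' hr)
    simp only [fi, fi']
    linear_combination this
  linear_combination this

lemma X_eq (r : ℕ) (u : ℕ → ℂ) : T.Xf L r u = ∑ b ∈ Finset.range r, T.Zf L r u b := by
  have : ∀ n, T.Sf L r u n ^ 2 + ∑ a ∈ Finset.range n, T.fi' L r u a = ∑ b ∈ Finset.range n, T.Zf L r u b := by
    intro n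
    induction n with
    | zero => simp [Sf]
    | succ n ih => rw [Finset.sum_range_succ, Finset.sum_range_succ, ← ih, Sf_succ, Zf]; ring
  exact this r

lemma alloc_sum {r : ℕ} (hr : r < N) (u : ℕ → ℂ) : ∑ r' ∈ Finset.range N, T.alloc L r u r' =
    2 * ∑ b ∈ Finset.range r, T.rho' (L b - L r) := by
  have key := sum_ite_range' N r hr (fun a => T.alloc L r u a)
  have e1 : ∑ r' ∈ Finset.range N, T.alloc L r u r' = ∑ a ∈ Finset.range N, (if a ≤ r then T.alloc L r u a else 0) := by
    refine Finset.sum_congr rfl fun a _ => ?_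
    split_ifs with h
    · rfl
    · simp only [alloc]; rw [if_neg (by omega), if_neg (by omega)]
  rw [e1, key]
  have e2 : ∑ a ∈ Finset.range r, T.alloc L r u a = ∑ a ∈ Finset.range r, (T.Zf L r u a + 2 * T.rho' (L a - L r)) := by
    refine Finset.sum_congr rfl fun a ha => ?_
    rw [alloc, if_pos (Finset.mem_range.1 ha)]
  rw [e2, Finset.sum_add_distrib, ← X_eq, ← Finset.mul_sum, alloc, if_neg (lt_irrefl _), if_pos rfl]
  ring
end TH

section
variable {m : ℕ} {ι : Type*} [Fintype ι] [DecidableEq ι] {T : TH} {L : ℕ → ℂ} {c : Fin m → ℕ} {t : Fin m → ℂ} {N p : ℕ}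

lemma sum_len {g : Fin m → ι} (hg : Valid c N p g) (hc : ∀ i, c i + 2 ≤ N) (hN : 0 < N) (h : ℕ → ℂ) :
    ∑ i, h (len c N g i) = p * ∑ r ∈ Finset.range N, h r := by
  have hmap : ∀ i ∈ (Finset.univ : Finset ι), len c N g i ∈ Finset.range N :=
    fun i _ => Finset.mem_range.2 (len_lt hg hc hN i)
  rw [← Finset.sum_fiberwise_of_maps_to hmap, Finset.mul_sum]
  refine Finset.sum_congr rfl fun r hr => ?_
  rw [Finset.sum_congr rfl (g := fun _ => h r) (fun i hi => by rw [(Finset.mem_filter.1 hi).2]), Finset.sum_const,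
    hg.2 r (Finset.mem_range.1 hr), nsmul_eq_mul]

variable (T L c t N p)
/-- total local energy of a configuration -/
def Tot (g : Fin m → ι) : ℂ :=
  ∑ n ∈ Finset.range N, (∑ i, T.Dn L (len c N g i) (yv c t g i) n) ^ 2
  + 2 * ∑ i, ∑ a ∈ Finset.range (len c N g i), T.fi' L (len c N g i) (yv c t g i) a
  + 2 * ∑ i, ∑ a ∈ Finset.range (len c N g i), T.Sf L (len c N g i) (yv c t g i) (a + 1) *
      ∑ j, T.Bp (len c N g j) (yv c t g j) (yv c t g i (a + 1)) a
  + 2 * p * (p + 1) * ∑ b ∈ Finset.range N, ∑ a ∈ Finset.range b, T.rho' (L a - L b)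
  + ∑ i, (∑ j ∈ Finset.univ.erase i, T.etaJ (len c N g i) (yv c t g i) (len c N g j) (yv c t g j)
      + ∑ a ∈ Finset.range (len c N g i), T.eta (yv c t g i (a + 1) - yv c t g i a))
variable {T L c t N p}

lemma Tot_eq (hG : Gen T L t N) (hc : ∀ i, c i + 2 ≤ N) (hN : 0 < N) {g : Fin m → ι} (hg : Valid c N p g) :
    Tot T L c t N p g = ∑ i, ∑ j ∈ Finset.univ.erase i, T.Jf L N (len c N g i) (yv c t g i) (len c N g j) (yv c t g j) := by
  have hlt := fun x => len_lt hg hc hN x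
  simp only [TH.Jf, Finset.sum_add_distrib]
  -- D terms
  have hD : ∑ i, ∑ j ∈ Finset.univ.erase i, ∑ n ∈ Finset.range N, T.Dn L (len c N g i) (yv c t g i) n * T.Dn L (len c N g j) (yv c t g j) n
     = ∑ n ∈ Finset.range N, (∑ i, T.Dn L (len c N g i) (yv c t g i) n) ^ 2 -
       ∑ i, ∑ n ∈ Finset.range N, T.Dn L (len c N g i) (yv c t g i) n * T.Dn L (len c N g i) (yv c t g i) n := by
    have : ∀ n, (∑ i, T.Dn L (len c N g i) (yv c t g i) n) ^ 2 = ∑ i, ∑ j, T.Dn L (len c N g i) (yv c t g i) n * T.Dn L (len c N g j) (yv c t g j) n := by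
      intro n; rw [sq, Finset.sum_mul_sum]
    simp only [this]
    rw [Finset.sum_comm (s := Finset.range N), ← Finset.sum_sub_distrib]
    refine Finset.sum_congr rfl fun i _ => ?_
    rw [Finset.sum_erase_eq_sub (Finset.mem_univ i), Finset.sum_comm (s := Finset.range N)]
  have hB : ∑ i, ∑ j ∈ Finset.univ.erase i, 2 * ∑ a ∈ Finset.range (len c N g i), T.Sf L (len c N g i) (yv c t g i) (a + 1) *
       T.Bp (len c N g j) (yv c t g j) (yv c t g i (a + 1)) a =
     2 * ∑ i, ∑ a ∈ Finset.range (len c N g i), T.Sf L (len c N g i) (yv c t g i) (a + 1) *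
      ∑ j, T.Bp (len c N g j) (yv c t g j) (yv c t g i (a + 1)) a
     - ∑ i, 2 * ∑ a ∈ Finset.range (len c N g i), T.Sf L (len c N g i) (yv c t g i) (a + 1) *
       T.Bp (len c N g i) (yv c t g i) (yv c t g i (a + 1)) a := by
    rw [Finset.mul_sum, ← Finset.sum_sub_distrib]
    refine Finset.sum_congr rfl fun i _ => ?_
    rw [Finset.sum_erase_eq_sub (Finset.mem_univ i), ← Finset.mul_sum, Finset.sum_comm]
    simp only [Finset.mul_sum]
  have hA : ∑ i, ∑ j ∈ Finset.univ.erase i, T.alloc L (len c N g i) (yv c t g i) (len c N g j) =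
      ∑ i, T.Xf L (len c N g i) (yv c t g i) + p * ∑ i, 2 * ∑ b ∈ Finset.range (len c N g i), T.rho' (L b - L (len c N g i)) := by
    rw [Finset.mul_sum, ← Finset.sum_add_distrib]
    refine Finset.sum_congr rfl fun i _ => ?_
    rw [Finset.sum_erase_eq_sub (Finset.mem_univ i), sum_len hg hc hN (T.alloc L (len c N g i) (yv c t g i)),
      T.alloc_sum L N (hlt i)]
    rw [TH.alloc, if_neg (lt_irrefl _), if_pos rfl]
    ring
  have hR : ∑ i, 2 * ∑ b ∈ Finset.range (len c N g i), T.rho' (L b - L (len c N g i)) =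
      2 * p * ∑ b ∈ Finset.range N, ∑ a ∈ Finset.range b, T.rho' (L a - L b) := by
    rw [sum_len hg hc hN (fun r => 2 * ∑ b ∈ Finset.range r, T.rho' (L b - L r)), ← Finset.mul_sum]
    ring
  have hS : ∑ i, ∑ n ∈ Finset.range N, T.Dn L (len c N g i) (yv c t g i) n * T.Dn L (len c N g i) (yv c t g i) n
     + ∑ i, 2 * ∑ a ∈ Finset.range (len c N g i), T.Sf L (len c N g i) (yv c t g i) (a + 1) *
       T.Bp (len c N g i) (yv c t g i) (yv c t g i (a + 1)) a
     + ∑ i, ∑ a ∈ Finset.range (len c N g i), T.eta (yv c t g i (a + 1) - yv c t g i a)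
     + ∑ i, 2 * ∑ a ∈ Finset.range (len c N g i), T.fi' L (len c N g i) (yv c t g i) a
     + ∑ i, 2 * ∑ b ∈ Finset.range (len c N g i), T.rho' (L b - L (len c N g i)) =
     ∑ i, T.Xf L (len c N g i) (yv c t g i) := by
    simp only [← Finset.sum_add_distrib]
    refine Finset.sum_congr rfl fun i _ => ?_
    exact T.self_eq L N (hlt i) hG.hL (fun a ha => gd_yy hG hg ha ha.le (Or.inr (by omega)))
  rw [hD, hB, hA, hR, ← hS, hR, Tot, Finset.sum_add_distrib]
  rw [← Finset.mul_sum (s := Finset.univ) (f := fun i => ∑ a ∈ Finset.range (len c N g i), T.fi' L (len c N g i) (yv c t g i) a)]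
  ring

open Classical in
/-- The main identity for sums over string configurations. -/
lemma main_sum (hG : Gen T L t N) (hc : ∀ i, c i + 2 ≤ N) (hN : 0 < N) :
    ∑ g ∈ Finset.univ.filter (fun g : Fin m → ι => Valid c N p g), Tg T L c t N g * Tot T L c t N p g = 0 := by
  have h1 : ∑ g ∈ Finset.univ.filter (fun g : Fin m → ι => Valid c N p g), Tg T L c t N g * Tot T L c t N p g =
     ∑ i, ∑ j ∈ Finset.univ.erase i, ∑ g ∈ Finset.univ.filter (fun g : Fin m → ι => Valid c N p g),
       Tg T L c t N g * T.Jf L N (len c N g i) (yv c t g i) (len c N g j) (yv c t g j) := by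
    have : ∀ g ∈ Finset.univ.filter (fun g : Fin m → ι => Valid c N p g), Tg T L c t N g * Tot T L c t N p g =
       ∑ i, ∑ j ∈ Finset.univ.erase i, Tg T L c t N g * T.Jf L N (len c N g i) (yv c t g i) (len c N g j) (yv c t g j) := by
      intro g hg
      rw [Tot_eq hG hc hN (Finset.mem_filter.1 hg).2]
      simp only [Finset.mul_sum]
    rw [Finset.sum_congr rfl this, Finset.sum_comm]
    refine Finset.sum_congr rfl fun i _ => ?_
    rw [Finset.sum_comm]
  set Q : ι → ι → ℂ := fun i j => ∑ g ∈ Finset.univ.filter (fun g : Fin m → ι => Valid c N p g),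
       Tg T L c t N g * T.Jf L N (len c N g i) (yv c t g i) (len c N g j) (yv c t g j) with hQ
  have h2 : ∀ i j, i ≠ j → Q i j + Q j i = 0 := by
    intro i j hij
    rw [← pair_sum (p := p) hG hc hN hij, hQ, ← Finset.sum_add_distrib]
    refine Finset.sum_congr rfl fun g _ => ?_
    rw [TH.Kf]; ring
  have h3 : ∑ i, ∑ j ∈ Finset.univ.erase i, Q i j = ∑ i, ∑ j ∈ Finset.univ.erase i, Q j i := by
    refine Finset.sum_comm' ?_
    intro x y
    simp [eq_comm]
  have h4 : ∑ i, ∑ j ∈ Finset.univ.erase i, Q i j + ∑ i, ∑ j ∈ Finset.univ.erase i, Q j i = 0 := by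
    simp only [← Finset.sum_add_distrib]
    refine Finset.sum_eq_zero fun i _ => Finset.sum_eq_zero fun j hj => h2 i j (Finset.ne_of_mem_erase hj).symm
  rw [h1]
  change ∑ i, ∑ j ∈ Finset.univ.erase i, Q i j = 0
  rw [← h3, ← two_mul] at h4
  simpa using h4
end
end

noncomputable section

section
variable {m : ℕ} (T : TH) (L : ℕ → ℂ) (c : Fin m → ℕ) (t : Fin m → ℂ)

lemma fop_add (j : ℕ) (P Q : MvPolynomial ℕ ℂ) : fop j (P + Q) = fop j P + fop j Q := by
  simp [fop, mul_add]
lemma fop_zero (j : ℕ) : fop j 0 = 0 := by simp [fop]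
lemma fop_smul (j : ℕ) (r : ℂ) (P : MvPolynomial ℕ ℂ) : fop j (r • P) = r • fop j P := by
  simp [fop]
lemma fop_mul (j : ℕ) (P Q : MvPolynomial ℕ ℂ) : fop j (P * Q) = fop j P * Q + P * fop j Q := by
  simp only [fop, Derivation.leibniz, smul_eq_mul]; ring
lemma fop_X (j a : ℕ) : fop j (MvPolynomial.X a) = if j = a then MvPolynomial.X (a + 1) else 0 := by
  rw [fop, MvPolynomial.pderiv_X]
  by_cases h : j = a
  · subst h; simp
  · rw [Pi.single_eq_of_ne (Ne.symm h)]; simp [h]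

/-- total weight of a set of Bethe variables -/
def Wt (S : Finset (Fin m)) : ℂ := ∑ k ∈ S, (L (c k) - L (c k + 1))

/-- The recursive form of the weight function. -/
def Vn : ℕ → Finset (Fin m) → ℂ → MvPolynomial ℕ ℂ → MvPolynomial ℕ ℂ
  | 0, _, _, P => P
  | n + 1, S, z, P => ∑ k ∈ S, T.sig (Wt L c S) (t k - z) • Vn n (S.erase k) (t k) (fop (c k) P)

def VV (S : Finset (Fin m)) (z : ℂ) (P : MvPolynomial ℕ ℂ) : MvPolynomial ℕ ℂ := Vn T L c t S.card S z P

lemma VV_empty (z : ℂ) (P : MvPolynomial ℕ ℂ) : VV T L c t ∅ z P = P := rfl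

lemma VV_rec {S : Finset (Fin m)} (hS : S.Nonempty) (z : ℂ) (P : MvPolynomial ℕ ℂ) :
    VV T L c t S z P = ∑ k ∈ S, T.sig (Wt L c S) (t k - z) • VV T L c t (S.erase k) (t k) (fop (c k) P) := by
  obtain ⟨n, hn⟩ : ∃ n, S.card = n + 1 := ⟨S.card - 1, by have := hS.card_pos; omega⟩
  rw [VV, hn, Vn]
  refine Finset.sum_congr rfl fun k hk => ?_
  rw [VV, Finset.card_erase_of_mem hk, hn]
  rfl

lemma Vn_add (n : ℕ) : ∀ (S : Finset (Fin m)) (z : ℂ) (P Q : MvPolynomial ℕ ℂ),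
    Vn T L c t n S z (P + Q) = Vn T L c t n S z P + Vn T L c t n S z Q := by
  induction n with
  | zero => intros; rfl
  | succ n ih =>
    intro S z P Q
    simp only [Vn, fop_add, ih, smul_add, Finset.sum_add_distrib]

lemma Vn_zero (n : ℕ) : ∀ (S : Finset (Fin m)) (z : ℂ), Vn T L c t n S z 0 = 0 := by
  induction n with
  | zero => intros; rfl
  | succ n ih =>
    intro S z
    simp only [Vn, fop_zero, ih, smul_zero, Finset.sum_const_zero]

lemma VV_add (S : Finset (Fin m)) (z : ℂ) (P Q : MvPolynomial ℕ ℂ) :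
    VV T L c t S z (P + Q) = VV T L c t S z P + VV T L c t S z Q := Vn_add T L c t _ S z P Q
lemma VV_zero (S : Finset (Fin m)) (z : ℂ) : VV T L c t S z 0 = 0 := Vn_zero T L c t _ S z

variable {T L c t}

/-- per-subset Fay expansion -/
lemma VV_fay (hW : ∀ S : Finset (Fin m), S.Nonempty → T.th (Wt L c S) ≠ 0)
    (ht : ∀ k l, k ≠ l → T.th (t k - t l) ≠ 0) {S A : Finset (Fin m)} (hS : S.Nonempty) (hA : A ⊆ S) {z : ℂ}
    (hz : ∀ k ∈ S, T.th (t k - z) ≠ 0) (P Q : MvPolynomial ℕ ℂ) :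
    VV T L c t A z P * VV T L c t (S \ A) z Q =
    ∑ k ∈ A, T.sig (Wt L c S) (t k - z) • (VV T L c t (A.erase k) (t k) (fop (c k) P) * VV T L c t (S \ A) (t k) Q) +
    ∑ l ∈ S \ A, T.sig (Wt L c S) (t l - z) • (VV T L c t A (t l) P * VV T L c t ((S \ A).erase l) (t l) (fop (c l) Q)) := by
  rcases A.eq_empty_or_nonempty with rfl | hAn
  · simp only [Finset.sdiff_empty, VV_empty, Finset.sum_empty, zero_add]
    rw [VV_rec T L c t hS, Finset.mul_sum]
    exact Finset.sum_congr rfl fun k _ => mul_smul_comm _ _ _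
  rcases (S \ A).eq_empty_or_nonempty with hB | hBn
  · have : S = A := Finset.Subset.antisymm (Finset.sdiff_eq_empty_iff_subset.1 hB) hA
    subst this
    rw [hB]
    simp only [VV_empty, Finset.sum_empty, add_zero]
    rw [VV_rec T L c t hS, Finset.sum_mul]
    exact Finset.sum_congr rfl fun k _ => smul_mul_assoc _ _ _
  set B := S \ A with hBdef
  have hWS : Wt L c S = Wt L c A + Wt L c B := by
    rw [Wt, Wt, Wt, add_comm, hBdef, Finset.sum_sdiff hA]
  have hdisj : ∀ k ∈ A, ∀ l ∈ B, k ≠ l := by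
    intro k hk l hl h
    subst h
    exact (Finset.mem_sdiff.1 hl).2 hk
  rw [VV_rec T L c t hAn z P, VV_rec T L c t hBn z Q, Finset.sum_mul_sum]
  have h1 : ∀ k ∈ A, T.sig (Wt L c S) (t k - z) • (VV T L c t (A.erase k) (t k) (fop (c k) P) * VV T L c t B (t k) Q) =
      ∑ l ∈ B, (T.sig (Wt L c S) (t k - z) * T.sig (Wt L c B) (t l - t k)) • (VV T L c t (A.erase k) (t k) (fop (c k) P) *
         VV T L c t (B.erase l) (t l) (fop (c l) Q)) := by
    intro k _
    rw [VV_rec T L c t hBn (t k) Q, Finset.mul_sum, Finset.smul_sum]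
    refine Finset.sum_congr rfl fun l _ => ?_
    rw [mul_smul_comm, smul_smul]
  have h2 : ∀ l ∈ B, T.sig (Wt L c S) (t l - z) • (VV T L c t A (t l) P * VV T L c t (B.erase l) (t l) (fop (c l) Q)) =
      ∑ k ∈ A, (T.sig (Wt L c S) (t l - z) * T.sig (Wt L c A) (t k - t l)) • (VV T L c t (A.erase k) (t k) (fop (c k) P) *
         VV T L c t (B.erase l) (t l) (fop (c l) Q)) := by
    intro l _
    rw [VV_rec T L c t hAn (t l) P, Finset.sum_mul, Finset.smul_sum]
    refine Finset.sum_congr rfl fun k _ => ?_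
    rw [smul_mul_assoc, smul_smul]
  rw [Finset.sum_congr rfl h1, Finset.sum_congr rfl h2, Finset.sum_comm (s := B), ← Finset.sum_add_distrib]
  refine Finset.sum_congr rfl fun k hk => ?_
  rw [← Finset.sum_add_distrib]
  refine Finset.sum_congr rfl fun l hl => ?_
  rw [smul_mul_smul_comm, ← add_smul]
  congr 1
  have hlS : l ∈ S := (Finset.mem_sdiff.1 hl).1
  have hx : t l - t k = (t l - z) - (t k - z) := by ring
  have hy : t k - t l = (t k - z) - (t l - z) := by ring
  rw [hWS, hx, hy]
  refine T.fay (hW A hAn) (hW B hBn) (hWS ▸ hW S hS) (hz k (hA hk)) (hz l hlS) ?_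
  rw [← hy]
  exact ht k l (hdisj k hk l hl)

lemma sum_powerset_swap {M : Type*} [AddCommMonoid M] (S : Finset (Fin m)) (h : Fin m → Finset (Fin m) → M) :
    ∑ A ∈ S.powerset, ∑ k ∈ A, h k (A.erase k) = ∑ k ∈ S, ∑ A ∈ (S.erase k).powerset, h k A := by
  rw [Finset.sum_sigma', Finset.sum_sigma']
  refine Finset.sum_bij' (fun x _ => ⟨x.2, x.1.erase x.2⟩) (fun x _ => ⟨insert x.1 x.2, x.1⟩) ?_ ?_ ?_ ?_ ?_
  · rintro ⟨A, k⟩ hx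
    simp only [Finset.mem_sigma, Finset.mem_powerset] at hx ⊢
    exact ⟨hx.1 hx.2, Finset.erase_subset_erase _ hx.1⟩
  · rintro ⟨k, A⟩ hx
    simp only [Finset.mem_sigma, Finset.mem_powerset] at hx ⊢
    exact ⟨Finset.insert_subset hx.1 (hx.2.trans (Finset.erase_subset _ _)), Finset.mem_insert_self _ _⟩
  · rintro ⟨A, k⟩ hx
    simp only [Finset.mem_sigma, Finset.mem_powerset] at hx
    simp [Finset.insert_erase hx.2]
  · rintro ⟨k, A⟩ hx
    simp only [Finset.mem_sigma, Finset.mem_powerset] at hx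
    have : k ∉ A := fun h => Finset.notMem_erase k S (hx.2 h)
    simp [Finset.erase_insert this]
  · rintro ⟨A, k⟩ hx
    rfl

lemma VV_mul (hW : ∀ S : Finset (Fin m), S.Nonempty → T.th (Wt L c S) ≠ 0)
    (ht : ∀ k l, k ≠ l → T.th (t k - t l) ≠ 0) (n : ℕ) : ∀ (S : Finset (Fin m)), S.card = n → ∀ (z : ℂ)
    (_ : ∀ k ∈ S, T.th (t k - z) ≠ 0) (P Q : MvPolynomial ℕ ℂ),
    VV T L c t S z (P * Q) = ∑ A ∈ S.powerset, VV T L c t A z P * VV T L c t (S \ A) z Q := by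
  induction n with
  | zero =>
    intro S hS z _ P Q
    rw [Finset.card_eq_zero] at hS
    subst hS
    simp [VV_empty]
  | succ n ih =>
    intro S hS z hz P Q
    have hSn : S.Nonempty := Finset.card_pos.1 (by omega)
    rw [Finset.sum_congr rfl (fun A hA => VV_fay hW ht hSn (Finset.mem_powerset.1 hA) hz P Q), Finset.sum_add_distrib]
    have e1 : ∑ A ∈ S.powerset, ∑ k ∈ A, T.sig (Wt L c S) (t k - z) •
        (VV T L c t (A.erase k) (t k) (fop (c k) P) * VV T L c t (S \ A) (t k) Q) =
        ∑ k ∈ S, ∑ A ∈ (S.erase k).powerset, T.sig (Wt L c S) (t k - z) •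
        (VV T L c t A (t k) (fop (c k) P) * VV T L c t (S.erase k \ A) (t k) Q) := by
      rw [← sum_powerset_swap]
      refine Finset.sum_congr rfl fun A _ => Finset.sum_congr rfl fun k hk => ?_
      have : S.erase k \ A.erase k = S \ A := by
        ext x; simp only [Finset.mem_sdiff, Finset.mem_erase]
        constructor
        · rintro ⟨⟨h1, h2⟩, h3⟩; exact ⟨h2, fun h => h3 ⟨h1, h⟩⟩
        · rintro ⟨h1, h2⟩; exact ⟨⟨fun h => h2 (h ▸ hk), h1⟩, fun h => h2 h.2⟩
      rw [this]
    have e2 : ∑ A ∈ S.powerset, ∑ l ∈ S \ A, T.sig (Wt L c S) (t l - z) •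
        (VV T L c t A (t l) P * VV T L c t ((S \ A).erase l) (t l) (fop (c l) Q)) =
        ∑ k ∈ S, ∑ A ∈ (S.erase k).powerset, T.sig (Wt L c S) (t k - z) •
        (VV T L c t A (t k) P * VV T L c t (S.erase k \ A) (t k) (fop (c k) Q)) := by
      refine (Finset.sum_comm' (s' := fun k => (S.erase k).powerset) (t' := S) ?_).trans ?_
      · intro A k
        simp only [Finset.mem_powerset, Finset.mem_sdiff]
        constructor
        · rintro ⟨h1, h2, h3⟩
          exact ⟨fun x hx => Finset.mem_erase.2 ⟨fun h => h3 (h ▸ hx), h1 hx⟩, h2⟩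
        · rintro ⟨h1, h2⟩
          exact ⟨h1.trans (Finset.erase_subset _ _), h2, fun h => Finset.notMem_erase k S (h1 h)⟩
      · refine Finset.sum_congr rfl fun k _ => Finset.sum_congr rfl fun A _ => ?_
        have : (S \ A).erase k = S.erase k \ A := by
          ext x; simp only [Finset.mem_sdiff, Finset.mem_erase]; tauto
        rw [this]
    rw [e1, e2, ← Finset.sum_add_distrib, VV_rec T L c t hSn]
    refine Finset.sum_congr rfl fun k hk => ?_
    have hc' : (S.erase k).card = n := by rw [Finset.card_erase_of_mem hk]; omega
    have hz' : ∀ l ∈ S.erase k, T.th (t l - t k) ≠ 0 := fun l hl => ht l k (Finset.ne_of_mem_erase hl)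
    rw [fop_mul, VV_add, ih _ hc' _ hz', ih _ hc' _ hz', smul_add, Finset.smul_sum, Finset.smul_sum]
end
end

noncomputable section

section
variable {m : ℕ} {T : TH} {L : ℕ → ℂ} {c : Fin m → ℕ} {t : Fin m → ℂ}

def Gset {ι : Type*} [DecidableEq ι] (S : Finset (Fin m)) (I : Finset ι) : Finset (Fin m → Option ι) :=
  Fintype.piFinset (fun k => if k ∈ S then I.image some else {none})

lemma mem_Gset {ι : Type*} [DecidableEq ι] {S : Finset (Fin m)} {I : Finset ι} {g : Fin m → Option ι} :
    g ∈ Gset S I ↔ ∀ k, (k ∈ S → ∃ i ∈ I, g k = some i) ∧ (k ∉ S → g k = none) := by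
  rw [Gset, Fintype.mem_piFinset]
  refine forall_congr' fun k => ?_
  by_cases h : k ∈ S
  · simp [h, eq_comm]
  · simp [h]

lemma VV_prod_aux {ι : Type*} [DecidableEq ι] (hW : ∀ S : Finset (Fin m), S.Nonempty → T.th (Wt L c S) ≠ 0)
    (ht : ∀ k l, k ≠ l → T.th (t k - t l) ≠ 0) (P : ι → MvPolynomial ℕ ℂ) (hP1 : ∀ S : Finset (Fin m), S.Nonempty → ∀ z, VV T L c t S z 1 = 0)
    (I : Finset ι) : ∀ (S : Finset (Fin m)) (z : ℂ)
    (_ : ∀ k ∈ S, T.th (t k - z) ≠ 0),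
    VV T L c t S z (∏ i ∈ I, P i) = ∑ g ∈ Gset S I, ∏ j ∈ I, VV T L c t (Finset.univ.filter fun k => g k = some j) z (P j) := by
  induction I using Finset.induction_on with
  | empty =>
    intro S z hz
    simp only [Finset.prod_empty]
    rcases S.eq_empty_or_nonempty with rfl | hS
    · rw [VV_empty]
      have : Gset (∅ : Finset (Fin m)) (∅ : Finset ι) = {fun _ => none} := by
        ext g
        rw [mem_Gset, Finset.mem_singleton, funext_iff]
        simp
      rw [this]; simp
    · rw [hP1 S hS]
      have : Gset S (∅ : Finset ι) = ∅ := by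
        ext g
        rw [mem_Gset]
        obtain ⟨k, hk⟩ := hS
        constructor
        · intro h
          obtain ⟨i, hi, _⟩ := (h k).1 hk
          simp at hi
        · simp
      rw [this]; simp
  | insert i I hi ih =>
    intro S z hz
    rw [Finset.prod_insert hi, VV_mul hW ht _ S rfl z hz]
    have : ∀ A ∈ S.powerset, VV T L c t A z (P i) * VV T L c t (S \ A) z (∏ i ∈ I, P i) =
        ∑ g ∈ Gset (S \ A) I, VV T L c t A z (P i) * ∏ j ∈ I, VV T L c t (Finset.univ.filter fun k => g k = some j) z (P j) := by
      intro A hA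
      rw [ih (S \ A) z (fun k hk => hz k (Finset.mem_sdiff.1 hk).1), Finset.mul_sum]
    rw [Finset.sum_congr rfl this, Finset.sum_sigma']
    refine Finset.sum_bij' (fun x _ => fun k => if k ∈ x.1 then some i else x.2 k)
      (fun g _ => ⟨Finset.univ.filter fun k => g k = some i, fun k => if g k = some i then none else g k⟩) ?_ ?_ ?_ ?_ ?_
    · rintro ⟨A, g⟩ hx
      simp only [Finset.mem_sigma, Finset.mem_powerset] at hx
      obtain ⟨hA, hg⟩ := hx
      rw [mem_Gset] at hg ⊢
      intro k
      by_cases hk : k ∈ A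
      · simp [hk, hA hk]
      · have := hg k
        simp only [hk, Finset.mem_sdiff, not_false_eq_true, and_true, if_false] at this ⊢
        refine ⟨fun h => ?_, this.2⟩
        obtain ⟨j, hj, h⟩ := this.1 h
        exact ⟨j, Finset.mem_insert_of_mem hj, h⟩
    · intro g hg
      rw [mem_Gset] at hg
      simp only [Finset.mem_sigma, Finset.mem_powerset]
      refine ⟨?_, ?_⟩
      · intro k hk
        by_contra h
        have := (hg k).2 h
        simp [this] at hk
      · rw [mem_Gset]
        intro k
        simp only [Finset.mem_sdiff, Finset.mem_filter, Finset.mem_univ, true_and]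
        constructor
        · rintro ⟨h1, h2⟩
          obtain ⟨j, hj, h⟩ := (hg k).1 h1
          refine ⟨j, ?_, by rw [if_neg h2, h]⟩
          rcases Finset.mem_insert.1 hj with rfl | hj
          · exact absurd h h2
          · exact hj
        · intro h
          by_cases h2 : g k = some i
          · simp [h2]
          · rw [if_neg h2]
            exact (hg k).2 fun h3 => h ⟨h3, h2⟩
    · rintro ⟨A, g⟩ hx
      simp only [Finset.mem_sigma, Finset.mem_powerset] at hx
      obtain ⟨hA, hg⟩ := hx
      rw [mem_Gset] at hg
      have hne : ∀ k, g k ≠ some i := by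
        intro k hk
        by_cases h : k ∈ S \ A
        · obtain ⟨j, hj, h⟩ := (hg k).1 h
          rw [h] at hk
          exact hi (Option.some.inj hk ▸ hj)
        · rw [(hg k).2 h] at hk; simp at hk
      have e1 : (Finset.univ.filter fun k => (if k ∈ A then some i else g k) = some i) = A := by
        ext k
        by_cases hk : k ∈ A <;> simp [hk, hne k]
      have e2 : (fun k => if (if k ∈ A then some i else g k) = some i then none else (if k ∈ A then some i else g k)) = g := by
        funext k
        by_cases hk : k ∈ A
        · simp only [hk, if_true]
          exact ((hg k).2 (by simp [hk])).symm
        · simp [hk, hne k]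
      simp only [e1, e2]
    · intro g hg
      funext k
      by_cases h : g k = some i <;> simp [h]
    · rintro ⟨A, g⟩ hx
      simp only [Finset.mem_sigma, Finset.mem_powerset] at hx
      obtain ⟨hA, hg⟩ := hx
      rw [mem_Gset] at hg
      have hne : ∀ k, g k ≠ some i := by
        intro k hk
        by_cases h : k ∈ S \ A
        · obtain ⟨j, hj, h⟩ := (hg k).1 h
          rw [h] at hk
          exact hi (Option.some.inj hk ▸ hj)
        · rw [(hg k).2 h] at hk; simp at hk
      rw [Finset.prod_insert hi]
      have e1 : (Finset.univ.filter fun k => (if k ∈ A then some i else g k) = some i) = A := by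
        ext k
        by_cases hk : k ∈ A <;> simp [hk, hne k]
      simp only [e1]
      congr 1
      refine Finset.prod_congr rfl fun j hj => ?_
      congr 1
      ext k
      by_cases hk : k ∈ A
      · have h1 := (hg k).2 (by simp [hk])
        have : i ≠ j := fun h => hi (h ▸ hj)
        simp [hk, h1, this]
      · simp [hk]

lemma fop_one (j : ℕ) : fop j 1 = 0 := by simp [fop]

lemma VV_one (S : Finset (Fin m)) (hS : S.Nonempty) (z : ℂ) : VV T L c t S z 1 = 0 := by
  rw [VV_rec T L c t hS]
  refine Finset.sum_eq_zero fun k _ => ?_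
  rw [fop_one, VV_zero, smul_zero]

lemma VV_prod {ι : Type*} [Fintype ι] [DecidableEq ι] (hW : ∀ S : Finset (Fin m), S.Nonempty → T.th (Wt L c S) ≠ 0)
    (ht : ∀ k l, k ≠ l → T.th (t k - t l) ≠ 0) (P : ι → MvPolynomial ℕ ℂ) (z : ℂ)
    (hz : ∀ k, T.th (t k - z) ≠ 0) :
    VV T L c t Finset.univ z (∏ i, P i) = ∑ g : Fin m → ι, ∏ j, VV T L c t (Finset.univ.filter fun k => g k = j) z (P j) := by
  rw [VV_prod_aux hW ht P VV_one Finset.univ _ z (fun k _ => hz k)]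
  symm
  refine Finset.sum_bij (fun g _ k => some (g k)) ?_ ?_ ?_ ?_
  · intro g _
    rw [mem_Gset]; simp
  · intro g _ g' _ h
    funext k
    exact Option.some.inj (congrFun h k)
  · intro g hg
    rw [mem_Gset] at hg
    have : ∀ k, ∃ i, g k = some i := fun k => by
      obtain ⟨i, _, h⟩ := (hg k).1 (Finset.mem_univ _)
      exact ⟨i, h⟩
    choose f hf using this
    exact ⟨f, Finset.mem_univ _, funext fun k => (hf k).symm⟩
  · intro g _
    simp

end
end

noncomputable section

section
variable {m : ℕ} {T : TH} {L : ℕ → ℂ} {c : Fin m → ℕ} {t : Fin m → ℂ}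

def scond (c : Fin m → ℕ) (A : Finset (Fin m)) (a : ℕ) : Prop :=
  ∀ b, (A.filter fun k => c k = b).card = if a ≤ b ∧ b < a + A.card then 1 else 0

def Yv (c : Fin m → ℕ) (t : Fin m → ℂ) (A : Finset (Fin m)) (z : ℂ) (a : ℕ) : ℕ → ℂ
  | 0 => z
  | b + 1 => ∑ k ∈ A.filter (fun k => c k = a + b), t k

lemma cond_erase {A : Finset (Fin m)} {k : Fin m} (hk : k ∈ A) :
    scond c (A.erase k) (c k + 1) ↔ scond c A (c k) := by
  refine forall_congr' fun b => ?_
  have hpos : 0 < A.card := Finset.card_pos.2 ⟨k, hk⟩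
  rw [Finset.filter_erase, Finset.card_erase_of_mem hk]
  by_cases hb : c k = b
  · have hm : k ∈ A.filter fun k => c k = b := by simp [hk, hb]
    have hp : 0 < (A.filter fun k => c k = b).card := Finset.card_pos.2 ⟨k, hm⟩
    rw [Finset.card_erase_of_mem hm, if_neg (by omega), if_pos (by omega)]
    omega
  · rw [Finset.erase_eq_of_notMem (by simp [hb])]
    have : (c k + 1 ≤ b ∧ b < c k + 1 + (A.card - 1)) ↔ (c k ≤ b ∧ b < c k + A.card) := by omega
    rw [if_congr this rfl rfl]

lemma Wt_cond {A : Finset (Fin m)} {a : ℕ} (h : scond c A a) : Wt L c A = L a - L (a + A.card) := by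
  have hmem : ∀ k ∈ A, c k ∈ Finset.Ico a (a + A.card) := by
    intro k hk
    by_contra hc
    rw [Finset.mem_Ico] at hc
    have := h (c k)
    rw [if_neg hc, Finset.card_eq_zero] at this
    have : k ∈ (∅ : Finset (Fin m)) := this ▸ (by simp [hk])
    simp at this
  rw [Wt, ← Finset.sum_fiberwise_of_maps_to hmem]
  have : ∀ b ∈ Finset.Ico a (a + A.card), ∑ k ∈ A.filter (fun k => c k = b), (L (c k) - L (c k + 1)) = L b - L (b + 1) := by
    intro b hb
    have h1 := h b
    rw [if_pos (Finset.mem_Ico.1 hb), Finset.card_eq_one] at h1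
    obtain ⟨k, hk⟩ := h1
    have : k ∈ A.filter (fun k => c k = b) := by rw [hk]; simp
    rw [hk, Finset.sum_singleton, (Finset.mem_filter.1 this).2]
  rw [Finset.sum_congr rfl this, Finset.sum_Ico_eq_sum_range]
  have := Finset.sum_range_sub' (fun b => L (a + b)) A.card
  simp only [add_zero] at this
  rw [← this]
  simp [add_assoc]

open Classical in
lemma VV_X (n : ℕ) : ∀ (A : Finset (Fin m)), A.card = n → ∀ (z : ℂ) (a : ℕ),
    VV T L c t A z (MvPolynomial.X a) = if scond c A a then
      (∏ b ∈ Finset.range n, T.sig (L (a + b) - L (a + n)) (Yv c t A z a (b + 1) - Yv c t A z a b)) • MvPolynomial.X (a + n) else 0 := by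
  induction n with
  | zero =>
    intro A hA z a
    rw [Finset.card_eq_zero] at hA
    subst hA
    have : scond c ∅ a := by intro b; simp
    simp [this, VV_empty]
  | succ n ih =>
    intro A hA z a
    have hAn : A.Nonempty := Finset.card_pos.1 (by omega)
    rw [VV_rec T L c t hAn]
    by_cases hc : scond c A a
    · rw [if_pos hc]
      have h1 := hc a
      rw [if_pos (by omega), Finset.card_eq_one] at h1
      obtain ⟨k, hk⟩ := h1
      have hkm : k ∈ A.filter (fun k => c k = a) := by rw [hk]; simp
      obtain ⟨hkA, hka⟩ := Finset.mem_filter.1 hkm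
      rw [Finset.sum_eq_single k]
      · rw [fop_X, if_pos hka, ih (A.erase k) (by rw [Finset.card_erase_of_mem hkA]; omega), if_pos (by
          rw [← hka]; rw [← hka] at hc; exact (cond_erase hkA).2 hc), smul_smul]
        have e1 : a + 1 + n = a + (n + 1) := by ring
        rw [e1, Finset.prod_range_succ', mul_comm]
        have hY : ∀ b, Yv c t (A.erase k) (t k) (a + 1) b = Yv c t A z a (b + 1) := by
          intro b
          cases b with
          | zero => simp [Yv, hk]
          | succ b =>
            simp only [Yv]
            rw [Finset.filter_erase, Finset.erase_eq_of_notMem (by simp [hka]; omega)]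
            refine Finset.sum_congr (Finset.filter_congr fun k _ => ?_) fun _ _ => rfl
            constructor <;> intro <;> omega
        have hY1 : Yv c t A z a (0 + 1) = t k := by simp [Yv, hk]
        congr 2
        · refine Finset.prod_congr rfl fun b _ => ?_
          rw [hY, hY]
          congr 3
          ring
        · rw [hY1, Wt_cond hc, hA]
          rfl
      · intro b hb hbk
        rw [fop_X, if_neg, VV_zero, smul_zero]
        intro h
        have : b ∈ A.filter (fun k => c k = a) := by simp [hb, h]
        rw [hk, Finset.mem_singleton] at this
        exact hbk this
      · intro h; exact absurd hkA h
    · rw [if_neg hc]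
      refine Finset.sum_eq_zero fun k hk => ?_
      rw [fop_X]
      split_ifs with h
      · rw [ih (A.erase k) (by rw [Finset.card_erase_of_mem hk]; omega), if_neg, smul_zero]
        intro h'
        subst h
        exact hc ((cond_erase hk).1 h')
      · rw [VV_zero, smul_zero]

lemma len_eq_card (N : ℕ) {ι : Type*} [Fintype ι] [DecidableEq ι] (hc : ∀ i, c i + 2 ≤ N) (g : Fin m → ι) (i : ι) :
    len c N g i = (Finset.univ.filter fun k => g k = i).card := by
  rw [len, Finset.card_eq_sum_card_fiberwise (f := c) (t := Finset.range N)]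
  · refine Finset.sum_congr rfl fun a _ => ?_
    rw [cnt, Finset.filter_filter]
  · intro k _
    have := hc k
    simp; omega

lemma prod_X_pow (N p : ℕ) : (∏ k ∈ Finset.range N, (MvPolynomial.X k : MvPolynomial ℕ ℂ)) ^ p =
    MvPolynomial.monomial (∑ k ∈ Finset.range N, Finsupp.single k p) 1 := by
  rw [MvPolynomial.monomial_sum_one, ← Finset.prod_pow]
  refine Finset.prod_congr rfl fun k _ => ?_
  rw [MvPolynomial.X_pow_eq_monomial]

open Classical in
lemma coeff_VV {N p : ℕ} (hN : 0 < N) (hc : ∀ i, c i + 2 ≤ N) (hW : ∀ S : Finset (Fin m), S.Nonempty → T.th (Wt L c S) ≠ 0)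
    (ht : ∀ k l, k ≠ l → T.th (t k - t l) ≠ 0) (ht0 : ∀ k, T.th (t k) ≠ 0) :
    MvPolynomial.coeff (∑ k ∈ Finset.range N, Finsupp.single k p) (VV T L c t Finset.univ 0 (MvPolynomial.X 0 ^ (N * p))) =
    ∑ g ∈ Finset.univ.filter (fun g : Fin m → Fin (N * p) => Valid c N p g), Tg T L c t N g := by
  have h0 : (MvPolynomial.X 0 ^ (N * p) : MvPolynomial ℕ ℂ) = ∏ i : Fin (N * p), MvPolynomial.X 0 := by simp
  rw [h0, VV_prod hW ht _ 0 (by simpa using ht0), MvPolynomial.coeff_sum, Finset.sum_filter]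
  refine Finset.sum_congr rfl fun g _ => ?_
  have hs : ∀ j, scond c (Finset.univ.filter fun k => g k = j) 0 ↔ ∀ a, cnt c g j a = if a < len c N g j then 1 else 0 := by
    intro j
    refine forall_congr' fun a => ?_
    rw [len_eq_card N hc, cnt, Finset.filter_filter]
    simp
  have hV : ∀ j, VV T L c t (Finset.univ.filter fun k => g k = j) 0 (MvPolynomial.X 0) =
      if ∀ a, cnt c g j a = if a < len c N g j then 1 else 0 then T.tg L (len c N g j) (yv c t g j) • MvPolynomial.X (len c N g j) else 0 := by
    intro j
    rw [VV_X _ _ rfl, if_congr (hs j) rfl rfl, ← len_eq_card N hc]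
    have hy : ∀ b, Yv c t (Finset.univ.filter fun k => g k = j) 0 0 b = yv c t g j b := by
      intro b
      cases b with
      | zero => rfl
      | succ b => simp [Yv, yv, Finset.filter_filter]
    simp only [hy, zero_add, TH.tg]
  by_cases hA : ∀ j a, cnt c g j a = if a < len c N g j then 1 else 0
  · rw [Finset.prod_congr rfl fun j _ => (hV j).trans (if_pos (hA j))]
    have e1 : ∏ j, T.tg L (len c N g j) (yv c t g j) • (MvPolynomial.X (len c N g j) : MvPolynomial ℕ ℂ) =
        Tg T L c t N g • MvPolynomial.monomial (∑ j, Finsupp.single (len c N g j) 1) 1 := by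
      rw [MvPolynomial.monomial_sum_one, Tg, Finset.prod_smul]
      rfl
    rw [e1, MvPolynomial.coeff_smul, MvPolynomial.coeff_monomial]
    have e2 : (∑ j, Finsupp.single (len c N g j) 1 = ∑ k ∈ Finset.range N, Finsupp.single k p) ↔ Valid c N p g := by
      have l1 : ∀ r, (∑ j, Finsupp.single (len c N g j) 1 : ℕ →₀ ℕ) r = (Finset.univ.filter fun i => len c N g i = r).card := by
        intro r
        rw [Finsupp.finsetSum_apply, Finset.card_filter]
        exact Finset.sum_congr rfl fun j _ => Finsupp.single_apply
      have l2 : ∀ r, (∑ k ∈ Finset.range N, Finsupp.single k p : ℕ →₀ ℕ) r = if r < N then p else 0 := by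
        intro r
        rw [Finsupp.finsetSum_apply]
        simp [Finsupp.single_apply]
      rw [Finsupp.ext_iff]
      simp only [l1, l2]
      constructor
      · intro h
        refine ⟨hA, fun r hr => ?_⟩
        rw [h r, if_pos hr]
      · intro hg r
        split_ifs with h
        · exact hg.2 r h
        · rw [Finset.card_eq_zero, Finset.filter_eq_empty_iff]
          intro i _ hi
          have := len_lt hg hc hN i
          omega
    rw [if_congr e2 rfl rfl]
    split_ifs <;> simp
  · rw [if_neg (fun h => hA h.1)]
    push Not at hA
    obtain ⟨j, hj⟩ := hA
    rw [Finset.prod_eq_zero (Finset.mem_univ j), MvPolynomial.coeff_zero]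
    rw [hV, if_neg]
    intro h
    obtain ⟨a, ha⟩ := hj
    exact ha (h a)
end
end

noncomputable section

section
variable {m : ℕ} (T : TH) (L : ℕ → ℂ) (c : Fin m → ℕ) (t : Fin m → ℂ)

def chain (n : ℕ) (s : Fin n → Fin m) (z : ℂ) : ℂ :=
  ∏ j : Fin n, T.sig (∑ i ∈ Finset.univ.filter (fun i : Fin n => i ≤ j), (L (c (s i)) - L (c (s i) + 1)))
    (t (s j) - if h : (j : ℕ) + 1 < n then t (s ⟨(j : ℕ) + 1, h⟩) else z)

def fch (n : ℕ) (s : Fin n → Fin m) (P : MvPolynomial ℕ ℂ) : MvPolynomial ℕ ℂ :=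
  (List.finRange n).foldr (fun i P => fop (c (s i)) P) P

lemma chain_snoc (n : ℕ) (s : Fin n → Fin m) (k : Fin m) (z : ℂ) :
    chain T L c t (n + 1) (Fin.snoc s k : Fin (n+1) → Fin m) z = chain T L c t n s (t k) *
      T.sig (∑ i, (L (c (s i)) - L (c (s i) + 1)) + (L (c k) - L (c k + 1))) (t k - z) := by
  rw [chain, Fin.prod_univ_castSucc, chain]
  congr 1
  · refine Finset.prod_congr rfl fun j _ => ?_
    congr 1
    · rw [Finset.sum_filter, Fin.sum_univ_castSucc, Finset.sum_filter]
      simp [Fin.snoc_castSucc]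
    · rw [Fin.snoc_castSucc]
      congr 1
      have hj := j.2
      rw [dif_pos (by simp)]
      by_cases h : (j : ℕ) + 1 < n
      · rw [dif_pos h]
        have : (⟨((Fin.castSucc j : Fin (n+1)) : ℕ) + 1, by simp⟩ : Fin (n+1)) = Fin.castSucc ⟨(j:ℕ)+1, h⟩ := by
          ext; simp
        rw [this, Fin.snoc_castSucc]
      · rw [dif_neg h]
        have : (⟨((Fin.castSucc j : Fin (n+1)) : ℕ) + 1, by simp⟩ : Fin (n+1)) = Fin.last n := by
          ext; simp; omega
        rw [this, Fin.snoc_last]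
  · rw [Fin.snoc_last, dif_neg (by simp)]
    congr 1
    rw [Finset.filter_true_of_mem (fun i _ => Fin.le_last i), Fin.sum_univ_castSucc]
    simp

lemma fch_snoc (n : ℕ) (s : Fin n → Fin m) (k : Fin m) (P : MvPolynomial ℕ ℂ) :
    fch c (n + 1) (Fin.snoc s k : Fin (n+1) → Fin m) P = fch c n s (fop (c k) P) := by
  rw [fch, List.finRange_succ_last, List.foldr_append, List.foldr_map]
  simp [fch]

lemma Vn_chain (n : ℕ) : ∀ (S : Finset (Fin m)), S.card = n → ∀ (z : ℂ) (P : MvPolynomial ℕ ℂ),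
    Vn T L c t n S z P = ∑ s ∈ Finset.univ.filter (fun s : Fin n → Fin m => Finset.univ.image s = S),
      chain T L c t n s z • fch c n s P := by
  induction n with
  | zero =>
    intro S hS z P
    rw [Finset.card_eq_zero] at hS
    subst hS
    rw [Finset.filter_true_of_mem (by intro s _; simp)]
    simp [Vn, chain, fch]
  | succ n ih =>
    intro S hS z P
    rw [Vn]
    have : ∀ k ∈ S, T.sig (Wt L c S) (t k - z) • Vn T L c t n (S.erase k) (t k) (fop (c k) P) =
        ∑ s ∈ Finset.univ.filter (fun s : Fin n → Fin m => Finset.univ.image s = S.erase k),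
          chain T L c t (n + 1) (Fin.snoc s k : Fin (n+1) → Fin m) z • fch c (n + 1) (Fin.snoc s k : Fin (n+1) → Fin m) P := by
      intro k hk
      have hcard : (S.erase k).card = n := by rw [Finset.card_erase_of_mem hk]; omega
      rw [ih _ hcard, Finset.smul_sum]
      refine Finset.sum_congr rfl fun s hs => ?_
      have hs' := (Finset.mem_filter.1 hs).2
      have hinj : Function.Injective s := by
        rw [← Set.injOn_univ, ← Finset.coe_univ]
        apply Finset.injOn_of_card_image_eq
        rw [hs', hcard]; simp
      rw [smul_smul, chain_snoc, fch_snoc, mul_comm]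
      congr 3
      rw [Wt, ← Finset.sum_erase_add _ _ hk, ← hs', Finset.sum_image (fun x _ y _ h => hinj h)]
    rw [Finset.sum_congr rfl this, Finset.sum_sigma']
    refine Finset.sum_bij' (fun x _ => (Fin.snoc x.2 x.1 : Fin (n+1) → Fin m)) (fun s _ => ⟨s (Fin.last n), fun i => s (Fin.castSucc i)⟩) ?_ ?_ ?_ ?_ ?_
    · rintro ⟨k, s⟩ hx
      simp only [Finset.mem_sigma, Finset.mem_filter, Finset.mem_univ, true_and] at hx ⊢
      rw [← Finset.insert_erase hx.1, ← hx.2]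
      ext x
      simp only [Finset.mem_image, Finset.mem_univ, true_and, Finset.mem_insert, Fin.exists_fin_succ']
      simp [or_comm, eq_comm]
    · intro s hs
      simp only [Finset.mem_sigma, Finset.mem_filter, Finset.mem_univ, true_and] at hs ⊢
      have hinj : Function.Injective s := by
        rw [← Set.injOn_univ, ← Finset.coe_univ]
        apply Finset.injOn_of_card_image_eq
        rw [hs, hS]; simp
      refine ⟨hs ▸ Finset.mem_image_of_mem _ (Finset.mem_univ _), ?_⟩
      rw [← hs]
      ext x
      simp only [Finset.mem_image, Finset.mem_univ, true_and, Finset.mem_erase, Fin.exists_fin_succ']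
      constructor
      · rintro ⟨a, rfl⟩
        refine ⟨fun h => ?_, Or.inl ⟨a, rfl⟩⟩
        exact absurd (hinj h) (Fin.castSucc_lt_last a).ne
      · rintro ⟨h1, ⟨a, h⟩ | h⟩
        · exact ⟨a, h⟩
        · exact absurd h.symm h1
    · rintro ⟨k, s⟩ hx
      simp
    · intro s hs
      funext i
      refine Fin.lastCases ?_ (fun i => ?_) i <;> simp
    · rintro ⟨k, s⟩ hx
      rfl

lemma VV_perm (z : ℂ) (P : MvPolynomial ℕ ℂ) :
    VV T L c t Finset.univ z P = ∑ s : Equiv.Perm (Fin m), chain T L c t m s z • fch c m s P := by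
  have h : (Finset.univ : Finset (Fin m)).card = m := by simp
  have : VV T L c t Finset.univ z P = Vn T L c t m Finset.univ z P := by rw [VV, h]
  rw [this, Vn_chain T L c t m _ h]
  symm
  refine Finset.sum_bij (fun s _ => (s : Fin m → Fin m)) ?_ ?_ ?_ ?_
  · intro s _
    simp only [Finset.mem_filter, Finset.mem_univ, true_and]
    exact Finset.image_univ_of_surjective s.surjective
  · intro s _ s' _ h
    exact DFunLike.coe_injective h
  · intro s hs
    simp only [Finset.mem_filter, Finset.mem_univ, true_and] at hs
    have : Function.Surjective s := fun x => by
      have : x ∈ Finset.univ.image s := by rw [hs]; exact Finset.mem_univ x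
      simpa using this
    exact ⟨Equiv.ofBijective s (Finite.surjective_iff_bijective.1 this), Finset.mem_univ _, rfl⟩
  · intro s _; rfl

open Classical in
/-- The symmetrisation identity -/
lemma psi_sum {N p : ℕ} (hN : 0 < N) (hc : ∀ i, c i + 2 ≤ N) (hW : ∀ S : Finset (Fin m), S.Nonempty → T.th (Wt L c S) ≠ 0)
    (ht : ∀ k l, k ≠ l → T.th (t k - t l) ≠ 0) (ht0 : ∀ k, T.th (t k) ≠ 0) (l : Equiv.Perm (Fin m) → ℕ)
    (hl : ∀ s : Equiv.Perm (Fin m),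
      bethePoly N p m c s = l s • (∏ k ∈ Finset.range N, MvPolynomial.X k) ^ p) :
    ∑ s : Equiv.Perm (Fin m), (l s : ℂ) * chain T L c t m s 0 =
    ∑ g ∈ Finset.univ.filter (fun g : Fin m → Fin (N * p) => Valid c N p g), Tg T L c t N g := by
  rw [← coeff_VV hN hc hW ht ht0, VV_perm, MvPolynomial.coeff_sum]
  refine Finset.sum_congr rfl fun s _ => ?_
  have : fch c m s (MvPolynomial.X 0 ^ (N * p)) = bethePoly N p m c s := rfl
  rw [this, hl, prod_X_pow, MvPolynomial.coeff_smul, MvPolynomial.coeff_smul, MvPolynomial.coeff_monomial]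
  simp [mul_comm]

end
end

noncomputable section

section
variable {m : ℕ} {ι : Type*} [Fintype ι] [DecidableEq ι] {T : TH} {L : ℕ → ℂ} {c : Fin m → ℕ} {t : Fin m → ℂ} {N p : ℕ}

lemma sum_color {g : Fin m → ι} (hg : Valid c N p g) (h : ℂ → ℂ) (a : ℕ) :
    ∑ k ∈ Finset.univ.filter (fun k => c k = a), h (t k) =
    ∑ j, if a + 1 ≤ len c N g j then h (yv c t g j (a + 1)) else 0 := by
  rw [← Finset.sum_fiberwise (g := g)]
  refine Finset.sum_congr rfl fun j _ => ?_
  rw [Finset.filter_filter]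
  have hE : (Finset.univ.filter fun k => c k = a ∧ g k = j) = Finset.univ.filter fun k => g k = j ∧ c k = a := by
    ext; simp [and_comm]
  rw [hE]
  have h1 := hg.1 j a
  rw [cnt] at h1
  split_ifs with h2
  · rw [if_pos (by omega), Finset.card_eq_one] at h1
    obtain ⟨k, hk⟩ := h1
    simp only [yv]
    rw [hk]; simp
  · rw [if_neg (by omega), Finset.card_eq_zero] at h1
    rw [h1]; simp

lemma sum_all {g : Fin m → ι} (hg : Valid c N p g) (hc : ∀ i, c i + 2 ≤ N) (hN : 0 < N) (h : ℕ → ℂ → ℂ) :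
    ∑ k, h (c k) (t k) = ∑ j, ∑ a ∈ Finset.range (len c N g j), h a (yv c t g j (a + 1)) := by
  rw [← Finset.sum_fiberwise_of_maps_to (s := Finset.univ) (t := Finset.range N) (g := c)
    (fun k _ => by have := hc k; simp; omega)]
  have : ∀ a ∈ Finset.range N, ∑ k ∈ Finset.univ.filter (fun k => c k = a), h (c k) (t k) =
      ∑ j, if a + 1 ≤ len c N g j then h a (yv c t g j (a + 1)) else 0 := by
    intro a _
    rw [← sum_color hg (h a) a]
    refine Finset.sum_congr rfl fun k hk => ?_
    rw [(Finset.mem_filter.1 hk).2]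
  rw [Finset.sum_congr rfl this, Finset.sum_comm]
  refine Finset.sum_congr rfl fun j _ => ?_
  exact sum_ite_range N _ (len_lt hg hc hN j).le _

lemma xi_sum (r : ℕ) (hr : r < N) (u : ℕ → ℂ) (ξ : ℕ → ℂ) :
    ∑ n ∈ Finset.range N, ξ n * T.Dn L r u n = ∑ a ∈ Finset.range r, T.Sf L r u (a + 1) * (ξ a - ξ (a + 1)) := by
  have h1 : ∑ n ∈ Finset.range N, ξ n * T.Dn L r u n = ∑ n ∈ Finset.range r, ξ n * T.fi L r u n - ξ r * T.Sf L r u r := by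
    simp only [TH.Dn, mul_sub, Finset.sum_sub_distrib, mul_ite, mul_zero]
    congr 1
    · exact sum_ite_range N r hr.le _
    · simp [hr]
  rw [h1]
  have : ∀ k, ∑ n ∈ Finset.range k, ξ n * T.fi L r u n - ξ k * T.Sf L r u k = ∑ a ∈ Finset.range k, T.Sf L r u (a + 1) * (ξ a - ξ (a + 1)) := by
    intro k
    induction k with
    | zero => simp [TH.Sf_zero]
    | succ k ih =>
      rw [Finset.sum_range_succ, Finset.sum_range_succ, ← ih, TH.Sf_succ]
      ring
  exact this r

lemma bethe_str {g : Fin m → ι} (hg : Valid c N p g) (hcard : Fintype.card ι = N * p) {X : ℕ → ℂ}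
    (hB : ∀ j : Fin m,
      (∑ i ∈ Finset.univ.filter (fun i : Fin m => c i = c j + 1 ∨ c j = c i + 1), T.rho (t j - t i))
        - 2 * ∑ i ∈ Finset.univ.filter (fun i : Fin m => i ≠ j ∧ c i = c j), T.rho (t j - t i)
        + (N * p : ℕ) * (if c j = 0 then (1 : ℂ) else 0) * T.rho (t j) = X (c j))
    {i : ι} {a : ℕ} (ha : a < len c N g i) :
    ∑ j, T.Bp (len c N g j) (yv c t g j) (yv c t g i (a + 1)) a = X a := by
  obtain ⟨k, hk1, hk2, hk3⟩ := yv_succ (t := t) hg ha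
  rw [hk3, ← hk2, ← hB k, hk2]
  simp only [TH.Bp, Finset.sum_add_distrib, Finset.sum_sub_distrib, ← Finset.mul_sum]
  have e3 : ∑ i ∈ Finset.univ.filter (fun i : Fin m => i ≠ k ∧ c i = a), T.rho (t k - t i) =
      ∑ j, if a + 1 ≤ len c N g j then T.rho (t k - yv c t g j (a + 1)) else 0 := by
    rw [← sum_color hg (fun x => T.rho (t k - x)) a]
    have : k ∈ Finset.univ.filter (fun i => c i = a) := by simp [hk2]
    rw [← Finset.add_sum_erase _ _ this, sub_self, T.rho_zero, zero_add]
    refine Finset.sum_congr ?_ fun _ _ => rfl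
    ext i; simp
  have e2 : ∑ i ∈ Finset.univ.filter (fun i : Fin m => c i = a + 1), T.rho (t k - t i) =
      ∑ j, if a + 2 ≤ len c N g j then T.rho (t k - yv c t g j (a + 2)) else 0 :=
    sum_color hg (fun x => T.rho (t k - x)) (a + 1)
  have e0 : ∑ i ∈ Finset.univ.filter (fun i : Fin m => c i = a + 1 ∨ a = c i + 1), T.rho (t k - t i) =
      ∑ i ∈ Finset.univ.filter (fun i : Fin m => c i = a + 1), T.rho (t k - t i) +
      ∑ i ∈ Finset.univ.filter (fun i : Fin m => a = c i + 1), T.rho (t k - t i) := by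
    rw [Finset.filter_or, Finset.sum_union]
    rw [Finset.disjoint_filter]
    intro x _ h1 h2; omega
  have e1 : ∑ i ∈ Finset.univ.filter (fun i : Fin m => a = c i + 1), T.rho (t k - t i) +
      (N * p : ℕ) * (if a = 0 then (1 : ℂ) else 0) * T.rho (t k) =
      ∑ j, if a ≤ len c N g j then T.rho (t k - yv c t g j a) else 0 := by
    cases a with
    | zero => simp [yv, hcard]
    | succ b =>
      rw [← sum_color hg (fun x => T.rho (t k - x)) b]
      simp [eq_comm]
  rw [e0, e3, ← e2, ← e1]
  ring

lemma eta_str (hG : Gen T L t N) {g : Fin m → ι} (hg : Valid c N p g) (hc : ∀ i, c i + 2 ≤ N) (hN : 0 < N) (hcard : Fintype.card ι = N * p) :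
    ∑ i, (∑ j ∈ Finset.univ.erase i, T.etaJ (len c N g i) (yv c t g i) (len c N g j) (yv c t g j)
      + ∑ a ∈ Finset.range (len c N g i), T.eta (yv c t g i (a + 1) - yv c t g i a)) =
    - ((∑ i : Fin m, ∑ j ∈ Finset.univ.filter (fun j : Fin m => i < j),
              (2 * (if c i = c j then (1 : ℂ) else 0)
                - (if c i = c j + 1 ∨ c j = c i + 1 then (1 : ℂ) else 0)) * T.eta (t i - t j))
            - (N * p : ℕ) * ∑ i ∈ Finset.univ.filter (fun i : Fin m => c i = 0), T.eta (t i)) := by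
  set e : ℂ → ℂ := fun x => if x = 0 then 0 else T.eta x with he
  have ene : ∀ x, T.th x ≠ 0 → e x = T.eta x := by
    intro x hx
    simp only [he]
    rw [if_neg]
    rintro rfl
    exact hx T.th_zero
  have e0 : e 0 = 0 := by simp [he]
  have et : ∀ k l, k ≠ l → e (t k - t l) = T.eta (t k - t l) := fun k l h => ene _ (hG.h2 k l h).1
  -- second part
  have p2 : ∀ i, ∑ j ∈ Finset.univ.erase i, ∑ a ∈ Finset.range (len c N g i),
      (if a + 1 ≤ len c N g j then T.eta (yv c t g i (a + 1) - yv c t g j (a + 1)) else 0) =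
      ∑ a ∈ Finset.range (len c N g i), ∑ k' ∈ Finset.univ.filter (fun k => c k = a), e (yv c t g i (a + 1) - t k') := by
    intro i
    rw [Finset.sum_comm]
    refine Finset.sum_congr rfl fun a ha => ?_
    rw [sum_color hg (fun x => e (yv c t g i (a + 1) - x)) a, ← Finset.add_sum_erase _ _ (Finset.mem_univ i), sub_self, e0]
    simp only [ite_self, zero_add]
    refine Finset.sum_congr rfl fun j hj => ?_
    split_ifs with h
    · obtain ⟨k, hk1, hk2, hk3⟩ := yv_succ (t := t) hg (Finset.mem_range.1 ha)
      obtain ⟨k', hk1', hk2', hk3'⟩ := yv_succ (t := t) hg h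
      rw [hk3, hk3', et]
      rintro rfl
      exact (Finset.ne_of_mem_erase hj) (hk1'.symm.trans hk1)
    · rfl
  have p1 : ∀ i, ∑ j ∈ Finset.univ.erase i, ∑ a ∈ Finset.range (len c N g i),
      (if a ≤ len c N g j then T.eta (yv c t g i (a + 1) - yv c t g j a) else 0) + ∑ a ∈ Finset.range (len c N g i), T.eta (yv c t g i (a + 1) - yv c t g i a)
      = ∑ a ∈ Finset.range (len c N g i), (∑ k' ∈ Finset.univ.filter (fun k => a = c k + 1), e (yv c t g i (a + 1) - t k') +
        (N * p : ℕ) * (if a = 0 then (1 : ℂ) else 0) * T.eta (yv c t g i (a + 1))) := by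
    intro i
    have : ∑ a ∈ Finset.range (len c N g i), T.eta (yv c t g i (a + 1) - yv c t g i a) =
      ∑ a ∈ Finset.range (len c N g i), (if a ≤ len c N g i then T.eta (yv c t g i (a + 1) - yv c t g i a) else 0) := by
      refine Finset.sum_congr rfl fun a ha => ?_
      rw [if_pos (Finset.mem_range.1 ha).le]
    rw [this, Finset.sum_erase_add _ _ (Finset.mem_univ i), Finset.sum_comm]
    refine Finset.sum_congr rfl fun a ha => ?_
    cases a with
    | zero => simp [yv, hcard]
    | succ b =>
      have : (Finset.univ.filter fun k => b + 1 = c k + 1) = Finset.univ.filter fun k => c k = b := by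
        ext k; simp [eq_comm]
      rw [this, sum_color hg (fun x => e (yv c t g i (b + 1 + 1) - x)) b]
      simp only [Nat.add_eq_zero_iff, one_ne_zero, and_false, if_false, mul_zero, zero_mul, add_zero]
      refine Finset.sum_congr rfl fun j hj => ?_
      split_ifs with h
      · obtain ⟨k, hk1, hk2, hk3⟩ := yv_succ (t := t) hg (Finset.mem_range.1 ha)
        obtain ⟨k', hk1', hk2', hk3'⟩ := yv_succ (t := t) hg h
        rw [hk3, hk3', et]
        rintro rfl
        omega
      · rfl
  have lhs : ∑ i, (∑ j ∈ Finset.univ.erase i, T.etaJ (len c N g i) (yv c t g i) (len c N g j) (yv c t g j)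
      + ∑ a ∈ Finset.range (len c N g i), T.eta (yv c t g i (a + 1) - yv c t g i a)) =
      ∑ k, (∑ k' ∈ Finset.univ.filter (fun k' => c k = c k' + 1), e (t k - t k') + (N * p : ℕ) * (if c k = 0 then (1 : ℂ) else 0) * T.eta (t k)
        - ∑ k' ∈ Finset.univ.filter (fun k' => c k' = c k), e (t k - t k')) := by
    rw [sum_all hg hc hN (fun a x => (∑ k' ∈ Finset.univ.filter (fun k' => a = c k' + 1), e (x - t k') + (N * p : ℕ) * (if a = 0 then (1 : ℂ) else 0) * T.eta x
        - ∑ k' ∈ Finset.univ.filter (fun k' => c k' = a), e (x - t k')))]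
    refine Finset.sum_congr rfl fun i _ => ?_
    rw [Finset.sum_sub_distrib, ← p2, ← p1]
    simp only [TH.etaJ, Finset.sum_sub_distrib]
    ring
  rw [lhs]
  -- ordered pairs
  have ord : ∀ F : Fin m → Fin m → ℂ, (∀ i, F i i = 0) → ∑ i, ∑ j, F i j =
      ∑ i, ∑ j ∈ Finset.univ.filter (fun j => i < j), (F i j + F j i) := by
    intro F hF
    have h1 : ∀ i, ∑ j, F i j = ∑ j ∈ Finset.univ.filter (fun j => i < j), F i j + ∑ j ∈ Finset.univ.filter (fun j => j < i), F i j := by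
      intro i
      rw [Finset.sum_filter, Finset.sum_filter, ← Finset.sum_add_distrib]
      refine Finset.sum_congr rfl fun j _ => ?_
      rcases lt_trichotomy i j with h | h | h
      · simp [h, h.not_gt]
      · subst h; simp [hF]
      · simp [h, h.not_gt]
    rw [Finset.sum_congr rfl fun i _ => h1 i, Finset.sum_add_distrib]
    have h2 : ∑ i, ∑ j ∈ Finset.univ.filter (fun j => j < i), F i j = ∑ i, ∑ j ∈ Finset.univ.filter (fun j => i < j), F j i := by
      simp only [Finset.sum_filter]
      rw [Finset.sum_comm]
    rw [h2, ← Finset.sum_add_distrib]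
    exact Finset.sum_congr rfl fun i _ => Finset.sum_add_distrib.symm
  have hF := ord (fun k k' => (if c k = c k' + 1 then e (t k - t k') else 0) - (if c k' = c k then e (t k - t k') else 0))
    (by intro i; simp [e0])
  have r1 : ∑ k, (∑ k' ∈ Finset.univ.filter (fun k' => c k = c k' + 1), e (t k - t k') + (N * p : ℕ) * (if c k = 0 then (1 : ℂ) else 0) * T.eta (t k)
        - ∑ k' ∈ Finset.univ.filter (fun k' => c k' = c k), e (t k - t k')) =
      ∑ k, ∑ k', ((if c k = c k' + 1 then e (t k - t k') else 0) - (if c k' = c k then e (t k - t k') else 0)) +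
      (N * p : ℕ) * ∑ i ∈ Finset.univ.filter (fun i : Fin m => c i = 0), T.eta (t i) := by
    rw [Finset.sum_filter, Finset.mul_sum, ← Finset.sum_add_distrib]
    refine Finset.sum_congr rfl fun k _ => ?_
    rw [Finset.sum_sub_distrib, Finset.sum_filter, Finset.sum_filter]
    split_ifs <;> ring
  rw [r1, hF, neg_sub, sub_eq_neg_add, ← Finset.sum_neg_distrib]
  congr 1
  refine Finset.sum_congr rfl fun i _ => ?_
  rw [← Finset.sum_neg_distrib]
  refine Finset.sum_congr rfl fun j hj => ?_
  have hij := (Finset.mem_filter.1 hj).2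
  rw [et i j hij.ne, et j i hij.ne', T.eta_sub (t j)]
  by_cases h1 : c i = c j
  · simp [h1]; ring
  · by_cases h2 : c i = c j + 1
    · have h3 : ¬ c j = c i := fun h => h1 h.symm
      have h4 : ¬ c j = c i + 1 := by omega
      simp [h1, h2]; try omega
    · have h3 : ¬ c j = c i := fun h => h1 h.symm
      by_cases h4 : c j = c i + 1 <;> simp [h1, h2, h3, h4] <;> (intro h; omega)

open Classical in
/-- The algebraic eigenvalue identity at generic points. -/
lemma eig_sum (hG : Gen T L t N) (hc : ∀ i, c i + 2 ≤ N) (hN : 0 < N) (hcard : Fintype.card ι = N * p) (ξ : ℕ → ℂ) (q : ℂ)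
    (hB : ∀ j : Fin m,
      (∑ i ∈ Finset.univ.filter (fun i : Fin m => c i = c j + 1 ∨ c j = c i + 1), T.rho (t j - t i))
        - 2 * ∑ i ∈ Finset.univ.filter (fun i : Fin m => i ≠ j ∧ c i = c j), T.rho (t j - t i)
        + (N * p : ℕ) * (if c j = 0 then (1 : ℂ) else 0) * T.rho (t j) = q * (ξ (c j) - ξ (c j + 1))) :
    ∑ g ∈ Finset.univ.filter (fun g : Fin m → ι => Valid c N p g), Tg T L c t N g *
      (∑ n ∈ Finset.range N, (q * ξ n + ∑ i, T.Dn L (len c N g i) (yv c t g i) n) ^ 2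
        + 2 * ∑ i, ∑ a ∈ Finset.range (len c N g i), T.fi' L (len c N g i) (yv c t g i) a) =
    (q ^ 2 * ∑ n ∈ Finset.range N, ξ n ^ 2 - 2 * p * (p + 1) * ∑ b ∈ Finset.range N, ∑ a ∈ Finset.range b, T.rho' (L a - L b)
     + ((∑ i : Fin m, ∑ j ∈ Finset.univ.filter (fun j : Fin m => i < j),
              (2 * (if c i = c j then (1 : ℂ) else 0)
                - (if c i = c j + 1 ∨ c j = c i + 1 then (1 : ℂ) else 0)) * T.eta (t i - t j))
            - (N * p : ℕ) * ∑ i ∈ Finset.univ.filter (fun i : Fin m => c i = 0), T.eta (t i))) *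
     ∑ g ∈ Finset.univ.filter (fun g : Fin m → ι => Valid c N p g), Tg T L c t N g := by
  rw [← sub_eq_zero, Finset.mul_sum, ← Finset.sum_sub_distrib]
  refine Eq.trans ?_ (main_sum (ι := ι) (p := p) hG hc hN)
  refine Finset.sum_congr rfl fun g hg => ?_
  have hv := (Finset.mem_filter.1 hg).2
  rw [Tot, eta_str hG hv hc hN hcard]
  have e1 : ∑ i, ∑ a ∈ Finset.range (len c N g i), T.Sf L (len c N g i) (yv c t g i) (a + 1) *
      ∑ j, T.Bp (len c N g j) (yv c t g j) (yv c t g i (a + 1)) a =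
      ∑ n ∈ Finset.range N, q * ξ n * ∑ i, T.Dn L (len c N g i) (yv c t g i) n := by
    have : ∀ n ∈ Finset.range N, q * ξ n * ∑ i, T.Dn L (len c N g i) (yv c t g i) n = ∑ i, q * ξ n * T.Dn L (len c N g i) (yv c t g i) n :=
      fun n _ => Finset.mul_sum _ _ _
    rw [Finset.sum_congr rfl this, Finset.sum_comm]
    refine Finset.sum_congr rfl fun i _ => ?_
    rw [xi_sum (L := L) (T := T) (N := N) _ (len_lt hv hc hN i) _ (fun n => q * ξ n)]
    refine Finset.sum_congr rfl fun a ha => ?_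
    rw [bethe_str (X := fun a => q * (ξ a - ξ (a + 1))) hv hcard hB (Finset.mem_range.1 ha)]
    ring
  have e2 : ∑ n ∈ Finset.range N, (q * ξ n + ∑ i, T.Dn L (len c N g i) (yv c t g i) n) ^ 2 =
      q ^ 2 * ∑ n ∈ Finset.range N, ξ n ^ 2 + 2 * ∑ n ∈ Finset.range N, q * ξ n * ∑ i, T.Dn L (len c N g i) (yv c t g i) n
      + ∑ n ∈ Finset.range N, (∑ i, T.Dn L (len c N g i) (yv c t g i) n) ^ 2 := by
    rw [Finset.mul_sum, Finset.mul_sum, ← Finset.sum_add_distrib, ← Finset.sum_add_distrib]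
    exact Finset.sum_congr rfl fun n _ => by ring
  rw [e1, e2]
  ring
end
end

noncomputable section

namespace TH
variable (T : TH)
lemma sig_deriv {w x : ℂ} (hw : T.th w ≠ 0) (hwx : T.th (w - x) ≠ 0) (hx : T.th x ≠ 0) :
    HasDerivAt (fun w => T.sig w x) (T.sig w x * T.phi w x) w := by
  have h1 : HasDerivAt (fun w => T.th (w - x)) (T.th1 (w - x)) w := by
    exact HasDerivAt.comp_sub_const w x (T.d0 (w - x))
  have := (h1.mul_const (T.th1 0)).div ((T.d0 w).mul_const (T.th x)) (mul_ne_zero hw hx)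
  refine HasDerivAt.congr_deriv (f := fun w => T.sig w x) this ?_
  simp only [sig, phi, rho]
  field_simp

lemma phi_deriv {w x : ℂ} (hw : T.th w ≠ 0) (hwx : T.th (w - x) ≠ 0) :
    HasDerivAt (fun w => T.phi w x) (T.phi' w x) w := by
  have h1 : HasDerivAt (fun w => T.rho (w - x)) (T.rho' (w - x)) w := by
    exact HasDerivAt.comp_sub_const w x (T.rho_hasDerivAt hwx)
  exact h1.sub (T.rho_hasDerivAt hw)
end TH

def del (n r a : ℕ) : ℂ := (if n = a then 1 else 0) - (if n = r then 1 else 0)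

lemma Dn_eq_del (T : TH) (L : ℕ → ℂ) (r : ℕ) (u : ℕ → ℂ) (n : ℕ) :
    T.Dn L r u n = ∑ a ∈ Finset.range r, T.fi L r u a * del n r a := by
  simp only [del, mul_sub, Finset.sum_sub_distrib, mul_ite, mul_one, mul_zero, TH.Dn]
  congr 1
  · simp
  · split_ifs
    · rfl
    · simp

lemma hasDerivAt_prod_log {ι : Type*} (s : Finset ι) (f : ι → ℂ → ℂ) (d : ι → ℂ) (x : ℂ)
    (h : ∀ i ∈ s, HasDerivAt (f i) (f i x * d i) x) :
    HasDerivAt (fun z => ∏ i ∈ s, f i z) ((∏ i ∈ s, f i x) * ∑ i ∈ s, d i) x := by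
  classical
  induction s using Finset.induction_on with
  | empty => simpa using hasDerivAt_const x (1 : ℂ)
  | insert i s hi ih =>
    simp only [Finset.prod_insert hi, Finset.sum_insert hi]
    refine ((h i (Finset.mem_insert_self _ _)).mul (ih fun j hj => h j (Finset.mem_insert_of_mem hj))).congr_deriv ?_
    ring

section
variable {m : ℕ} {ι : Type*} [Fintype ι] [DecidableEq ι] {T : TH} {c : Fin m → ℕ} {t : Fin m → ℂ} {N p : ℕ}

lemma LL_deriv {L : ℂ → ℕ → ℂ} {n : ℕ} {z : ℂ}
    (hL : ∀ a < N, HasDerivAt (fun z => L z a) (if n = a then 1 else 0) z) {a r : ℕ} (ha : a < N) (hr : r < N) :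
    HasDerivAt (fun z => L z a - L z r) (del n r a) z := (hL a ha).sub (hL r hr)

lemma Tg_deriv {L : ℂ → ℕ → ℂ} {n : ℕ} {z : ℂ}
    (hL : ∀ a < N, HasDerivAt (fun z => L z a) (if n = a then 1 else 0) z) (hG : Gen T (L z) t N) {g : Fin m → ι}
    (hg : Valid c N p g) (hc : ∀ i, c i + 2 ≤ N) (hN : 0 < N) :
    HasDerivAt (fun z => Tg T (L z) c t N g) (Tg T (L z) c t N g * ∑ i, T.Dn (L z) (len c N g i) (yv c t g i) n) z := by
  refine hasDerivAt_prod_log _ (fun i z => T.tg (L z) (len c N g i) (yv c t g i)) _ z fun i _ => ?_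
  rw [Dn_eq_del]
  refine hasDerivAt_prod_log _ (fun a z => T.sig (L z a - L z (len c N g i)) (yv c t g i (a + 1) - yv c t g i a)) _ z fun a ha => ?_
  have ha' := Finset.mem_range.1 ha
  have hr := len_lt hg hc hN i
  have hgd := gd_yy (t := t) hG hg ha' ha'.le (Or.inr (by omega))
  have := (T.sig_deriv (hG.hL a _ ha' hr) (hgd.2 a _ ha' hr) hgd.1).comp z (LL_deriv hL (ha'.trans hr) hr)
  refine this.congr_deriv ?_
  rw [TH.fi]; ring

lemma Dn_deriv {L : ℂ → ℕ → ℂ} {n : ℕ} {z : ℂ}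
    (hL : ∀ a < N, HasDerivAt (fun z => L z a) (if n = a then 1 else 0) z) (hG : Gen T (L z) t N) {g : Fin m → ι}
    (hg : Valid c N p g) (hc : ∀ i, c i + 2 ≤ N) (hN : 0 < N) (i : ι) :
    HasDerivAt (fun z => T.Dn (L z) (len c N g i) (yv c t g i) n)
      (∑ a ∈ Finset.range (len c N g i), T.fi' (L z) (len c N g i) (yv c t g i) a * del n (len c N g i) a ^ 2) z := by
  simp only [Dn_eq_del]
  refine HasDerivAt.fun_sum fun a ha => ?_
  have ha' := Finset.mem_range.1 ha
  have hr := len_lt hg hc hN i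
  have hgd := gd_yy (t := t) hG hg ha' ha'.le (Or.inr (by omega))
  have := ((T.phi_deriv (hG.hL a _ ha' hr) (hgd.2 a _ ha' hr)).comp z (LL_deriv hL (ha'.trans hr) hr)).mul_const (del n (len c N g i) a)
  refine this.congr_deriv ?_
  rw [TH.fi']; ring

lemma del_sum {r a : ℕ} (ha : a < r) (hr : r < N) : ∑ n ∈ Finset.range N, del n r a ^ 2 = 2 := by
  have : ∀ n ∈ Finset.range N, del n r a ^ 2 = (if n = a then 1 else 0) + (if n = r then 1 else 0) := by
    intro n _
    rw [del]
    split_ifs with h1 h2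
    · omega
    · norm_num
    · norm_num
    · norm_num
  rw [Finset.sum_congr rfl this, Finset.sum_add_distrib]
  simp [hr, ha.trans hr]
  norm_num

lemma second_deriv {κ : Type*} (S : Finset κ) (f : ℂ → ℂ) (F A : κ → ℂ → ℂ) (A' : κ → ℂ) (z0 : ℂ)
    (hf : ∀ᶠ z in 𝓝 z0, f z = ∑ g ∈ S, F g z)
    (hF : ∀ g ∈ S, ∀ᶠ z in 𝓝 z0, HasDerivAt (F g) (F g z * A g z) z) (hA : ∀ g ∈ S, HasDerivAt (A g) (A' g) z0) :
    deriv (deriv f) z0 = ∑ g ∈ S, F g z0 * (A g z0 ^ 2 + A' g) := by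
  have h1 : deriv f =ᶠ[𝓝 z0] fun z => ∑ g ∈ S, F g z * A g z := by
    have hall : ∀ᶠ z in 𝓝 z0, ∀ g ∈ S, HasDerivAt (F g) (F g z * A g z) z := (Filter.eventually_all_finset S).2 hF
    filter_upwards [hf.eventually_nhds, hall] with z hz hz2
    have : f =ᶠ[𝓝 z] fun z => ∑ g ∈ S, F g z := hz
    rw [this.deriv_eq]
    exact (HasDerivAt.fun_sum hz2).deriv
  rw [h1.deriv_eq]
  have : HasDerivAt (fun z => ∑ g ∈ S, F g z * A g z) (∑ g ∈ S, (F g z0 * A g z0 * A g z0 + F g z0 * A' g)) z0 :=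
    HasDerivAt.fun_sum fun g hg => ((hF g hg).self_of_nhds).mul (hA g hg)
  rw [this.deriv]
  exact Finset.sum_congr rfl fun g _ => by ring

def GenAll (T : TH) (c : Fin m → ℕ) (t : Fin m → ℂ) (lam : Fin N → ℂ) : Prop :=
  Gen T (ext lam) t N ∧ ∀ S : Finset (Fin m), S.Nonempty → T.th (Wt (ext lam) c S) ≠ 0

def Sp (t : Fin m → ℂ) (x : ℂ) : Prop := x = 0 ∨ (∃ k, x = t k) ∨ ∃ k l, k ≠ l ∧ x = t k - t l

lemma ext_lt (lam : Fin N → ℂ) {a : ℕ} (ha : a < N) : ext lam a = lam ⟨a, ha⟩ := by rw [_root_.ext, dif_pos ha]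

lemma gen_ev {α : Type*} {F : Filter α} (lamf : α → Fin N → ℂ)
    (ht0 : ∀ k, T.th (t k) ≠ 0) (ht1 : ∀ k l, k ≠ l → T.th (t k - t l) ≠ 0)
    (hA : ∀ i j : Fin N, i < j → ∀ x, Sp t x → ∀ᶠ y in F, T.th (lamf y i - lamf y j - x) ≠ 0)
    (hW : ∀ S : Finset (Fin m), S.Nonempty → ∀ᶠ y in F, T.th (Wt (ext (lamf y)) c S) ≠ 0) :
    ∀ᶠ y in F, GenAll T c t (lamf y) := by
  have hA' : ∀ x, Sp t x → ∀ᶠ y in F, ∀ a b, a < b → b < N → T.th (ext (lamf y) a - ext (lamf y) b - x) ≠ 0 := by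
    intro x hx
    have : ∀ᶠ y in F, ∀ i j : Fin N, i < j → T.th (lamf y i - lamf y j - x) ≠ 0 := by
      refine Filter.eventually_all.2 fun i => Filter.eventually_all.2 fun j => ?_
      by_cases h : i < j
      · filter_upwards [hA i j h x hx] with y hy _ using hy
      · exact Filter.Eventually.of_forall fun y h' => absurd h' h
    filter_upwards [this] with y hy a b hab hb
    rw [ext_lt _ (hab.trans hb), ext_lt _ hb]
    exact hy _ _ hab
  have e1 := hA' 0 (Or.inl rfl)
  have e2 : ∀ᶠ y in F, ∀ k, ∀ a b, a < b → b < N → T.th (ext (lamf y) a - ext (lamf y) b - t k) ≠ 0 :=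
    Filter.eventually_all.2 fun k => hA' _ (Or.inr (Or.inl ⟨k, rfl⟩))
  have e3 : ∀ᶠ y in F, ∀ k l, k ≠ l → ∀ a b, a < b → b < N → T.th (ext (lamf y) a - ext (lamf y) b - (t k - t l)) ≠ 0 := by
    refine Filter.eventually_all.2 fun k => Filter.eventually_all.2 fun l => ?_
    by_cases h : k = l
    · exact Filter.Eventually.of_forall fun y h' => absurd h h'
    · filter_upwards [hA' _ (Or.inr (Or.inr ⟨k, l, h, rfl⟩))] with y hy _ using hy
  have e4 : ∀ᶠ y in F, ∀ S : Finset (Fin m), S.Nonempty → T.th (Wt (ext (lamf y)) c S) ≠ 0 := by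
    refine Filter.eventually_all.2 fun S => ?_
    by_cases h : S.Nonempty
    · filter_upwards [hW S h] with y hy _ using hy
    · exact Filter.Eventually.of_forall fun y h' => absurd h' h
  filter_upwards [e1, e2, e3, e4] with y h1 h2 h3 h4
  refine ⟨⟨?_, fun k => ⟨ht0 k, h2 k⟩, fun k l hkl => ⟨ht1 k l hkl, h3 k l hkl⟩⟩, h4⟩
  intro a b hab hb
  simpa using h1 a b hab hb

lemma ext_cont (a : ℕ) : Continuous fun lam : Fin N → ℂ => ext lam a := by
  by_cases h : a < N
  · simp only [ext_lt _ h]; exact continuous_apply _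
  · simp only [_root_.ext, dif_neg h]; exact continuous_const

lemma Wt_cont (S : Finset (Fin m)) : Continuous fun lam : Fin N → ℂ => Wt (ext lam) c S := by
  unfold Wt
  exact continuous_finsetSum _ fun k _ => (ext_cont _).sub (ext_cont _)

lemma gen_open (ht0 : ∀ k, T.th (t k) ≠ 0) (ht1 : ∀ k l, k ≠ l → T.th (t k - t l) ≠ 0) {lam : Fin N → ℂ}
    (h : GenAll T c t lam) : ∀ᶠ lam' in 𝓝 lam, GenAll T c t lam' := by
  refine gen_ev (fun lam => lam) ht0 ht1 ?_ ?_
  · intro i j hij x hx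
    have hcont : Continuous fun lam : Fin N → ℂ => T.th (lam i - lam j - x) :=
      T.cont0.comp (((continuous_apply i).sub (continuous_apply j)).sub continuous_const)
    refine hcont.continuousAt.eventually_ne ?_
    have hi := ext_lt lam i.2
    have hj := ext_lt lam j.2
    rcases hx with rfl | ⟨k, rfl⟩ | ⟨k, l, hkl, rfl⟩
    · simpa [hi, hj] using h.1.hL i j hij j.2
    · simpa [hi, hj] using (h.1.h1 k).2 i j hij j.2
    · simpa [hi, hj] using (h.1.h2 k l hkl).2 i j hij j.2
  · intro S hS
    exact (T.cont0.comp (Wt_cont S)).continuousAt.eventually_ne (h.2 S hS)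
end
end

noncomputable section
section
variable {m : ℕ} {T : TH} {c : Fin m → ℕ} {t : Fin m → ℂ} {N p : ℕ}

def psiT (T : TH) (c : Fin m → ℕ) (l : Equiv.Perm (Fin m) → ℕ) (ξ : Fin N → ℂ) (t : Fin m → ℂ) (lam : Fin N → ℂ) : ℂ :=
  Complex.exp (2 * (Real.pi : ℂ) * Complex.I * ∑ j : Fin N, ξ j * lam j) *
  ∑ s : Equiv.Perm (Fin m), (l s : ℂ) * chain T (ext lam) c t m s 0

def etaS (T : TH) (c : Fin m → ℕ) (t : Fin m → ℂ) (N p : ℕ) : ℂ :=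
  (∑ i : Fin m, ∑ j ∈ Finset.univ.filter (fun j : Fin m => i < j),
              (2 * (if c i = c j then (1 : ℂ) else 0)
                - (if c i = c j + 1 ∨ c j = c i + 1 then (1 : ℂ) else 0)) * T.eta (t i - t j))
            - (N * p : ℕ) * ∑ i ∈ Finset.univ.filter (fun i : Fin m => c i = 0), T.eta (t i)

lemma ext_update_deriv (lam : Fin N → ℂ) (n : Fin N) (z : ℂ) (a : ℕ) (ha : a < N) :
    HasDerivAt (fun z => ext (Function.update lam n z) a) (if (n : ℕ) = a then 1 else 0) z := by
  simp only [ext_lt _ ha]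
  by_cases h : (n : ℕ) = a
  · subst h
    simpa using hasDerivAt_id' z
  · have hne : (⟨a, ha⟩ : Fin N) ≠ n := fun h' => h (by rw [← h'])
    simpa [h, Function.update_of_ne hne] using hasDerivAt_const z (lam ⟨a, ha⟩)

lemma exp_update_deriv (ξ lam : Fin N → ℂ) (n : Fin N) (z : ℂ) :
    HasDerivAt (fun z => Complex.exp (2 * (Real.pi : ℂ) * Complex.I * ∑ j : Fin N, ξ j * Function.update lam n z j))
      (Complex.exp (2 * (Real.pi : ℂ) * Complex.I * ∑ j : Fin N, ξ j * Function.update lam n z j) * (2 * (Real.pi : ℂ) * Complex.I * ext ξ n)) z := by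
  refine HasDerivAt.cexp ?_
  refine HasDerivAt.const_mul _ ?_
  have : HasDerivAt (fun z => ∑ j : Fin N, ξ j * Function.update lam n z j) (∑ j : Fin N, ξ j * (if (n : ℕ) = j then 1 else 0)) z := by
    refine HasDerivAt.fun_sum fun j _ => HasDerivAt.const_mul _ ?_
    have := ext_update_deriv lam n z j j.2
    simpa [ext_lt _ j.2] using this
  refine this.congr_deriv ?_
  rw [ext_lt _ n.2]
  simp [Fin.val_inj]

lemma generic_eq (hN : 0 < N) (hc : ∀ i, c i + 2 ≤ N)
    (l : Equiv.Perm (Fin m) → ℕ)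
    (hl : ∀ s : Equiv.Perm (Fin m),
      bethePoly N p m c s = l s • (∏ k ∈ Finset.range N, MvPolynomial.X k) ^ p)
    (ht0 : ∀ k, T.th (t k) ≠ 0) (ht1 : ∀ k l, k ≠ l → T.th (t k - t l) ≠ 0) (ξ : Fin N → ℂ)
    (hB : ∀ j : Fin m,
      (∑ i ∈ Finset.univ.filter (fun i : Fin m => c i = c j + 1 ∨ c j = c i + 1), T.rho (t j - t i))
        - 2 * ∑ i ∈ Finset.univ.filter (fun i : Fin m => i ≠ j ∧ c i = c j), T.rho (t j - t i)
        + (N * p : ℕ) * (if c j = 0 then (1 : ℂ) else 0) * T.rho (t j) = 2 * (Real.pi : ℂ) * Complex.I * (ext ξ (c j) - ext ξ (c j + 1)))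
    {lam : Fin N → ℂ} (hgen : GenAll T c t lam) :
    ∑ n : Fin N, deriv (deriv (fun z => psiT T c l ξ t (Function.update lam n z))) (lam n) =
    ((2 * (Real.pi : ℂ) * Complex.I) ^ 2 * ∑ n : Fin N, ξ n ^ 2
      - 2 * p * (p + 1) * ∑ b ∈ Finset.range N, ∑ a ∈ Finset.range b, T.rho' (ext lam a - ext lam b)
      + etaS T c t N p) * psiT T c l ξ t lam := by
  classical
  set q : ℂ := 2 * (Real.pi : ℂ) * Complex.I with hq
  set V := Finset.univ.filter (fun g : Fin m → Fin (N * p) => Valid c N p g) with hV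
  have hpsi : ∀ lam' : Fin N → ℂ, GenAll T c t lam' → psiT T c l ξ t lam' = 
      ∑ g ∈ V, Complex.exp (q * ∑ j : Fin N, ξ j * lam' j) * Tg T (ext lam') c t N g := by
    intro lam' h
    rw [psiT, psi_sum T (ext lam') c t hN hc h.2 ht1 ht0 l hl, Finset.mul_sum]
  have key : ∀ n : Fin N, deriv (deriv (fun z => psiT T c l ξ t (Function.update lam n z))) (lam n) =
      ∑ g ∈ V, Complex.exp (q * ∑ j : Fin N, ξ j * lam j) * Tg T (ext lam) c t N g * ((q * ext ξ n + ∑ i, T.Dn (ext lam) (len c N g i) (yv c t g i) n) ^ 2 +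
        ∑ i, ∑ a ∈ Finset.range (len c N g i), T.fi' (ext lam) (len c N g i) (yv c t g i) a * del n (len c N g i) a ^ 2) := by
    intro n
    have hcu : Continuous fun z => Function.update lam n z := continuous_const.update n continuous_id
    have hev : ∀ᶠ z in 𝓝 (lam n), GenAll T c t (Function.update lam n z) := by
      have h1 := gen_open ht0 ht1 hgen
      have h2 : Tendsto (fun z => Function.update lam n z) (𝓝 (lam n)) (𝓝 lam) := by
        have := hcu.tendsto (lam n)
        rwa [Function.update_eq_self] at this
      exact h2.eventually h1
    rw [second_deriv V _ (fun g z => Complex.exp (q * ∑ j : Fin N, ξ j * Function.update lam n z j) * Tg T (ext (Function.update lam n z)) c t N g)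
      (fun g z => q * ext ξ n + ∑ i, T.Dn (ext (Function.update lam n z)) (len c N g i) (yv c t g i) n)
      (fun g => ∑ i, ∑ a ∈ Finset.range (len c N g i), T.fi' (ext lam) (len c N g i) (yv c t g i) a * del n (len c N g i) a ^ 2)]
    · simp only [Function.update_eq_self]
    · filter_upwards [hev] with z hz using hpsi _ hz
    · intro g hg
      have hv := (Finset.mem_filter.1 hg).2
      filter_upwards [hev] with z hz
      have h1 := exp_update_deriv ξ lam n z
      have h2 := Tg_deriv (L := fun z => ext (Function.update lam n z)) (ext_update_deriv lam n z) hz.1 hv hc hN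
      refine (h1.mul h2).congr_deriv ?_
      ring
    · intro g hg
      have hv := (Finset.mem_filter.1 hg).2
      refine HasDerivAt.const_add _ (HasDerivAt.fun_sum fun i _ => ?_)
      have hG : Gen T (ext (Function.update lam n (lam n))) t N := by rw [Function.update_eq_self]; exact hgen.1
      have h2 := Dn_deriv (L := fun z => ext (Function.update lam n z)) (ext_update_deriv lam n (lam n)) hG hv hc hN i
      simpa only [Function.update_eq_self] using h2
  rw [Finset.sum_congr rfl fun n _ => key n, Finset.sum_comm, hpsi lam hgen, ← Finset.mul_sum]
  generalize Complex.exp (q * ∑ j : Fin N, ξ j * lam j) = e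
  have hes := eig_sum (ι := Fin (N * p)) (p := p) hgen.1 hc hN (by simp) (ext ξ) q hB
  have hx : ∑ n : Fin N, ξ n ^ 2 = ∑ n ∈ Finset.range N, ext ξ n ^ 2 := by
    rw [Finset.sum_range]
    exact Finset.sum_congr rfl fun n _ => by rw [ext_lt _ n.2]
  rw [hx, mul_left_comm, etaS, ← hes, Finset.mul_sum]
  refine Finset.sum_congr rfl fun g hg => ?_
  have hv := (Finset.mem_filter.1 hg).2
  rw [← Finset.mul_sum, mul_assoc, Finset.sum_add_distrib]
  congr 3
  · rw [Finset.sum_range]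
  · rw [Finset.sum_comm, Finset.mul_sum]
    refine Finset.sum_congr rfl fun i _ => ?_
    rw [Finset.sum_comm, Finset.mul_sum]
    refine Finset.sum_congr rfl fun a ha => ?_
    rw [← Finset.mul_sum, ← Finset.sum_range (fun n => del n (len c N g i) a ^ 2), del_sum (Finset.mem_range.1 ha) (len_lt hv hc hN i)]
    ring
end
end

noncomputable section
section

lemma fop_monomial (a : ℕ) (e : ℕ →₀ ℕ) (C : ℂ) :
    fop a (MvPolynomial.monomial e C) = MvPolynomial.monomial (e - Finsupp.single a 1 + Finsupp.single (a + 1) 1) (C * e a) := by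
  rw [fop, MvPolynomial.pderiv_monomial, MvPolynomial.X, MvPolynomial.monomial_mul, one_mul, add_comm]

/-- Each operator in the list acts nontrivially. -/
def GoodL (n : ℕ) : List ℕ → Prop
  | [] => True
  | x :: xs => (xs.count x < if x = 0 then n else xs.count (x - 1)) ∧ GoodL n xs

lemma foldr_fop (n : ℕ) (L : List ℕ) (h : GoodL n L) :
    ∃ (e : ℕ →₀ ℕ) (C : ℂ), C ≠ 0 ∧ L.foldr fop (MvPolynomial.X 0 ^ n) = MvPolynomial.monomial e C ∧
      ∀ a, e a + L.count a = if a = 0 then n else L.count (a - 1) := by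
  induction L with
  | nil =>
    refine ⟨Finsupp.single 0 n, 1, one_ne_zero, ?_, ?_⟩
    · simp [MvPolynomial.X_pow_eq_monomial]
    · intro a
      by_cases ha : a = 0
      · simp [ha]
      · simp [ha, Finsupp.single_apply, Ne.symm ha]
  | cons x xs ih =>
    obtain ⟨e, C, hC, h1, h2⟩ := ih h.2
    have hx := h2 x
    have hlt := h.1
    have hpos : 0 < e x := by omega
    refine ⟨e - Finsupp.single x 1 + Finsupp.single (x + 1) 1, C * e x, mul_ne_zero hC (by exact_mod_cast hpos.ne'), ?_, ?_⟩
    · rw [List.foldr_cons, h1, fop_monomial]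
    · intro a
      have ha := h2 a
      simp only [Finsupp.add_apply, Finsupp.tsub_apply, Finsupp.single_apply, List.count_cons, beq_iff_eq]
      by_cases h0 : a = 0
      · simp only [h0, if_true] at ha ⊢
        by_cases hx0 : x = 0
        · subst hx0; simp; omega
        · simp [hx0]; omega
      · simp only [h0, if_false] at ha ⊢
        by_cases hxa : x = a
        · subst hxa
          have : ¬ x = x - 1 := by omega
          simp [this]; omega
        · by_cases hxa' : x + 1 = a
          · subst hxa'; simp at ha ⊢; omega
          · have : ¬ x = a - 1 := by omega
            simp [hxa, hxa', this]; omega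

lemma goodL_of (n : ℕ) (L : List ℕ) (h : ∀ L1 x L2, L = L1 ++ x :: L2 → L2.count x < if x = 0 then n else L2.count (x - 1)) :
    GoodL n L := by
  induction L with
  | nil => trivial
  | cons x xs ih =>
    refine ⟨h [] x xs rfl, ih fun L1 y L2 e => h (x :: L1) y L2 (by rw [e]; rfl)⟩

lemma count_map_finRange {m : ℕ} (f : Fin m → ℕ) (a : ℕ) :
    ((List.finRange m).map f).count a = (Finset.univ.filter (fun i => f i = a)).card := by
  rw [List.count, List.countP_map, List.countP_eq_length_filter,
    ← List.toFinset_card_of_nodup ((List.nodup_finRange m).filter _)]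
  congr 1
  ext x
  simp

lemma exists_perm {N p m : ℕ} (hp : 1 ≤ p) (c : Fin m → ℕ) (hc : ∀ i, c i + 2 ≤ N)
    (hccard : ∀ j : ℕ, j + 2 ≤ N →
      (Finset.univ.filter (fun i : Fin m => c i = j)).card = (N - 1 - j) * p)
    (l : Equiv.Perm (Fin m) → ℕ)
    (hl : ∀ s : Equiv.Perm (Fin m),
      bethePoly N p m c s = l s • (∏ k ∈ Finset.range N, MvPolynomial.X k) ^ p)
    (i j : ℕ) (hij : i < j) (hj : j < N) (lam : Fin N → ℂ) :
    ∃ s : Equiv.Perm (Fin m), l s ≠ 0 ∧ ∃ q, Wcoef c s lam q = ext lam i - ext lam j := by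
  classical
  have hr : ∀ a : ℕ, ∃ k : Option (Fin m), a + 2 ≤ N → ∃ k', k = some k' ∧ c k' = a := by
    intro a
    by_cases ha : a + 2 ≤ N
    · have : 0 < (Finset.univ.filter (fun i : Fin m => c i = a)).card := by
        rw [hccard a ha]
        exact Nat.mul_pos (by omega) hp
      obtain ⟨k, hk⟩ := Finset.card_pos.1 this
      exact ⟨some k, fun _ => ⟨k, rfl, (Finset.mem_filter.1 hk).2⟩⟩
    · exact ⟨none, fun h => absurd h ha⟩
  obtain ⟨k0, hk0, hk0'⟩ := (hr i).choose_spec (by omega)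
  have hr' : ∀ a : ℕ, ∃ k : Fin m, a + 2 ≤ N → c k = a := by
    intro a
    by_cases ha : a + 2 ≤ N
    · obtain ⟨k, _, hk⟩ := (hr a).choose_spec ha
      exact ⟨k, fun _ => hk⟩
    · exact ⟨k0, fun h => absurd h ha⟩
  choose r hr using hr'
  set A : Finset (Fin m) := (Finset.Ico i j).image r with hA
  have hrinj : Set.InjOn r (Finset.Ico i j : Finset ℕ) := by
    intro a ha b hb e
    rw [Finset.coe_Ico, Set.mem_Ico] at ha hb
    rw [← hr a (by omega), ← hr b (by omega), e]
  have hAmem : ∀ k ∈ A, k = r (c k) := by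
    intro k hk
    obtain ⟨a, ha, rfl⟩ := Finset.mem_image.1 hk
    rw [Finset.mem_Ico] at ha
    rw [hr a (by omega)]
  set key : Fin m → ℕ := fun k => if k ∈ A then 0 else N - c k with hkey
  set s : Equiv.Perm (Fin m) := Tuple.sort key with hs
  have hmono : Monotone (key ∘ s) := Tuple.monotone_sort key
  have hnon : ((Finset.univ.filter fun x => s x ∈ A)).Nonempty := by
    refine ⟨s.symm (r i), ?_⟩
    simp only [Finset.mem_filter, Finset.mem_univ, true_and, Equiv.apply_symm_apply]
    exact Finset.mem_image_of_mem _ (Finset.mem_Ico.2 ⟨le_rfl, hij⟩)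
  refine ⟨s, ?_, ((Finset.univ.filter fun x => s x ∈ A)).max' hnon, ?_⟩
  · intro h0
    have hb := hl s
    rw [h0, zero_smul] at hb
    set f : Fin m → ℕ := fun x => c (s x) with hf
    have hcnt : ∀ a, a + 2 ≤ N → ((List.finRange m).map f).count a = (N - 1 - a) * p := by
      intro a ha
      rw [count_map_finRange, ← hccard a ha]
      refine Finset.card_bij (fun x _ => s x) ?_ ?_ ?_
      · intro x hx; simpa [hf] using hx
      · intro x _ y _ e; exact s.injective e
      · intro y hy; exact ⟨s.symm y, by simpa [hf] using hy, by simp⟩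
    have hgood : GoodL (N * p) ((List.finRange m).map f) := by
      refine goodL_of _ _ fun L1 x L2 e => ?_
      obtain ⟨A1, A2', e1, e2, e3⟩ := List.map_eq_append_iff.1 e
      obtain ⟨q, A2, rfl, e4, e5⟩ := List.map_eq_cons_iff.1 e3
      have hx : x + 2 ≤ N := by rw [← e4]; exact hc _
      have h1 := hcnt x hx
      rw [e, List.count_append, List.count_cons_self] at h1
      by_cases h0 : x = 0
      · subst h0
        simp only [if_true]
        have : (N - 1 - 0) * p ≤ N * p := Nat.mul_le_mul_right _ (by omega)
        omega
      · simp only [h0, if_false]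
        have h2 := hcnt (x - 1) (by omega)
        rw [e, List.count_append, List.count_cons_of_ne (by omega)] at h2
        have h3 : L1.count (x - 1) ≤ 1 := by
          rw [← e2, List.count, List.countP_map, List.countP_eq_length_filter]
          have hnd : (A1 ++ q :: A2).Nodup := e1 ▸ List.nodup_finRange m
          have hnd1 : A1.Nodup := (List.nodup_append.1 hnd).1
          have hpw : (A1 ++ q :: A2).Pairwise (· < ·) := e1 ▸ List.pairwise_lt_finRange m
          rw [← List.toFinset_card_of_nodup (hnd1.filter _)]
          refine (Finset.card_le_card (t := {s.symm (r (x - 1))}) ?_).trans (by simp)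
          intro q' hq'
          simp only [List.mem_toFinset, List.mem_filter, Function.comp, beq_iff_eq] at hq'
          have hlt : q' < q := (List.pairwise_append.1 hpw).2.2 q' hq'.1 q (by simp)
          have hm := hmono hlt.le
          have e6 : c (s q') = x - 1 := hq'.2
          have e7 : c (s q) = x := e4
          have hin : s q' ∈ A := by
            by_contra hna
            simp only [Function.comp, hkey, if_neg hna, e6, e7] at hm
            split_ifs at hm <;> omega
          rw [Finset.mem_singleton, Equiv.eq_symm_apply, hAmem _ hin, e6]
        have : (N - 1 - (x - 1)) * p = (N - 1 - x) * p + p := by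
          have : N - 1 - (x - 1) = N - 1 - x + 1 := by omega
          rw [this]; ring
        omega
    obtain ⟨e, C, hC, h1, _⟩ := foldr_fop _ _ hgood
    rw [List.foldr_map] at h1
    have : bethePoly N p m c s = MvPolynomial.monomial e C := h1
    rw [hb] at this
    exact hC (MvPolynomial.monomial_eq_zero.1 this.symm)
  · set q := ((Finset.univ.filter fun x => s x ∈ A)).max' hnon with hq
    have hqA : s q ∈ A := (Finset.mem_filter.1 (Finset.max'_mem _ hnon)).2
    have hset : Finset.univ.filter (fun x : Fin m => x ≤ q) = Finset.univ.filter fun x => s x ∈ A := by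
      ext x
      simp only [Finset.mem_filter, Finset.mem_univ, true_and]
      constructor
      · intro hx
        have hm := hmono hx
        by_contra hna
        simp only [Function.comp, hkey, if_neg hna, if_pos hqA] at hm
        have := hc (s x)
        omega
      · intro hx
        exact Finset.le_max' _ _ (by simpa using hx)
    rw [Wcoef, hset]
    have : ∑ x ∈ Finset.univ.filter (fun x => s x ∈ A), (ext lam (c (s x)) - ext lam (c (s x) + 1)) =
        ∑ k ∈ A, (ext lam (c k) - ext lam (c k + 1)) := by
      refine Finset.sum_bij (fun x _ => s x) ?_ ?_ ?_ ?_
      · intro x hx; exact (Finset.mem_filter.1 hx).2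
      · intro x _ y _ e; exact s.injective e
      · intro y hy; exact ⟨s.symm y, by simpa using hy, by simp⟩
      · intro x _; rfl
    rw [this, hA, Finset.sum_image hrinj]
    have h2 : ∑ a ∈ Finset.Ico i j, (ext lam (c (r a)) - ext lam (c (r a) + 1)) = ∑ a ∈ Finset.Ico i j, (ext lam a - ext lam (a + 1)) := by
      refine Finset.sum_congr rfl fun a ha => ?_
      rw [Finset.mem_Ico] at ha
      rw [hr a (by omega)]
    rw [h2]
    have h3 := Finset.sum_Ico_sub (fun a => ext lam a) hij.le
    rw [← neg_inj, ← Finset.sum_neg_distrib]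
    simpa using h3
end
end

noncomputable section
section
variable {m : ℕ} {T : TH} {c : Fin m → ℕ} {t : Fin m → ℂ} {N p : ℕ}

lemma punct_line (T : TH) (b a : ℂ) (ha : a ≠ 0) : ∀ᶠ e in 𝓝[≠] (0 : ℂ), T.th (b + e * a) ≠ 0 := by
  have h : Tendsto (fun e : ℂ => b + e * a) (𝓝[≠] 0) (𝓝[≠] b) := by
    refine tendsto_nhdsWithin_iff.2 ⟨?_, ?_⟩
    · have : Continuous fun e : ℂ => b + e * a := by fun_prop
      have := this.tendsto 0
      simp only [zero_mul, add_zero] at this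
      exact this.mono_left nhdsWithin_le_nhds
    · filter_upwards [self_mem_nhdsWithin] with e he
      simpa using ⟨he, ha⟩
  exact h.eventually (T.punct b)

/-- Moving in a strictly decreasing direction makes a point generic. -/
lemma gen_line (hc : ∀ i, c i + 2 ≤ N)
    (ht0 : ∀ k, T.th (t k) ≠ 0) (ht1 : ∀ k l, k ≠ l → T.th (t k - t l) ≠ 0) (lam : Fin N → ℂ) :
    ∀ᶠ e in 𝓝[≠] (0 : ℂ), GenAll T c t (fun i => lam i - e * (i : ℕ)) := by
  refine gen_ev (fun (e : ℂ) i => lam i - e * (i : ℕ)) ht0 ht1 ?_ ?_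
  · intro i j hij x _
    filter_upwards [punct_line T (lam i - lam j - x) ((j : ℕ) - (i : ℕ) : ℂ)
      (sub_ne_zero.2 (by exact_mod_cast (Fin.lt_def.1 hij).ne'))] with e he
    convert he using 2
    ring
  · intro S hS
    filter_upwards [punct_line T (Wt (ext lam) c S) (S.card : ℂ)
      (by exact_mod_cast (Finset.card_pos.2 hS).ne')] with e he
    convert he using 2
    unfold Wt
    rw [← nsmul_eq_mul', ← Finset.sum_const, ← Finset.sum_add_distrib]
    refine Finset.sum_congr rfl fun k _ => ?_
    have := hc k
    rw [ext_lt _ (show c k < N by omega), ext_lt _ (show c k + 1 < N by omega),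
      ext_lt _ (show c k < N by omega), ext_lt _ (show c k + 1 < N by omega)]
    push_cast
    ring

lemma ext_analytic (lam : Fin N → ℂ) (a : ℕ) : AnalyticAt ℂ (fun lam : Fin N → ℂ => ext lam a) lam := by
  by_cases h : a < N
  · simp only [ext_lt _ h]
    exact (ContinuousLinearMap.proj (R := ℂ) (φ := fun _ : Fin N => ℂ) (⟨a, h⟩ : Fin N)).analyticAt lam
  · simp only [_root_.ext, dif_neg h]; exact analyticAt_const

lemma psiT_analytic (l : Equiv.Perm (Fin m) → ℕ) (ξ : Fin N → ℂ)
    (ht0 : ∀ k, T.th (t k) ≠ 0) (ht1 : ∀ k l, k ≠ l → T.th (t k - t l) ≠ 0) (lam : Fin N → ℂ)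
    (hlam : ∀ s : Equiv.Perm (Fin m), l s ≠ 0 → ∀ j : Fin m, T.th (Wcoef c s lam j) ≠ 0) :
    AnalyticAt ℂ (psiT T c l ξ t) lam := by
  unfold psiT
  refine AnalyticAt.mul ?_ ?_
  · refine AnalyticAt.cexp ?_
    refine analyticAt_const.mul ?_
    refine Finset.analyticAt_fun_sum _ fun j _ => analyticAt_const.mul ?_
    have := ext_analytic lam j
    simpa only [ext_lt _ j.2] using this
  · refine Finset.analyticAt_fun_sum _ fun s _ => ?_
    by_cases hs : l s = 0
    · simp only [hs, Nat.cast_zero, zero_mul]; exact analyticAt_const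
    refine analyticAt_const.mul ?_
    unfold chain
    refine Finset.analyticAt_fun_prod _ fun j _ => ?_
    have hW : AnalyticAt ℂ (fun lam : Fin N → ℂ => ∑ i ∈ Finset.univ.filter (fun i : Fin m => i ≤ j), (ext lam (c (s i)) - ext lam (c (s i) + 1))) lam :=
      Finset.analyticAt_fun_sum _ fun i _ => (ext_analytic _ _).sub (ext_analytic _ _)
    have hx : T.th (t (s j) - if h : (j : ℕ) + 1 < m then t (s ⟨(j : ℕ) + 1, h⟩) else 0) ≠ 0 := by
      split_ifs with h
      · refine ht1 _ _ fun e => ?_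
        have := congrArg Fin.val (s.injective e)
        simp at this
      · rw [sub_zero]; exact ht0 _
    unfold TH.sig
    have h1 := hlam s hs j
    refine AnalyticAt.div ?_ ?_ (mul_ne_zero h1 hx)
    · exact ((T.analytic _).fun_comp (hW.sub analyticAt_const)).mul analyticAt_const
    · exact ((T.analytic _).fun_comp hW).mul analyticAt_const

lemma update_hasDerivAt (y : Fin N → ℂ) (n : Fin N) (z : ℂ) :
    HasDerivAt (fun z => Function.update y n z) (Pi.single n 1) z := by
  refine hasDerivAt_pi.2 fun i => ?_
  by_cases h : i = n
  · subst h; simpa using hasDerivAt_id' z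
  · simpa [h] using hasDerivAt_const z (y i)

lemma deriv_upd_eq {f : (Fin N → ℂ) → ℂ} {y : Fin N → ℂ} (n : Fin N) (hf : DifferentiableAt ℂ f y) :
    deriv (fun z => f (Function.update y n z)) (y n) = fderiv ℂ f y (Pi.single n 1) := by
  have h1 : HasFDerivAt f (fderiv ℂ f y) (Function.update y n (y n)) := by
    rw [Function.update_eq_self]; exact hf.hasFDerivAt
  exact (h1.comp_hasDerivAt (y n) (update_hasDerivAt y n (y n))).deriv

lemma cont_second {f : (Fin N → ℂ) → ℂ} {lam : Fin N → ℂ} (n : Fin N) (hf : AnalyticAt ℂ f lam) :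
    ContinuousAt (fun y : Fin N → ℂ => deriv (deriv (fun z => f (Function.update y n z))) (y n)) lam := by
  set g : (Fin N → ℂ) → ℂ := fun y => fderiv ℂ f y (Pi.single n 1) with hg
  have hga : AnalyticAt ℂ g lam := ((ContinuousLinearMap.apply ℂ ℂ (Pi.single n 1 : Fin N → ℂ)).analyticAt _).fun_comp hf.fderiv
  have hgd : AnalyticAt ℂ (fun y => fderiv ℂ g y (Pi.single n 1)) lam := ((ContinuousLinearMap.apply ℂ ℂ (Pi.single n 1 : Fin N → ℂ)).analyticAt _).fun_comp hga.fderiv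
  refine hgd.continuousAt.congr ?_
  filter_upwards [hf.eventually_analyticAt.eventually_nhds, hga.eventually_analyticAt] with y hy hy2
  have hcu : Continuous fun z => Function.update y n z := continuous_const.update n continuous_id
  have h2 : Tendsto (fun z => Function.update y n z) (𝓝 (y n)) (𝓝 y) := by
    have := hcu.tendsto (y n)
    rwa [Function.update_eq_self] at this
  have : deriv (fun z => f (Function.update y n z)) =ᶠ[𝓝 (y n)] fun z => g (Function.update y n z) := by
    filter_upwards [h2.eventually hy] with z hz
    have := deriv_upd_eq n hz.differentiableAt
    simpa using this
  rw [this.deriv_eq, deriv_upd_eq n hy2.differentiableAt]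

lemma rho'_cont {x : ℂ} (hx : T.th x ≠ 0) : ContinuousAt T.rho' x := by
  unfold TH.rho' TH.rho
  have h0 := T.cont0.continuousAt (x := x)
  exact (T.cont2.continuousAt.div h0 hx).sub ((T.cont1.continuousAt.div h0 hx).pow 2)

lemma all_eq (hN : 0 < N) (hc : ∀ i, c i + 2 ≤ N)
    (l : Equiv.Perm (Fin m) → ℕ)
    (hl : ∀ s : Equiv.Perm (Fin m),
      bethePoly N p m c s = l s • (∏ k ∈ Finset.range N, MvPolynomial.X k) ^ p)
    (ht0 : ∀ k, T.th (t k) ≠ 0) (ht1 : ∀ k l, k ≠ l → T.th (t k - t l) ≠ 0) (ξ : Fin N → ℂ)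
    (hB : ∀ j : Fin m,
      (∑ i ∈ Finset.univ.filter (fun i : Fin m => c i = c j + 1 ∨ c j = c i + 1), T.rho (t j - t i))
        - 2 * ∑ i ∈ Finset.univ.filter (fun i : Fin m => i ≠ j ∧ c i = c j), T.rho (t j - t i)
        + (N * p : ℕ) * (if c j = 0 then (1 : ℂ) else 0) * T.rho (t j) = 2 * (Real.pi : ℂ) * Complex.I * (ext ξ (c j) - ext ξ (c j + 1)))
    {lam : Fin N → ℂ}
    (hlam : ∀ s : Equiv.Perm (Fin m), l s ≠ 0 → ∀ j : Fin m, T.th (Wcoef c s lam j) ≠ 0)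
    (hd : ∀ i j : ℕ, i < j → j < N → T.th (ext lam i - ext lam j) ≠ 0) :
    ∑ n : Fin N, deriv (deriv (fun z => psiT T c l ξ t (Function.update lam n z))) (lam n) =
    ((2 * (Real.pi : ℂ) * Complex.I) ^ 2 * ∑ n : Fin N, ξ n ^ 2
      - 2 * p * (p + 1) * ∑ b ∈ Finset.range N, ∑ a ∈ Finset.range b, T.rho' (ext lam a - ext lam b)
      + etaS T c t N p) * psiT T c l ξ t lam := by
  have han := psiT_analytic (T := T) (c := c) (t := t) l ξ ht0 ht1 lam hlam
  have hA : ContinuousAt (fun lam => ∑ n : Fin N, deriv (deriv (fun z => psiT T c l ξ t (Function.update lam n z))) (lam n)) lam :=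
    tendsto_finsetSum _ fun n _ => cont_second n han
  have hBc : ContinuousAt (fun lam => ((2 * (Real.pi : ℂ) * Complex.I) ^ 2 * ∑ n : Fin N, ξ n ^ 2
      - 2 * p * (p + 1) * ∑ b ∈ Finset.range N, ∑ a ∈ Finset.range b, T.rho' (ext lam a - ext lam b)
      + etaS T c t N p) * psiT T c l ξ t lam) lam := by
    refine ContinuousAt.mul (((continuousAt_const).sub (continuousAt_const.mul ?_)).add continuousAt_const) han.continuousAt
    refine tendsto_finsetSum _ fun b hb => tendsto_finsetSum _ fun a ha => ?_
    rw [Finset.mem_range] at hb ha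
    have h1 : Continuous fun lam : Fin N → ℂ => ext lam a - ext lam b := (ext_cont a).sub (ext_cont b)
    exact ContinuousAt.comp (f := fun lam : Fin N → ℂ => ext lam a - ext lam b) (rho'_cont (hd a b ha hb)) h1.continuousAt
  have hγ : Tendsto (fun (e : ℂ) (i : Fin N) => lam i - e * (i : ℕ)) (𝓝[≠] 0) (𝓝 lam) := by
    have : Continuous fun (e : ℂ) (i : Fin N) => lam i - e * (i : ℕ) := by fun_prop
    have := this.tendsto 0
    simp only [zero_mul, sub_zero] at this
    exact this.mono_left nhdsWithin_le_nhds
  have h1 := hA.tendsto.comp hγ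
  have h2 := hBc.tendsto.comp hγ
  refine tendsto_nhds_unique (h1.congr' ?_) h2
  filter_upwards [gen_line hc ht0 ht1 lam] with e he
  exact generic_eq hN hc l hl ht0 ht1 ξ hB he

lemma dsum (F : ℕ → ℕ → ℂ) : ∑ b ∈ Finset.range N, ∑ a ∈ Finset.range b, F a b =
    ∑ i : Fin N, ∑ j ∈ Finset.univ.filter (fun j : Fin N => i < j), F i j := by
  have h : ∀ b ∈ Finset.range N, ∑ a ∈ Finset.range b, F a b = ∑ a ∈ Finset.range N, if a < b then F a b else 0 := by
    intro b hb
    rw [Finset.mem_range] at hb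
    rw [← Finset.sum_filter]
    refine Finset.sum_congr ?_ fun _ _ => rfl
    ext a; simp; omega
  rw [Finset.sum_congr rfl h, Finset.sum_comm, Finset.sum_range]
  refine Finset.sum_congr rfl fun i _ => ?_
  rw [Finset.sum_range, Finset.sum_filter]
  rfl
end
end

/-- Bethe ansatz for the elliptic Calogero–Moser system: if `t` satisfies
the Bethe ansatz equations, then `ψ` is an eigenfunction of the elliptic Calogero–Moser
Hamiltonian `H_{N,p}` with the stated eigenvalue `ε`.  All indexing is 0-based: color
`j` is the paper's `j+1`, coordinate `λ ⟨k⟩` is the paper's `λ_{k+1}`, and `c i = 0`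
corresponds to the paper's `c(i) = 1`. -/
theorem bethe_ansatz_eigenfunction (N p : ℕ) (hN : 2 ≤ N) (hp : 1 ≤ p)
    (m : ℕ) (hm : 2 * m = N * (N - 1) * p)
    (c : Fin m → ℕ) (hcmono : Monotone c) (hcrange : ∀ i, c i + 2 ≤ N)
    (hccard : ∀ j : ℕ, j + 2 ≤ N →
      (Finset.univ.filter (fun i : Fin m => c i = j)).card = (N - 1 - j) * p)
    (l : Equiv.Perm (Fin m) → ℕ)
    (hl : ∀ s : Equiv.Perm (Fin m),
      bethePoly N p m c s = l s • (∏ k ∈ Finset.range N, MvPolynomial.X k) ^ p)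
    (τ : ℂ) (hτ : 0 < τ.im) (ξ : Fin N → ℂ) (t : Fin m → ℂ)
    (ht0 : ∀ i, ¬ inLattice τ (t i))
    (ht1 : ∀ i j, i ≠ j → ¬ inLattice τ (t i - t j))
    (hBethe : ∀ j : Fin m,
      (∑ i ∈ Finset.univ.filter (fun i : Fin m => c i = c j + 1 ∨ c j = c i + 1),
          rhoF (t j - t i) τ)
        - 2 * ∑ i ∈ Finset.univ.filter (fun i : Fin m => i ≠ j ∧ c i = c j),
            rhoF (t j - t i) τ
        + (N * p : ℕ) * (if c j = 0 then (1 : ℂ) else 0) * rhoF (t j) τ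
      = 2 * (Real.pi : ℂ) * Complex.I * (ext ξ (c j) - ext ξ (c j + 1)))
    (lam : Fin N → ℂ)
    (hlam : ∀ s : Equiv.Perm (Fin m), l s ≠ 0 → ∀ j : Fin m,
      ¬ inLattice τ (Wcoef c s lam j)) :
    -(∑ i : Fin N, deriv (deriv (fun z => psiF c l τ ξ t (Function.update lam i z))) (lam i))
      - 2 * (p : ℂ) * ((p : ℂ) + 1) *
          (∑ i : Fin N, ∑ j ∈ Finset.univ.filter (fun j : Fin N => i < j),
            deriv (fun z => rhoF z τ) (lam i - lam j)) * psiF c l τ ξ t lam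
    = (4 * (Real.pi : ℂ) ^ 2 * ∑ j : Fin N, ξ j ^ 2
        - 4 * (Real.pi : ℂ) * Complex.I *
          ((∑ i : Fin m, ∑ j ∈ Finset.univ.filter (fun j : Fin m => i < j),
              (2 * (if c i = c j then (1 : ℂ) else 0)
                - (if c i = c j + 1 ∨ c j = c i + 1 then (1 : ℂ) else 0)) *
                (deriv (fun τ' => EF (t i - t j) τ') τ / EF (t i - t j) τ))
            - (N * p : ℕ) * ∑ i ∈ Finset.univ.filter (fun i : Fin m => c i = 0),
                deriv (fun τ' => EF (t i) τ') τ / EF (t i) τ))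
        * psiF c l τ ξ t lam := by
  by_cases k0 : theta1' 0 τ = 0
  · have hm0 : 0 < m := by
      rcases Nat.eq_zero_or_pos m with h | h
      · exfalso
        have : 0 < N * (N - 1) * p := Nat.mul_pos (Nat.mul_pos (by omega) (by omega)) hp
        omega
      · exact h
    have hz : ∀ lam', psiF c l τ ξ t lam' = 0 := by
      intro lam'
      unfold psiF
      refine mul_eq_zero_of_right _ (Finset.sum_eq_zero ?_)
      intro s _
      rw [Finset.prod_eq_zero (Finset.mem_univ ⟨0, hm0⟩), mul_zero]
      simp [sigmaF, k0]
    simp [hz]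
  · set T := thJ τ hτ k0 with hT
    have h0 : ∀ k, T.th (t k) ≠ 0 := fun k => th_ne hτ k0 (ht0 k)
    have h1 : ∀ k k', k ≠ k' → T.th (t k - t k') ≠ 0 := fun k k' h => th_ne hτ k0 (ht1 k k' h)
    have hW : ∀ s : Equiv.Perm (Fin m), l s ≠ 0 → ∀ j : Fin m, T.th (Wcoef c s lam j) ≠ 0 :=
      fun s hs j => th_ne hτ k0 (hlam s hs j)
    have hd : ∀ i j : ℕ, i < j → j < N → T.th (ext lam i - ext lam j) ≠ 0 := by
      intro i j hij hj
      obtain ⟨s, hs, q, hq⟩ := exists_perm hp c hcrange hccard l hl i j hij hj lam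
      rw [← hq]
      exact hW s hs q
    have hpsi : ∀ lam', psiF c l τ ξ t lam' = psiT T c l ξ t lam' := fun _ => rfl
    have key := all_eq (T := T) (by omega) hcrange l hl h0 h1 ξ hBethe hW hd
    simp only [hpsi]
    rw [key, dsum (fun a b => T.rho' (ext lam a - ext lam b))]
    have hr : ∑ i : Fin N, ∑ j ∈ Finset.univ.filter (fun j : Fin N => i < j), deriv (fun z => rhoF z τ) (lam i - lam j) =
        ∑ i : Fin N, ∑ j ∈ Finset.univ.filter (fun j : Fin N => i < j), T.rho' (ext lam i - ext lam j) := by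
      refine Finset.sum_congr rfl fun i _ => Finset.sum_congr rfl fun j hj => ?_
      have hd' := hd i j (Finset.mem_filter.1 hj).2 j.2
      rw [ext_lt _ i.2, ext_lt _ j.2] at hd' ⊢
      exact (T.rho_hasDerivAt hd').deriv
    have he : 4 * (Real.pi : ℂ) * Complex.I *
          ((∑ i : Fin m, ∑ j ∈ Finset.univ.filter (fun j : Fin m => i < j),
              (2 * (if c i = c j then (1 : ℂ) else 0)
                - (if c i = c j + 1 ∨ c j = c i + 1 then (1 : ℂ) else 0)) *
                (deriv (fun τ' => EF (t i - t j) τ') τ / EF (t i - t j) τ))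
            - (N * p : ℕ) * ∑ i ∈ Finset.univ.filter (fun i : Fin m => c i = 0),
                deriv (fun τ' => EF (t i) τ') τ / EF (t i) τ) = etaS T c t N p := by
      rw [etaS, mul_sub, Finset.mul_sum, mul_left_comm]
      congr 1
      · refine Finset.sum_congr rfl fun i _ => ?_
        rw [Finset.mul_sum]
        refine Finset.sum_congr rfl fun j hj => ?_
        rw [mul_left_comm, eta_link hτ k0 (h1 i j (Finset.mem_filter.1 hj).2.ne)]
      · congr 1
        rw [Finset.mul_sum]
        refine Finset.sum_congr rfl fun i _ => ?_
        rw [eta_link hτ k0 (h0 i)]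
    rw [hr, he]
    have hI : (2 * (Real.pi : ℂ) * Complex.I) ^ 2 = - (4 * (Real.pi : ℂ) ^ 2) := by
      rw [mul_pow, Complex.I_sq]; ring
    rw [hI]
    ring
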